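/- Let f ≥ 3 be an odd integer, let S = PSL₂(3^f), and let G be a group with Inn(S) < G ≤ Aut(S), where S is identified with Inn(S). Then G has a non-trivial rational element x ∈ Inn(S) of odd order if and only if G has a rational irreducible complex character of even degree whose kernel does not contain Inn(S). -/

import Mathlib

open CategoryTheory

/-- An element `x` of a finite group is *rational* if it is conjugate to every
generator of the cyclic group `⟨x⟩`. -/
def IsRationalElement {G : Type*} [Group G] (x : G) : Prop :=
  ∀ y : G, Subgroup.zpowers y = Subgroup.zpowers x → IsConj x y

instance : Fact (Nat.Prime 3) := ⟨by norm_num⟩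

/-- `SL₂(F)`. -/
abbrev SL2 (F : Type*) [CommRing F] := Matrix.SpecialLinearGroup (Fin 2) F

/-- `PSL₂(F) = SL₂(F)/Z(SL₂(F))`. -/
abbrev PSL2 (F : Type*) [CommRing F] := SL2 F ⧸ Subgroup.center (SL2 F)

/-- `PGL₂(F) = GL₂(F)/Z(GL₂(F))`. -/
abbrev PGL2 (F : Type*) [CommRing F] :=
  Matrix.GeneralLinearGroup (Fin 2) F ⧸
    Subgroup.center (Matrix.GeneralLinearGroup (Fin 2) F)

/-- The subgroup of inner automorphisms of `S` inside `Aut(S)`. -/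
def innAut (S : Type*) [Group S] : Subgroup (MulAut S) :=
  (MulAut.conj : S →* MulAut S).range

instance innAut_normal (S : Type*) [Group S] : (innAut S).Normal := by
  constructor
  rintro α ⟨s, rfl⟩ β
  refine ⟨β s, ?_⟩
  ext x
  simp [MulAut.conj]


set_option linter.unusedSectionVars false
set_option linter.style.haveILetI false
set_option linter.unusedFintypeInType false
set_option linter.unusedDecidableInType false

section PartP1

section CharTheory

variable {G H : Type} [Group G] [Fintype G] [Group H] [Fintype H]

/-- The (bilinear) inner product of functions on a finite group. -/
noncomputable def ip (f h : G → ℂ) : ℂ := (Nat.card G : ℂ)⁻¹ * ∑ g, f g * h g⁻¹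

def IsChar (χ : G → ℂ) : Prop := ∃ V : FDRep ℂ G, V.character = χ

def IsIrr (χ : G → ℂ) : Prop := ∃ V : FDRep ℂ G, Simple V ∧ V.character = χ

def IsClassFn (f : G → ℂ) : Prop := ∀ g h : G, f (h * g * h⁻¹) = f g

lemma ip_comm (f h : G → ℂ) : ip f h = ip h f := by
  unfold ip
  congr 1
  refine Fintype.sum_equiv (Equiv.inv G) _ _ (fun g => ?_)
  simp [mul_comm]

lemma ip_add_left (f f' h : G → ℂ) : ip (f + f') h = ip f h + ip f' h := by
  simp [ip, add_mul, Finset.sum_add_distrib, mul_add]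

lemma ip_sub_left (f f' h : G → ℂ) : ip (f - f') h = ip f h - ip f' h := by
  simp [ip, sub_mul, Finset.sum_sub_distrib, mul_sub]

lemma ip_smul_left (c : ℂ) (f h : G → ℂ) : ip (c • f) h = c * ip f h := by
  simp only [ip, Pi.smul_apply, smul_eq_mul, Finset.mul_sum]
  refine Finset.sum_congr rfl (fun g _ => by ring)

lemma ip_add_right (f f' h : G → ℂ) : ip h (f + f') = ip h f + ip h f' := by
  rw [ip_comm, ip_add_left, ip_comm f, ip_comm f']

lemma ip_sub_right (f f' h : G → ℂ) : ip h (f - f') = ip h f - ip h f' := by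
  rw [ip_comm, ip_sub_left, ip_comm f, ip_comm f']

lemma ip_smul_right (c : ℂ) (f h : G → ℂ) : ip f (c • h) = c * ip f h := by
  rw [ip_comm, ip_smul_left, ip_comm]

lemma ip_zero_left (h : G → ℂ) : ip 0 h = 0 := by simp [ip]

lemma ip_sum_left {ι : Type*} (s : Finset ι) (F : ι → G → ℂ) (h : G → ℂ) :
    ip (∑ i ∈ s, F i) h = ∑ i ∈ s, ip (F i) h := by
  classical
  induction s using Finset.induction_on with
  | empty => simp [ip_zero_left]
  | insert a s ha ih => rw [Finset.sum_insert ha, Finset.sum_insert ha, ip_add_left, ih]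

lemma ip_sum_right {ι : Type*} (s : Finset ι) (F : ι → G → ℂ) (h : G → ℂ) :
    ip h (∑ i ∈ s, F i) = ∑ i ∈ s, ip h (F i) := by
  rw [ip_comm, ip_sum_left]
  exact Finset.sum_congr rfl (fun i _ => ip_comm _ _)

noncomputable instance invCard : Invertible (Nat.card G : ℂ) :=
  invertibleOfNonzero (Nat.cast_ne_zero.mpr Nat.card_pos.ne')

lemma IsIrr.isChar {χ : G → ℂ} (h : IsIrr χ) : IsChar χ := by
  obtain ⟨V, _, rfl⟩ := h; exact ⟨V, rfl⟩

lemma ip_nat {χ φ : G → ℂ} (h : IsChar χ) (h' : IsChar φ) : ∃ n : ℕ, ip χ φ = n := by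
  obtain ⟨V, rfl⟩ := h
  obtain ⟨W, rfl⟩ := h'
  exact ⟨_, FDRep.scalar_product_char_eq_finrank_equivariant W V⟩

lemma isIrr_iff {χ : G → ℂ} : IsIrr χ ↔ IsChar χ ∧ ip χ χ = 1 := by
  have key : ∀ V : FDRep ℂ G, Simple V ↔ ip V.character V.character = 1 := by
    intro V
    rw [FDRep.simple_iff_char_is_norm_one, ip]
    have : (Nat.card G : ℂ) ≠ 0 := (Nat.cast_ne_zero.mpr Nat.card_pos.ne')
    rw [inv_mul_eq_iff_eq_mul₀ this, mul_one]
  constructor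
  · rintro ⟨V, hV, rfl⟩; exact ⟨⟨V, rfl⟩, (key V).1 hV⟩
  · rintro ⟨⟨V, rfl⟩, h⟩; exact ⟨V, (key V).2 h, rfl⟩

lemma IsIrr.ip_self {χ : G → ℂ} (h : IsIrr χ) : ip χ χ = 1 := (isIrr_iff.1 h).2

lemma IsIrr.ip_ne {χ φ : G → ℂ} (h : IsIrr χ) (h' : IsIrr φ) (hne : χ ≠ φ) : ip χ φ = 0 := by
  obtain ⟨V, hV, rfl⟩ := h
  obtain ⟨W, hW, rfl⟩ := h'
  have := FDRep.char_orthonormal V W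
  rw [if_neg] at this
  · exact this
  · rintro ⟨i⟩; exact hne (FDRep.char_iso i)

lemma IsChar.classFn {χ : G → ℂ} (h : IsChar χ) : IsClassFn χ := by
  obtain ⟨V, rfl⟩ := h
  intro g h; exact V.char_conj g h

lemma IsChar.one {χ : G → ℂ} (h : IsChar χ) : ∃ n : ℕ, χ 1 = n := by
  obtain ⟨V, rfl⟩ := h
  exact ⟨_, V.char_one⟩

lemma IsChar.comp {χ : G → ℂ} (h : IsChar χ) (j : H →* G) : IsChar (fun x => χ (j x)) := by
  obtain ⟨V, rfl⟩ := h
  exact ⟨FDRep.of (V.ρ.comp j), rfl⟩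

lemma IsChar.mul {χ φ : G → ℂ} (h : IsChar χ) (h' : IsChar φ) : IsChar (χ * φ) := by
  obtain ⟨V, rfl⟩ := h
  obtain ⟨W, rfl⟩ := h'
  exact ⟨MonoidalCategoryStruct.tensorObj V W, FDRep.char_tensor V W⟩

lemma IsChar.inv {χ : G → ℂ} (h : IsChar χ) : IsChar (fun g => χ g⁻¹) := by
  obtain ⟨V, rfl⟩ := h
  exact ⟨FDRep.of (Representation.dual V.ρ), funext (FDRep.char_dual V)⟩

lemma ip_inv (f h : G → ℂ) : ip (fun g => f g⁻¹) (fun g => h g⁻¹) = ip f h := by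
  rw [ip_comm f]
  simp only [ip, inv_inv]
  congr 1
  exact Finset.sum_congr rfl (fun g _ => mul_comm _ _)

lemma IsIrr.inv {χ : G → ℂ} (h : IsIrr χ) : IsIrr (fun g => χ g⁻¹) := by
  rw [isIrr_iff] at h ⊢
  exact ⟨h.1.inv, by rw [ip_inv, h.2]⟩

/-- character of a representation built from a hom into matrices -/
lemma isChar_of_matrix {n : ℕ} (M : G →* Matrix (Fin n) (Fin n) ℂ) :
    IsChar (fun g => (M g).trace) := by
  refine ⟨FDRep.of (V := Fin n → ℂ)
    ((Matrix.toLinAlgEquiv' : Matrix (Fin n) (Fin n) ℂ ≃ₐ[ℂ] _).toAlgHom.toMonoidHom.comp M), ?_⟩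
  funext g
  exact Matrix.trace_toLin'_eq _

lemma IsChar.exists_matrix {χ : G → ℂ} (h : IsChar χ) :
    ∃ (n : ℕ) (M : G →* Matrix (Fin n) (Fin n) ℂ), ∀ g, χ g = (M g).trace := by
  obtain ⟨V, rfl⟩ := h
  refine ⟨Module.finrank ℂ V,
    ((LinearMap.toMatrixAlgEquiv (Module.finBasis ℂ V)).toAlgHom.toMonoidHom.comp V.ρ), ?_⟩
  intro g
  exact LinearMap.trace_eq_matrix_trace ℂ (Module.finBasis ℂ V) (V.ρ g)

lemma IsChar.galois {χ : G → ℂ} (h : IsChar χ) (σ : ℂ ≃+* ℂ) : IsChar (fun g => σ (χ g)) := by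
  obtain ⟨n, M, hM⟩ := h.exists_matrix
  have := isChar_of_matrix (((σ : ℂ →+* ℂ).mapMatrix (m := Fin n)).toMonoidHom.comp M)
  convert this using 2 with g
  rw [hM]
  simp [Matrix.trace, Matrix.map_apply]

lemma ip_galois (f h : G → ℂ) (σ : ℂ ≃+* ℂ) :
    ip (fun g => σ (f g)) (fun g => σ (h g)) = σ (ip f h) := by
  simp [ip, map_sum]

lemma IsIrr.galois {χ : G → ℂ} (h : IsIrr χ) (σ : ℂ ≃+* ℂ) : IsIrr (fun g => σ (χ g)) := by
  rw [isIrr_iff] at h ⊢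
  exact ⟨h.1.galois σ, by rw [ip_galois, h.2, map_one]⟩

lemma isIrr_lin (θ : G →* ℂ) : IsIrr (fun g => θ g) := by
  rw [isIrr_iff]
  constructor
  · have := isChar_of_matrix (n := 1) ((Matrix.scalar (Fin 1)).toMonoidHom.comp θ)
    convert this using 2 with g
    simp
  · have : ∀ g, θ g * θ g⁻¹ = 1 := fun g => by rw [← map_mul]; simp
    have h0 : (Nat.card G : ℂ) ≠ 0 := (Nat.cast_ne_zero.mpr Nat.card_pos.ne')
    simp only [ip, this, Finset.sum_const, Finset.card_univ, nsmul_eq_mul, mul_one]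
    rw [← Nat.card_eq_fintype_card]
    exact inv_mul_cancel₀ h0

lemma IsIrr.mul_lin {χ : G → ℂ} (h : IsIrr χ) (θ : G →* ℂ) : IsIrr (fun g => χ g * θ g) := by
  have h1 := isIrr_iff.1 h
  rw [isIrr_iff]
  refine ⟨h1.1.mul (isIrr_lin θ).isChar, ?_⟩
  rw [← h1.2]
  have : ∀ g, θ g * θ g⁻¹ = 1 := fun g => by rw [← map_mul]; simp
  simp only [ip]
  congr 1
  refine Finset.sum_congr rfl (fun g _ => ?_)
  linear_combination (χ g * χ g⁻¹) * this g

lemma IsIrr.comp_equiv {χ : G → ℂ} (h : IsIrr χ) (e : H ≃* G) : IsIrr (fun x => χ (e x)) := by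
  have h1 := isIrr_iff.1 h
  rw [isIrr_iff]
  refine ⟨h1.1.comp e.toMonoidHom, ?_⟩
  rw [← h1.2]
  simp only [ip]
  rw [Nat.card_congr e.toEquiv]
  congr 1
  refine Fintype.sum_equiv e.toEquiv _ _ (fun g => ?_)
  simp

/-- integrality of character values -/
lemma IsChar.algebraic {χ : G → ℂ} (h : IsChar χ) (g : G) : IsAlgebraic ℚ (χ g) := by
  obtain ⟨n, M, hM⟩ := h.exists_matrix
  rw [hM, Matrix.trace_eq_sum_roots_charpoly]
  apply IsIntegral.isAlgebraic
  apply IsIntegral.multiset_sum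
  intro x hx
  have hpow : M g ^ (Nat.card G) = 1 := by rw [← map_pow, pow_card_eq_one', map_one]
  have hroot : (M g).charpoly.IsRoot x := Polynomial.isRoot_of_mem_roots hx
  have hx1 : x ^ (Nat.card G) = 1 := by
    have hs : x ∈ spectrum ℂ (M g) := by
      rw [Matrix.mem_spectrum_iff_isRoot_charpoly]; exact hroot
    have := spectrum.pow_mem_pow (M g) (Nat.card G) hs
    rw [hpow] at this
    by_contra hne
    have h2 := spectrum.mem_iff.1 this
    apply h2
    rw [← map_one (algebraMap ℂ (Matrix (Fin n) (Fin n) ℂ)), ← map_sub]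
    exact (IsUnit.mk0 _ (sub_ne_zero.2 hne)).map _
  refine ⟨Polynomial.X ^ (Nat.card G) - 1, Polynomial.monic_X_pow_sub_C 1 Nat.card_pos.ne', ?_⟩
  rw [Polynomial.eval₂_sub, Polynomial.eval₂_X_pow, hx1]; simp

lemma isIrr_of_irreducible {V : Type} [AddCommGroup V] [Module ℂ V] [FiniteDimensional ℂ V]
    (ρ : Representation ℂ G V) [ρ.IsIrreducible] : IsIrr ρ.character := by
  rw [isIrr_iff]
  refine ⟨⟨FDRep.of ρ, rfl⟩, ?_⟩
  have := Representation.char_orthonormal ρ ρ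
  rw [if_pos ⟨Representation.Equiv.refl ρ⟩] at this
  exact this

lemma central_zero {V : Type} [AddCommGroup V] [Module ℂ V] [FiniteDimensional ℂ V]
    (ρ : Representation ℂ G V) [ρ.IsIrreducible] {f : G → ℂ} (hf : IsClassFn f)
    (h0 : ip f ρ.character = 0) : ∑ g : G, f g⁻¹ • ρ g = 0 := by
  let T : V →ₗ[ℂ] V := ∑ g : G, f g⁻¹ • ρ g
  have hT : ∀ h v, T (ρ h v) = ρ h (T v) := by
    intro h v
    simp only [T, LinearMap.sum_apply, LinearMap.smul_apply, map_sum, map_smul]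
    refine Fintype.sum_equiv (MulAut.conj h⁻¹).toEquiv _ _ (fun g => ?_)
    have h1 : f (h⁻¹ * g * h⁻¹⁻¹)⁻¹ = f g⁻¹ := by
      rw [← hf g⁻¹ h⁻¹]; congr 1; group
    have h2 : (MulAut.conj h⁻¹).toEquiv g = h⁻¹ * g * h⁻¹⁻¹ := by simp
    rw [h2, h1]
    congr 1
    rw [← Module.End.mul_apply, ← Module.End.mul_apply, ← map_mul, ← map_mul]
    congr 2
    group
  let I : Representation.IntertwiningMap ρ ρ := LinearMap.intertwiningMap_of_isIntertwiningMap _ _ T hT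
  obtain ⟨c, hc⟩ := (Representation.IsIrreducible.algebraMap_intertwiningMap_bijective_of_isAlgClosed
    (ρ := ρ)).2 I
  have hTc : T = c • (LinearMap.id : V →ₗ[ℂ] V) := by
    have : I.toLinearMap = T := rfl
    rw [← this, ← hc]; rfl
  have htr : LinearMap.trace ℂ V T = 0 := by
    simp only [T, map_sum, map_smul, smul_eq_mul]
    have h1 : (Nat.card G : ℂ) ≠ 0 := (Nat.cast_ne_zero.mpr Nat.card_pos.ne')
    rw [ip_comm] at h0
    have h2 := (mul_eq_zero.1 h0).resolve_left (inv_ne_zero h1)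
    rw [← h2]
    refine Finset.sum_congr rfl (fun g _ => ?_)
    rw [mul_comm]; rfl
  change T = 0
  rw [hTc, map_smul, LinearMap.trace_id, smul_eq_mul, mul_eq_zero] at htr
  rcases htr with h | h
  · rw [hTc, h, zero_smul]
  · have : Module.finrank ℂ V = 0 := by exact_mod_cast h
    have := Module.finrank_zero_iff.1 this
    ext v; exact Subsingleton.elim _ _

lemma simple_act_zero (M : Type) [AddCommGroup M] [Module (MonoidAlgebra ℂ G) M]
    [IsSimpleModule (MonoidAlgebra ℂ G) M] [Module.Finite (MonoidAlgebra ℂ G) M] {f : G → ℂ}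
    (hf : IsClassFn f) (h0 : ∀ χ : G → ℂ, IsIrr χ → ip f χ = 0) (x : M) :
    (∑ g : G, MonoidAlgebra.single g (f g⁻¹)) • x = 0 := by
  letI : Module ℂ M := Module.compHom M (algebraMap ℂ (MonoidAlgebra ℂ G))
  haveI : IsScalarTower ℂ (MonoidAlgebra ℂ G) M := ⟨fun c a m => by
    rw [Algebra.smul_def, mul_smul]; rfl⟩
  let ρ : Representation ℂ G M := Representation.ofModule' M
  have hρ : ∀ g v, ρ g v = (MonoidAlgebra.single g (1:ℂ)) • v := fun g v => rfl
  have has : ∀ a v, ρ.asAlgebraHom a v = a • v := by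
    intro a v
    induction a using MonoidAlgebra.induction_linear with
    | zero => simp
    | add x y hx hy => simp [add_smul, hx, hy]
    | single h c =>
      rw [Representation.asAlgebraHom_single, LinearMap.smul_apply, hρ, ← smul_assoc]
      simp
  let e : ρ.asModule ≃ₗ[MonoidAlgebra ℂ G] M :=
    { ρ.asModuleEquiv with
      map_smul' := by
        intro a v
        change ρ.asModuleEquiv (a • v) = a • ρ.asModuleEquiv v
        rw [Representation.asModuleEquiv_map_smul, has] }
  have hirr : ρ.IsIrreducible := by
    rw [Representation.irreducible_iff_isSimpleModule_asModule]
    exact IsSimpleModule.congr e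
  haveI : FiniteDimensional ℂ M := Module.Finite.trans (MonoidAlgebra ℂ G) _
  have h1 := central_zero ρ hf (h0 _ (isIrr_of_irreducible ρ))
  rw [← has, map_sum]
  simp only [Representation.asAlgebraHom_single]
  rw [h1]; rfl

/-- Completeness of irreducible characters. -/
lemma irr_complete {f : G → ℂ} (hf : IsClassFn f) (h0 : ∀ χ : G → ℂ, IsIrr χ → ip f χ = 0) :
    f = 0 := by
  classical
  let a : MonoidAlgebra ℂ G := ∑ g : G, MonoidAlgebra.single g (f g⁻¹)
  have hcen : ∀ x : MonoidAlgebra ℂ G, a * x = x * a := by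
    intro x
    induction x using MonoidAlgebra.induction_linear with
    | zero => simp
    | add x y hx hy => rw [mul_add, add_mul, hx, hy]
    | single h c =>
      change (∑ g : G, MonoidAlgebra.single g (f g⁻¹)) * _ = _ * (∑ g : G, MonoidAlgebra.single g (f g⁻¹))
      rw [Finset.sum_mul, Finset.mul_sum]
      refine Fintype.sum_equiv (MulAut.conj h⁻¹).toEquiv _ _ (fun g => ?_)
      have h1 : f (h⁻¹ * g * h⁻¹⁻¹)⁻¹ = f g⁻¹ := by
        rw [← hf g⁻¹ h⁻¹]; congr 1; group
      have h2 : (MulAut.conj h⁻¹).toEquiv g = h⁻¹ * g * h⁻¹⁻¹ := by simp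
      rw [h2, h1, MonoidAlgebra.single_mul_single, MonoidAlgebra.single_mul_single, mul_comm c]
      congr 1
      group
  let N : Submodule (MonoidAlgebra ℂ G) (MonoidAlgebra ℂ G) :=
    { carrier := {x | a * x = 0}
      add_mem' := by
        intro x y hx hy
        change a * (x + y) = 0
        rw [mul_add, show a * x = 0 from hx, show a * y = 0 from hy, add_zero]
      zero_mem' := by change a * 0 = 0; simp
      smul_mem' := by
        intro c x hx
        change a * (c * x) = 0
        rw [← mul_assoc, hcen, mul_assoc, show a * x = 0 from hx, mul_zero] }
  have hN : N = ⊤ := by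
    rw [eq_top_iff, ← IsSemisimpleModule.sSup_simples_eq_top (MonoidAlgebra ℂ G) (MonoidAlgebra ℂ G)]
    apply sSup_le
    intro m hm x hx
    change a * x = 0
    have hm' : IsSimpleModule (MonoidAlgebra ℂ G) m := hm
    have h4 := simple_act_zero m hf h0 ⟨x, hx⟩
    exact congrArg Subtype.val h4
  have h1 : (1 : MonoidAlgebra ℂ G) ∈ N := by rw [hN]; trivial
  have ha : a = 0 := by simpa using (show a * 1 = 0 from h1)
  funext g
  have h2 : a.coeff g⁻¹ = f g := by
    change (∑ g : G, MonoidAlgebra.single g (f g⁻¹)).coeff g⁻¹ = _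
    rw [MonoidAlgebra.coeff_sum]
    simp [MonoidAlgebra.coeff_single, Finsupp.single_apply]
  rw [← h2, ha]; rfl

end CharTheory

end PartP1

section PartP1b

section CharTheory2

variable {G H : Type} [Group G] [Fintype G] [Group H] [Fintype H]

lemma irr_finite : {χ : G → ℂ | IsIrr χ}.Finite := by
  have : LinearIndependent ℂ (fun χ : {χ : G → ℂ | IsIrr χ} => (χ : G → ℂ)) := by
    rw [linearIndependent_iff']
    intro s c hc i hi
    have h1 : ip (∑ i ∈ s, c i • (i : G → ℂ)) i = 0 := by rw [hc, ip_zero_left]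
    rw [ip_sum_left] at h1
    rw [Finset.sum_eq_single i] at h1
    · rwa [ip_smul_left, IsIrr.ip_self i.2, mul_one] at h1
    · intro k _ hk
      rw [ip_smul_left, IsIrr.ip_ne k.2 i.2 (fun h => hk (Subtype.ext h)), mul_zero]
    · intro h; exact absurd hi h
  exact this.setFinite

/-- The finite set of irreducible characters. -/
noncomputable def irrF (G : Type) [Group G] [Fintype G] : Finset (G → ℂ) :=
  (irr_finite (G := G)).toFinset

lemma mem_irrF {χ : G → ℂ} : χ ∈ irrF G ↔ IsIrr χ := by simp [irrF]

lemma IsClassFn.sub {f h : G → ℂ} (hf : IsClassFn f) (hh : IsClassFn h) : IsClassFn (f - h) := by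
  intro g x; simp [hf g x, hh g x]

lemma IsClassFn.add {f h : G → ℂ} (hf : IsClassFn f) (hh : IsClassFn h) : IsClassFn (f + h) := by
  intro g x; simp [hf g x, hh g x]

lemma IsClassFn.smul (c : ℂ) {f : G → ℂ} (hf : IsClassFn f) : IsClassFn (c • f) := by
  intro g x; simp [hf g x]

lemma IsClassFn.sum {ι : Type*} (s : Finset ι) (F : ι → G → ℂ) (h : ∀ i ∈ s, IsClassFn (F i)) :
    IsClassFn (∑ i ∈ s, F i) := by
  intro g x; simp only [Finset.sum_apply]
  exact Finset.sum_congr rfl (fun i hi => h i hi g x)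

lemma IsClassFn.comp {f : G → ℂ} (hf : IsClassFn f) (j : H →* G) :
    IsClassFn (fun x => f (j x)) := by
  intro g x; simp only [map_mul, map_inv]; exact hf _ _

lemma expand {f : G → ℂ} (hf : IsClassFn f) : f = ∑ χ ∈ irrF G, ip f χ • χ := by
  classical
  have : f - ∑ χ ∈ irrF G, ip f χ • χ = 0 := by
    apply irr_complete
    · exact hf.sub (IsClassFn.sum _ _ (fun χ h => ((mem_irrF.1 h).isChar.classFn).smul _))
    · intro χ hχ
      rw [ip_sub_left, ip_sum_left, Finset.sum_eq_single χ]
      · rw [ip_smul_left, hχ.ip_self, mul_one, sub_self]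
      · intro φ hφ hne
        rw [ip_smul_left, (mem_irrF.1 hφ).ip_ne hχ hne, mul_zero]
      · intro h; exact absurd (mem_irrF.2 hχ) h
  exact sub_eq_zero.1 this

lemma parseval {f h : G → ℂ} (hf : IsClassFn f) :
    ip f h = ∑ χ ∈ irrF G, ip f χ * ip χ h := by
  conv_lhs => rw [expand hf]
  rw [ip_sum_left]
  exact Finset.sum_congr rfl (fun χ _ => ip_smul_left _ _ _)

lemma norm_one {f : G → ℂ} (hf : IsClassFn f) (hinteg : ∀ χ, IsIrr χ → ∃ n : ℤ, ip f χ = n)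
    (h1 : ip f f = 1) : ∃ χ, IsIrr χ ∧ (f = χ ∨ f = -χ) := by
  classical
  choose! n hn using hinteg
  have hs : ∑ χ ∈ irrF G, n χ ^ 2 = 1 := by
    have := parseval (h := f) hf
    rw [h1] at this
    have h2 : (1 : ℂ) = ((∑ χ ∈ irrF G, n χ ^ 2 : ℤ) : ℂ) := by
      rw [this]; push_cast
      refine Finset.sum_congr rfl (fun χ h => ?_)
      rw [ip_comm χ f, hn χ (mem_irrF.1 h)]; ring
    exact_mod_cast h2.symm
  have hex : ∃ χ ∈ irrF G, n χ ≠ 0 := by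
    by_contra! h
    rw [Finset.sum_eq_zero (fun χ hχ => by rw [h χ hχ]; rfl)] at hs
    exact absurd hs (by norm_num)
  obtain ⟨χ, hχ, hne⟩ := hex
  have hle : ∀ φ ∈ irrF G, φ ≠ χ → n φ = 0 := by
    intro φ hφ hφχ
    by_contra h0
    have h3 : ∑ x ∈ ({χ, φ} : Finset (G → ℂ)), n x ^ 2 ≤ ∑ x ∈ irrF G, n x ^ 2 := by
      apply Finset.sum_le_sum_of_subset_of_nonneg
      · intro x hx; simp only [Finset.mem_insert, Finset.mem_singleton] at hx
        rcases hx with rfl | rfl <;> assumption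
      · intros; positivity
    rw [Finset.sum_pair hφχ.symm, hs] at h3
    have : 0 < n χ ^ 2 := by positivity
    have : 0 < n φ ^ 2 := by positivity
    omega
  have hsq : n χ ^ 2 = 1 := by
    rw [← hs, Finset.sum_eq_single χ]
    · intro φ hφ hne; rw [hle φ hφ hne]; rfl
    · intro h; exact absurd hχ h
  have hfe : f = (n χ : ℂ) • χ := by
    conv_lhs => rw [expand hf]
    rw [Finset.sum_eq_single χ]
    · rw [hn χ (mem_irrF.1 hχ)]
    · intro φ hφ hne; rw [hn φ (mem_irrF.1 hφ), hle φ hφ hne]; simp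
    · intro h; exact absurd hχ h
  refine ⟨χ, mem_irrF.1 hχ, ?_⟩
  have hpm : n χ = 1 ∨ n χ = -1 := by
    have : (n χ - 1) * (n χ + 1) = 0 := by linear_combination hsq
    rcases mul_eq_zero.1 this with h | h
    · left; omega
    · right; omega
  rcases hpm with h | h
  · left; rw [hfe, h]; simp
  · right; rw [hfe, h]; simp

lemma IsChar.eq_zero_of_one {χ : G → ℂ} (h : IsChar χ) (h1 : χ 1 = 0) : χ = 0 := by
  obtain ⟨n, M, hM⟩ := h.exists_matrix
  have h2 := hM 1
  rw [h1, map_one, Matrix.trace_one, Fintype.card_fin] at h2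
  have : n = 0 := by exact_mod_cast h2.symm
  subst this
  funext g; rw [hM]; simp [Matrix.trace]

lemma IsIrr.ne_zero {χ : G → ℂ} (h : IsIrr χ) : χ ≠ 0 := by
  rintro rfl
  have := h.ip_self
  rw [ip_zero_left] at this
  exact zero_ne_one this

lemma IsIrr.one_pos {χ : G → ℂ} (h : IsIrr χ) : ∃ n : ℕ, 0 < n ∧ χ 1 = n := by
  obtain ⟨n, hn⟩ := h.isChar.one
  refine ⟨n, Nat.pos_of_ne_zero ?_, hn⟩
  rintro rfl
  exact h.ne_zero (h.isChar.eq_zero_of_one (by simpa using hn))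

lemma norm_one_pos {f : G → ℂ} (hf : IsClassFn f) (hinteg : ∀ χ, IsIrr χ → ∃ n : ℤ, ip f χ = n)
    (h1 : ip f f = 1) (hpos : ∃ n : ℕ, f 1 = n) : IsIrr f := by
  obtain ⟨χ, hχ, rfl | rfl⟩ := norm_one hf hinteg h1
  · exact hχ
  · obtain ⟨n, hn, hn1⟩ := hχ.one_pos
    obtain ⟨m, hm⟩ := hpos
    rw [Pi.neg_apply, hn1] at hm
    have : (n : ℂ) + m = 0 := by rw [← hm]; ring
    have : n + m = 0 := by exact_mod_cast this
    omega

section Clifford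

variable {N : Type} [Group N] [Fintype N] (j : N →* G)

open Classical in
/-- induced class function -/
noncomputable def ind (χ : N → ℂ) : G → ℂ :=
  fun x => (Nat.card N : ℂ)⁻¹ * ∑ g : G, ∑ n : N, if j n = g * x * g⁻¹ then χ n else 0

lemma card_ne (G : Type) [Group G] [Fintype G] : (Nat.card G : ℂ) ≠ 0 :=
  (Nat.cast_ne_zero.mpr Nat.card_pos.ne')

lemma ind_classFn (χ : N → ℂ) : IsClassFn (ind j χ) := by
  intro g h
  unfold ind
  congr 1
  refine Fintype.sum_equiv (Equiv.mulRight h) _ _ (fun x => ?_)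
  refine Finset.sum_congr rfl (fun n _ => ?_)
  simp only [Equiv.coe_mulRight, mul_inv_rev]
  congr 1
  simp only [mul_assoc, mul_inv_rev]

lemma frob (χ : N → ℂ) {ψ : G → ℂ} (hψ : IsClassFn ψ) :
    ip (ind j χ) ψ = ip χ (fun n => ψ (j n)) := by
  classical
  unfold ip ind
  have h1 : ∀ x : G, ((Nat.card N : ℂ)⁻¹ * ∑ g : G, ∑ n : N, if j n = g * x * g⁻¹ then χ n else 0) * ψ x⁻¹
      = (Nat.card N : ℂ)⁻¹ * ∑ g : G, ∑ n : N, if x = g⁻¹ * j n * g then χ n * ψ (j n⁻¹) else 0 := by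
    intro x
    rw [mul_assoc, Finset.sum_mul]
    congr 1
    refine Finset.sum_congr rfl (fun g _ => ?_)
    rw [Finset.sum_mul]
    refine Finset.sum_congr rfl (fun n _ => ?_)
    have : (j n = g * x * g⁻¹) ↔ (x = g⁻¹ * j n * g) := by
      constructor
      · intro h; rw [h]; group
      · intro h; rw [h]; group
    by_cases h : x = g⁻¹ * j n * g
    · rw [if_pos h, if_pos (this.2 h), h]
      congr 1
      rw [map_inv, ← hψ (j n)⁻¹ g⁻¹]
      congr 1; group
    · rw [if_neg h, if_neg (fun h' => h (this.1 h')), zero_mul]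
  simp_rw [h1]
  rw [← Finset.mul_sum, Finset.sum_comm]
  have h2 : ∀ g : G, ∑ x : G, ∑ n : N, (if x = g⁻¹ * j n * g then χ n * ψ (j n⁻¹) else 0)
      = ∑ n : N, χ n * ψ (j n⁻¹) := by
    intro g
    rw [Finset.sum_comm]
    refine Finset.sum_congr rfl (fun n _ => ?_)
    simp
  simp_rw [h2]
  rw [Finset.sum_const, Finset.card_univ, ← Nat.card_eq_fintype_card, nsmul_eq_mul]
  field_simp [card_ne G, card_ne N]

variable (c : G → N ≃* N) (hj : Function.Injective j)
  (hc : ∀ g n, j (c g n) = g * j n * g⁻¹)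

lemma ind_res (χ : N → ℂ) (hj : Function.Injective j)
    (hc : ∀ g n, j (c g n) = g * j n * g⁻¹) (m : N) :
    ind j χ (j m) = (Nat.card N : ℂ)⁻¹ * ∑ g : G, χ (c g m) := by
  classical
  unfold ind
  congr 1
  refine Finset.sum_congr rfl (fun g _ => ?_)
  simp_rw [← hc, hj.eq_iff]
  simp

lemma exists_over {χ : N → ℂ} (hχ : IsIrr χ) (hj : Function.Injective j)
    (hc : ∀ g n, j (c g n) = g * j n * g⁻¹) :
    ∃ ψ : G → ℂ, IsIrr ψ ∧ ip χ (fun n => ψ (j n)) ≠ 0 := by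
  by_contra! h
  have h0 : ind j χ = 0 := irr_complete (ind_classFn j χ) (fun ψ hψ => by
    rw [frob j χ hψ.isChar.classFn, h ψ hψ])
  have h1 := ind_res j c χ hj hc 1
  rw [h0] at h1
  simp only [map_one, Pi.zero_apply, Finset.sum_const, Finset.card_univ, nsmul_eq_mul] at h1
  obtain ⟨n, hn, hn1⟩ := hχ.one_pos
  rw [hn1, ← Nat.card_eq_fintype_card] at h1
  have : (n : ℂ) ≠ 0 := Nat.cast_ne_zero.2 hn.ne'
  have := card_ne N
  have := card_ne G
  simp_all

lemma clifford {χ φ : N → ℂ} {ψ : G → ℂ} (hχ : IsIrr χ) (hφ : IsIrr φ) (hψ : IsIrr ψ)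
    (hj : Function.Injective j) (hc : ∀ g n, j (c g n) = g * j n * g⁻¹)
    (h1 : ip χ (fun n => ψ (j n)) ≠ 0) (h2 : ip φ (fun n => ψ (j n)) ≠ 0) :
    ∃ g, φ = fun n => χ (c g n) := by
  classical
  by_contra! hne
  have hz : ip (fun n => ind j χ (j n)) φ = 0 := by
    have : (fun n => ind j χ (j n)) = (Nat.card N : ℂ)⁻¹ • ∑ g : G, (fun n => χ (c g n)) := by
      funext n
      rw [ind_res j c χ hj hc n]
      simp
    rw [this, ip_smul_left, ip_sum_left, Finset.sum_eq_zero, mul_zero]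
    intro g _
    exact (hχ.comp_equiv (c g)).ip_ne hφ (fun h => hne g h.symm)
  have hexp : (fun n => ind j χ (j n)) = ∑ η ∈ irrF G, ip (ind j χ) η • (fun n => η (j n)) := by
    funext n
    conv_lhs => rw [expand (ind_classFn j χ)]
    simp
  rw [hexp, ip_sum_left] at hz
  have hnat : ∀ η ∈ irrF G, ∃ k : ℕ, ip (ip (ind j χ) η • (fun n => η (j n))) φ = k := by
    intro η hη
    have hη' := mem_irrF.1 hη
    rw [ip_smul_left, frob j χ hη'.isChar.classFn]
    obtain ⟨a, ha⟩ := ip_nat hχ.isChar (hη'.isChar.comp j)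
    obtain ⟨b, hb⟩ := ip_nat (hη'.isChar.comp j) hφ.isChar
    exact ⟨a * b, by rw [ha, hb]; push_cast; rfl⟩
  choose! k hk using hnat
  rw [Finset.sum_congr rfl hk] at hz
  have hz' : ∑ η ∈ irrF G, k η = 0 := by exact_mod_cast hz
  have h3 := (Finset.sum_eq_zero_iff.1 hz') ψ (mem_irrF.2 hψ)
  have h4 := hk ψ (mem_irrF.2 hψ)
  rw [h3, ip_smul_left, frob j χ hψ.isChar.classFn, ip_comm _ φ] at h4
  simp [h1, h2] at h4

/-- common constituent implies nonzero pairing -/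
lemma ip_ne_zero_of_common {f h χ : G → ℂ} (hf : IsChar f) (hh : IsChar h) (hχ : IsIrr χ)
    (h1 : ip χ f ≠ 0) (h2 : ip χ h ≠ 0) : ip f h ≠ 0 := by
  classical
  intro h0
  rw [parseval hf.classFn] at h0
  have hnat : ∀ η ∈ irrF G, ∃ k : ℕ, ip f η * ip η h = k := by
    intro η hη
    have hη' := mem_irrF.1 hη
    obtain ⟨a, ha⟩ := ip_nat hf hη'.isChar
    obtain ⟨b, hb⟩ := ip_nat hη'.isChar hh
    exact ⟨a * b, by rw [ha, hb]; push_cast; rfl⟩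
  choose! k hk using hnat
  rw [Finset.sum_congr rfl hk] at h0
  have hz' : ∑ η ∈ irrF G, k η = 0 := by exact_mod_cast h0
  have h3 := (Finset.sum_eq_zero_iff.1 hz') χ (mem_irrF.2 hχ)
  have h4 := hk χ (mem_irrF.2 hχ)
  rw [h3, ip_comm f] at h4
  simp [h1, h2] at h4

end Clifford

end CharTheory2

end PartP1b

section PartP1c

section CharTheory3

variable {G N Q : Type} [Group G] [Fintype G] [Group N] [Fintype N] [CommGroup Q] [Fintype Q]

/-- A linear character of `Q` inflated to `G`. -/
noncomputable def infl (π : G →* Q) (l : AddChar (Additive Q) ℂ) : G →* ℂ where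
  toFun g := l (Additive.ofMul (π g))
  map_one' := by simp
  map_mul' x y := by simp [AddChar.map_add_eq_mul]

lemma ip_res (j : N →* G) (π : G →* Q) (hj : Function.Injective j) (hπ : Function.Surjective π)
    (hker : ∀ g, π g = 1 ↔ ∃ n, j n = g) (φ ψ : G → ℂ) :
    ip (fun n => φ (j n)) (fun n => ψ (j n)) =
      ∑ l : AddChar (Additive Q) ℂ, ip (fun g => φ g * infl π l g) ψ := by
  classical
  have hcard : Nat.card G = Nat.card Q * Nat.card N := by
    have h1 := Subgroup.card_eq_card_quotient_mul_card_subgroup π.ker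
    rw [Nat.card_congr (QuotientGroup.quotientKerEquivOfSurjective π hπ).toEquiv] at h1
    have h2 : π.ker = j.range := by ext g; rw [MonoidHom.mem_ker, hker]; rfl
    rw [h1, h2]
    congr 1
    exact Nat.card_congr (MonoidHom.ofInjective hj).toEquiv.symm
  have hsum : ∀ g, ∑ l : AddChar (Additive Q) ℂ, infl π l g = if π g = 1 then (Nat.card Q : ℂ) else 0 := by
    intro g
    have := AddChar.sum_apply_eq_ite (Additive.ofMul (π g))
    simp only [infl, MonoidHom.coe_mk, OneHom.coe_mk]
    rw [this]
    simp [ofMul_eq_zero, Nat.card_eq_fintype_card]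
  simp only [ip]
  rw [← Finset.mul_sum, Finset.sum_comm]
  have h3 : ∀ g, ∑ l : AddChar (Additive Q) ℂ, φ g * infl π l g * ψ g⁻¹ =
      if π g = 1 then (Nat.card Q : ℂ) * (φ g * ψ g⁻¹) else 0 := by
    intro g
    rw [← Finset.sum_mul, ← Finset.mul_sum, hsum]
    split_ifs <;> ring
  simp_rw [h3]
  rw [← Finset.sum_filter]
  have h4 : Finset.univ.filter (fun g => π g = 1) = Finset.univ.image j := by
    ext g; simp [hker]
  rw [h4, Finset.sum_image (fun _ _ _ _ h => hj h), ← Finset.mul_sum, hcard]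
  have := card_ne N
  have : (Nat.card Q : ℂ) ≠ 0 := Nat.cast_ne_zero.mpr Nat.card_pos.ne'
  push_cast
  field_simp
  simp

lemma eq_mul_lin (j : N →* G) (π : G →* Q) (hj : Function.Injective j) (hπ : Function.Surjective π)
    (hker : ∀ g, π g = 1 ↔ ∃ n, j n = g) {φ ψ : G → ℂ} (hφ : IsIrr φ) (hψ : IsIrr ψ)
    (h : ip (fun n => φ (j n)) (fun n => ψ (j n)) ≠ 0) :
    ∃ l : AddChar (Additive Q) ℂ, ψ = fun g => φ g * infl π l g := by
  by_contra! hne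
  apply h
  rw [ip_res j π hj hπ hker, Finset.sum_eq_zero]
  intro l _
  exact (hφ.mul_lin _).ip_ne hψ (hne l).symm

lemma infl_pow (π : G →* Q) {f : ℕ} (hpow : ∀ g, π g ^ f = 1) (l : AddChar (Additive Q) ℂ) (g : G) :
    infl π l g ^ f = 1 := by
  rw [← map_pow]
  simp only [infl, MonoidHom.coe_mk, OneHom.coe_mk]
  rw [map_pow, hpow]; simp

lemma parity (j : N →* G) (c : G → N ≃* N) (hc : ∀ g n, j (c g n) = g * j n * g⁻¹)
    (π : G →* Q) (hj : Function.Injective j) (hπ : Function.Surjective π)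
    (hker : ∀ g, π g = 1 ↔ ∃ n, j n = g) {f : ℕ} (hf : Odd f) (hpow : ∀ g, π g ^ f = 1)
    {ψ : G → ℂ} (hψ : IsIrr ψ) {χ : N → ℂ} (hχ : IsIrr χ) (h : ip χ (fun n => ψ (j n)) ≠ 0)
    {d e : ℕ} (hd : ψ 1 = d) (he : χ 1 = e) (hev : Even d) : Even e := by
  classical
  -- the number of twists fixing ψ is odd
  let s : Finset (AddChar (Additive Q) ℂ) :=
    Finset.univ.filter (fun l => (fun g => ψ g * infl π l g) = ψ)
  have hs : ip (fun n => ψ (j n)) (fun n => ψ (j n)) = (s.card : ℂ) := by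
    rw [ip_res j π hj hπ hker, Finset.card_filter]
    push_cast
    refine Finset.sum_congr rfl (fun l _ => ?_)
    split_ifs with h
    · rw [h, hψ.ip_self]
    · rw [(hψ.mul_lin _).ip_ne hψ h]
  have hodd : Odd s.card := by
    have h1 : (1 : AddChar (Additive Q) ℂ) ∈ s := by
      refine Finset.mem_filter.2 ⟨Finset.mem_univ _, ?_⟩
      funext g; simp [infl]
    have h2 : ∑ x ∈ s.erase 1, (1 : ZMod 2) = 0 := by
      apply Finset.sum_involution (fun l _ => l⁻¹)
      · intros; decide
      · intro l hl _ heq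
        apply Finset.ne_of_mem_erase hl
        ext x
        obtain ⟨g, hg⟩ := hπ x.toMul
        have h5 := infl_pow π hpow l g
        have h6 : infl π l g = l x := by
          simp only [infl, MonoidHom.coe_mk, OneHom.coe_mk, hg]; rfl
        rw [h6] at h5
        have h7 : l x * l x = 1 := by
          nth_rewrite 1 [← heq]
          rw [AddChar.inv_apply, ← AddChar.map_add_eq_mul]; simp
        obtain ⟨k, rfl⟩ := hf
        rw [pow_add, pow_mul, sq, h7, one_pow, one_mul, pow_one] at h5
        rw [h5]; simp
      rotate_left
      · intro l hl
        rw [Finset.mem_erase] at hl ⊢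
        refine ⟨fun h => hl.1 (inv_eq_one.1 h), ?_⟩
        have h3 := (Finset.mem_filter.1 hl.2).2
        refine Finset.mem_filter.2 ⟨Finset.mem_univ _, ?_⟩
        funext g
        have h4 := congrFun h3 g
        conv_lhs => rw [← h4]
        have : infl π l g * infl π l⁻¹ g = 1 := by
          simp only [infl, MonoidHom.coe_mk, OneHom.coe_mk]
          rw [AddChar.inv_apply, ← AddChar.map_add_eq_mul]; simp
        rw [mul_assoc, this, mul_one]
      · intro l hl; simp
    rw [Finset.sum_const, nsmul_eq_mul, mul_one] at h2
    have h3 : Even (s.erase 1).card := (ZMod.natCast_eq_zero_iff_even).1 h2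
    rw [← Finset.card_erase_add_one h1]
    exact h3.add_one
  have hres := hψ.isChar.comp j
  have hm : ∀ η ∈ irrF N, ∃ m : ℕ, ip (fun n => ψ (j n)) η = m := fun η hη =>
    ip_nat hres (mem_irrF.1 hη).isChar
  choose! m hm using hm
  have hsq : ∑ η ∈ irrF N, m η ^ 2 = s.card := by
    rw [parseval hres.classFn] at hs
    have : ((∑ η ∈ irrF N, m η ^ 2 : ℕ) : ℂ) = (s.card : ℂ) := by
      rw [← hs]; push_cast
      refine Finset.sum_congr rfl (fun η hη => ?_)
      rw [ip_comm η, hm η hη]; ring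
    exact_mod_cast this
  have hsum : Odd (∑ η ∈ irrF N, m η) := by
    rw [← hsq, Finset.odd_sum_iff_odd_card_odd] at hodd
    rw [Finset.odd_sum_iff_odd_card_odd]
    convert hodd using 3
    rw [Nat.odd_pow_iff (by norm_num)]
  have hdeg : d = (∑ η ∈ irrF N, m η) * e := by
    have h1 := congrFun (expand hres.classFn) 1
    simp only [map_one, Finset.sum_apply, Pi.smul_apply, smul_eq_mul] at h1
    rw [hd] at h1
    have h2 : ∑ η ∈ irrF N, ip (fun n => ψ (j n)) η * η 1 = ∑ η ∈ irrF N, (m η : ℂ) * e := by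
      refine Finset.sum_congr rfl (fun η hη => ?_)
      rw [hm η hη]
      by_cases h0 : m η = 0
      · rw [h0]; simp
      · obtain ⟨g, hg⟩ := clifford j c hχ (mem_irrF.1 hη) hψ hj hc h (by
          rw [ip_comm, hm η hη]; exact Nat.cast_ne_zero.2 h0)
        rw [hg]; simp [he]
    rw [h2, ← Finset.sum_mul] at h1
    exact_mod_cast h1
  rw [hdeg, Nat.even_mul] at hev
  rcases hev with h | h
  · exact absurd h (Nat.not_even_iff_odd.2 hsum)
  · exact h

lemma ip_conj (j : N →* G) (c : G → N ≃* N) (hc : ∀ g n, j (c g n) = g * j n * g⁻¹) {ψ : G → ℂ}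
    (hψ : IsClassFn ψ) (η : N → ℂ) (g : G) :
    ip (fun n => η (c g n)) (fun n => ψ (j n)) = ip η (fun n => ψ (j n)) := by
  unfold ip
  congr 1
  refine Fintype.sum_equiv (c g).toEquiv _ _ (fun n => ?_)
  change η (c g n) * ψ (j n⁻¹) = η (c g n) * ψ (j (c g n)⁻¹)
  rw [← map_inv, hc, hψ]

/-- Existence of a Galois-stable real character above a real, Galois-semistable one. -/
lemma lemmaE0 (j : N →* G) (c : G → N ≃* N) (hc : ∀ g n, j (c g n) = g * j n * g⁻¹)
    (π : G →* Q) (hj : Function.Injective j) (hπ : Function.Surjective π)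
    (hker : ∀ g, π g = 1 ↔ ∃ n, j n = g) {f : ℕ} (hf : Odd f) (hpow : ∀ g, π g ^ f = 1)
    {η : N → ℂ} (hη : IsIrr η) (hreal : ∀ n, η n⁻¹ = η n)
    (hgal : ∀ σ : ℂ ≃+* ℂ, ∃ g : G, ∀ n, σ (η n) = η (c g n)) :
    ∃ ψ : G → ℂ, IsIrr ψ ∧ (∀ (σ : ℂ ≃+* ℂ) g, σ (ψ g) = ψ g) ∧ ip η (fun n => ψ (j n)) ≠ 0 := by
  obtain ⟨ψ0, hψ0, h0⟩ := exists_over j c hη hj hc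
  have hlj : ∀ (l : AddChar (Additive Q) ℂ) n, infl π l (j n) = 1 := by
    intro l n
    simp [infl, (hker (j n)).2 ⟨n, rfl⟩]
  obtain ⟨k, hk⟩ := hf
  -- real character
  obtain ⟨l, hl⟩ := eq_mul_lin j π hj hπ hker hψ0 hψ0.inv (by
    apply ip_ne_zero_of_common (hψ0.isChar.comp j) (hψ0.inv.isChar.comp j) hη h0
    have h2 := ip_inv η (fun n => ψ0 (j n))
    rw [← h2] at h0
    convert h0 using 2
    · funext n; exact (hreal n).symm
    · funext n; simp)
  have hlp : ∀ g, infl π l g ^ (2 * (k + 1)) = infl π l g := by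
    intro g
    have := infl_pow π hpow l g
    rw [hk] at this
    rw [show 2 * (k + 1) = 2 * k + 1 + 1 by ring, pow_succ, this, one_mul]
  have hlinv : ∀ g, infl π l g * infl π l g⁻¹ = 1 := by
    intro g; rw [← map_mul]; simp
  let μ : G →* ℂ := infl π l ^ (k + 1)
  have hμ : ∀ g, μ g = infl π l g ^ (k + 1) := fun g => rfl
  let ψ : G → ℂ := fun g => ψ0 g * μ g
  have hψ : IsIrr ψ := hψ0.mul_lin μ
  have hψreal : ∀ g, ψ g⁻¹ = ψ g := by
    intro g
    have h1 := congrFun hl g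
    simp only [ψ, hμ]
    rw [h1]
    have h2 := hlp g
    have h3 := hlinv g
    have h4 : infl π l g ^ (k + 1) * infl π l g⁻¹ ^ (k + 1) = 1 := by
      rw [← mul_pow, h3, one_pow]
    have h5 : infl π l g * infl π l g⁻¹ ^ (k + 1) = infl π l g ^ (k + 1) := by
      calc infl π l g * infl π l g⁻¹ ^ (k + 1)
          = infl π l g ^ (2 * (k + 1)) * infl π l g⁻¹ ^ (k + 1) := by rw [h2]
        _ = infl π l g ^ (k + 1) * (infl π l g ^ (k + 1) * infl π l g⁻¹ ^ (k + 1)) := by ring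
        _ = _ := by rw [h4, mul_one]
    rw [mul_assoc, h5]
  have hψj : (fun n => ψ (j n)) = fun n => ψ0 (j n) := by
    funext n; simp [ψ, hμ, hlj]
  have hover : ip η (fun n => ψ (j n)) ≠ 0 := by rw [hψj]; exact h0
  refine ⟨ψ, hψ, ?_, hover⟩
  intro σ
  obtain ⟨g0, hg0⟩ := hgal σ
  have hσψ : IsIrr (fun g => σ (ψ g)) := hψ.galois σ
  obtain ⟨l', hl'⟩ := eq_mul_lin j π hj hπ hker hψ hσψ (by
    apply ip_ne_zero_of_common (hψ.isChar.comp j) (hσψ.isChar.comp j) (hη.comp_equiv (c g0))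
    · rw [ip_conj j c hc hψ.isChar.classFn]; exact hover
    · have h2 := ip_galois η (fun n => ψ (j n)) σ
      have h3 : (fun n => η (c g0 n)) = fun n => σ (η n) := by funext n; exact (hg0 n).symm
      rw [h3, h2]
      exact fun h => hover ((map_eq_zero σ).1 h))
  intro g
  have h1 := congrFun hl' g
  have h2 := congrFun hl' g⁻¹
  rw [hψreal g] at h2
  have h3 : infl π l' g * infl π l' g⁻¹ = 1 := by rw [← map_mul]; simp
  have h4 : ψ g * infl π l' g ^ 2 = ψ g := by
    calc ψ g * infl π l' g ^ 2 = (ψ g * infl π l' g) * infl π l' g := by ring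
      _ = (ψ g * infl π l' g⁻¹) * infl π l' g := by rw [← h1, h2]
      _ = ψ g * (infl π l' g * infl π l' g⁻¹) := by ring
      _ = ψ g := by rw [h3, mul_one]
  have h5 : ∀ i : ℕ, ψ g * infl π l' g ^ (2 * i) = ψ g := by
    intro i
    induction i with
    | zero => simp
    | succ i ih => rw [mul_add, pow_add, ← mul_assoc, ih, mul_one, h4]
  rw [h1]
  have h6 := h5 (k + 1)
  have h7 := infl_pow π hpow l' g
  rw [hk] at h7
  rw [show 2 * (k + 1) = 2 * k + 1 + 1 by ring, pow_succ, h7, one_mul] at h6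
  exact h6

end CharTheory3

end PartP1c

section PartP2

section AutC
open Cardinal

lemma exists_ringEquiv_over {R K L : Type} [Field R] [Field K] [Field L] [Algebra R K] [Algebra R L]
    [IsAlgClosed K] [IsAlgClosed L] (hR : (Cardinal.mk R) ≤ ℵ₀) (hK : ℵ₀ < (Cardinal.mk K)) (hL : ℵ₀ < (Cardinal.mk L))
    (hKL : (Cardinal.mk K) = (Cardinal.mk L)) : ∃ σ : K ≃+* L, ∀ r, σ (algebraMap R K r) = algebraMap R L r := by
  obtain ⟨s, hs⟩ := exists_isTranscendenceBasis R K
  obtain ⟨t, ht⟩ := exists_isTranscendenceBasis R L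
  have h1 := IsAlgClosed.cardinal_eq_cardinal_transcendence_basis_of_aleph0_lt' _ hs hR hK
  have h2 := IsAlgClosed.cardinal_eq_cardinal_transcendence_basis_of_aleph0_lt' _ ht hR hL
  have h3 : (Cardinal.mk s) = (Cardinal.mk t) := by rw [← h1, ← h2, hKL]
  obtain ⟨e⟩ := Cardinal.eq.1 h3
  haveI := IsAlgClosed.isAlgClosure_of_transcendence_basis _ hs
  haveI := IsAlgClosed.isAlgClosure_of_transcendence_basis _ ht
  let E : Algebra.adjoin R (Set.range (Subtype.val : s → K)) ≃ₐ[R]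
      Algebra.adjoin R (Set.range (Subtype.val : t → L)) :=
    (hs.1.aevalEquiv.symm.trans (MvPolynomial.renameEquiv R e)).trans ht.1.aevalEquiv
  refine ⟨IsAlgClosure.equivOfEquiv K L E.toRingEquiv, fun r => ?_⟩
  rw [IsScalarTower.algebraMap_apply R (Algebra.adjoin R (Set.range (Subtype.val : s → K))) K,
    IsAlgClosure.equivOfEquiv_algebraMap]
  have : E.toRingEquiv (algebraMap R _ r) = algebraMap R _ r := E.commutes r
  rw [this, ← IsScalarTower.algebraMap_apply]

lemma exists_aut_of_root {z w : ℂ} (hz : IsIntegral ℚ z) (hw : Polynomial.aeval w (minpoly ℚ z) = 0) :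
    ∃ σ : ℂ ≃+* ℂ, σ z = w := by
  have hirr := minpoly.irreducible hz
  haveI : Fact (Irreducible (minpoly ℚ z)) := ⟨hirr⟩
  let R := AdjoinRoot (minpoly ℚ z)
  let f1 : R →ₐ[ℚ] ℂ := AdjoinRoot.liftAlgHom (minpoly ℚ z) (Algebra.ofId ℚ ℂ) z (minpoly.aeval ℚ z)
  let f2 : R →ₐ[ℚ] ℂ := AdjoinRoot.liftAlgHom (minpoly ℚ z) (Algebra.ofId ℚ ℂ) w hw
  have hR : (Cardinal.mk R) ≤ ℵ₀ := by
    haveI : Module.Finite ℚ R := (AdjoinRoot.powerBasis hirr.ne_zero).finite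
    haveI : Algebra.IsAlgebraic ℚ R := Algebra.IsAlgebraic.of_finite ℚ R
    have := Algebra.IsAlgebraic.cardinalMk_le_max ℚ R
    simpa using this
  have hC : ℵ₀ < (Cardinal.mk ℂ) := by
    rw [Cardinal.mk_complex]; exact Cardinal.aleph0_lt_continuum
  obtain ⟨σ, hσ⟩ := @exists_ringEquiv_over R ℂ ℂ _ _ _ f1.toRingHom.toAlgebra f2.toRingHom.toAlgebra
    _ _ hR hC hC rfl
  refine ⟨σ, ?_⟩
  have h1 : f1 (AdjoinRoot.root _) = z := AdjoinRoot.liftAlgHom_root _ _ _ _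
  have h2 : f2 (AdjoinRoot.root _) = w := AdjoinRoot.liftAlgHom_root _ _ _ _
  have h3 := hσ (AdjoinRoot.root _)
  rw [← h1, ← h2]; exact h3

lemma rational_of_fixed {z : ℂ} (hz : IsAlgebraic ℚ z) (h : ∀ σ : ℂ ≃+* ℂ, σ z = z) :
    ∃ q : ℚ, z = q := by
  have hzi : IsIntegral ℚ z := hz.isIntegral
  have hsep : (minpoly ℚ z).Separable := (minpoly.irreducible hzi).separable
  have hc := Polynomial.card_rootSet_eq_natDegree (K := ℂ) hsep (IsAlgClosed.splits _)
  have hsub : (minpoly ℚ z).rootSet ℂ ⊆ {z} := by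
    intro w hw
    obtain ⟨σ, hσ⟩ := exists_aut_of_root hzi ((Polynomial.mem_rootSet.1 hw).2)
    rw [h σ] at hσ
    exact hσ.symm
  have hle : (minpoly ℚ z).natDegree ≤ 1 := by
    rw [← hc, ← Nat.card_eq_fintype_card]
    calc Nat.card _ ≤ Nat.card ({z} : Set ℂ) := Nat.card_mono (Set.finite_singleton z) hsub
      _ = 1 := by simp
  have hpos := minpoly.natDegree_pos hzi
  obtain ⟨q, hq⟩ := (minpoly.natDegree_eq_one_iff (A := ℚ) (x := z)).1 (by omega)
  exact ⟨q, by rw [← hq]; simp⟩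

lemma exists_aut_root_of_unity {n k : ℕ} (hn : 0 < n) (hk : Nat.Coprime k n) {ζ : ℂ} (hζ : IsPrimitiveRoot ζ n) :
    ∃ σ : ℂ ≃+* ℂ, σ ζ = ζ ^ k := by
  have hi : IsIntegral ℚ ζ := (hζ.isIntegral hn).tower_top
  apply exists_aut_of_root hi
  have h1 := hζ.pow_of_coprime k hk
  rw [← Polynomial.cyclotomic_eq_minpoly_rat hζ hn, Polynomial.cyclotomic_eq_minpoly_rat h1 hn]
  exact minpoly.aeval _ _

end AutC

end PartP2

section PartP3a

section SL2Basics

variable {F : Type} [Field F]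

/-- The matrix with given entries. -/
def mkSL (a b c d : F) (h : a * d - b * c = 1) : SL2 F := ⟨!![a, b; c, d], by
  rw [Matrix.det_fin_two_of, h]⟩

/-- trace -/
def tr (A : SL2 F) : F := A 0 0 + A 1 1

@[simp] lemma mkSL_00 (a b c d : F) (h) : mkSL a b c d h 0 0 = a := rfl
@[simp] lemma mkSL_01 (a b c d : F) (h) : mkSL a b c d h 0 1 = b := rfl
@[simp] lemma mkSL_10 (a b c d : F) (h) : mkSL a b c d h 1 0 = c := rfl
@[simp] lemma mkSL_11 (a b c d : F) (h) : mkSL a b c d h 1 1 = d := rfl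

lemma sl_ext {A B : SL2 F} (h1 : A 0 0 = B 0 0) (h2 : A 0 1 = B 0 1) (h3 : A 1 0 = B 1 0)
    (h4 : A 1 1 = B 1 1) : A = B := by
  ext i j
  fin_cases i <;> fin_cases j <;> assumption

lemma sl_det (A : SL2 F) : A 0 0 * A 1 1 - A 0 1 * A 1 0 = 1 := by
  have := A.det_coe
  rwa [Matrix.det_fin_two] at this

@[simp] lemma sl_mul_00 (A B : SL2 F) : (A * B) 0 0 = A 0 0 * B 0 0 + A 0 1 * B 1 0 := by
  simp [Matrix.mul_apply, Fin.sum_univ_two]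
@[simp] lemma sl_mul_01 (A B : SL2 F) : (A * B) 0 1 = A 0 0 * B 0 1 + A 0 1 * B 1 1 := by
  simp [Matrix.mul_apply, Fin.sum_univ_two]
@[simp] lemma sl_mul_10 (A B : SL2 F) : (A * B) 1 0 = A 1 0 * B 0 0 + A 1 1 * B 1 0 := by
  simp [Matrix.mul_apply, Fin.sum_univ_two]
@[simp] lemma sl_mul_11 (A B : SL2 F) : (A * B) 1 1 = A 1 0 * B 0 1 + A 1 1 * B 1 1 := by
  simp [Matrix.mul_apply, Fin.sum_univ_two]
@[simp] lemma sl_inv_00 (A : SL2 F) : (A⁻¹) 0 0 = A 1 1 := by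
  rw [Matrix.SpecialLinearGroup.SL2_inv_expl]; rfl
@[simp] lemma sl_inv_01 (A : SL2 F) : (A⁻¹) 0 1 = - A 0 1 := by
  rw [Matrix.SpecialLinearGroup.SL2_inv_expl]; rfl
@[simp] lemma sl_inv_10 (A : SL2 F) : (A⁻¹) 1 0 = - A 1 0 := by
  rw [Matrix.SpecialLinearGroup.SL2_inv_expl]; rfl
@[simp] lemma sl_inv_11 (A : SL2 F) : (A⁻¹) 1 1 = A 0 0 := by
  rw [Matrix.SpecialLinearGroup.SL2_inv_expl]; rfl
@[simp] lemma sl_neg (A : SL2 F) (i j) : (-A) i j = - A i j := by simp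
@[simp] lemma sl_one_00 : (1 : SL2 F) 0 0 = 1 := by simp
@[simp] lemma sl_one_01 : (1 : SL2 F) 0 1 = 0 := by simp
@[simp] lemma sl_one_10 : (1 : SL2 F) 1 0 = 0 := by simp
@[simp] lemma sl_one_11 : (1 : SL2 F) 1 1 = 1 := by simp

lemma tr_conj (P A : SL2 F) : tr (P * A * P⁻¹) = tr A := by
  have := sl_det P
  simp only [tr, sl_mul_00, sl_mul_01, sl_mul_10, sl_mul_11, sl_inv_00, sl_inv_01, sl_inv_10, sl_inv_11]
  linear_combination (A 0 0 + A 1 1) * this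

@[simp] lemma tr_neg (A : SL2 F) : tr (-A) = - tr A := by
  simp only [tr, sl_neg]; ring

@[simp] lemma tr_inv (A : SL2 F) : tr A⁻¹ = tr A := by
  simp only [tr, sl_inv_00, sl_inv_11]; ring

lemma tr_one : tr (1 : SL2 F) = 2 := by simp only [tr, sl_one_00, sl_one_11]; norm_num

variable [CharP F 3]

lemma h3 : (3 : F) = 0 := by exact_mod_cast CharP.cast_eq_zero F 3

lemma tr_cube (A : SL2 F) : tr (A ^ 3) = tr A ^ 3 := by
  have := sl_det A
  have h := h3 (F := F)
  simp only [tr, pow_succ, pow_zero, one_mul, sl_mul_00, sl_mul_01, sl_mul_10, sl_mul_11]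
  linear_combination (-(A 0 0 + A 1 1) * (A 0 0 * A 1 1 - A 0 1 * A 1 0)) * h

/-- unipotent -/
def uu (x : F) : SL2 F := mkSL 1 x 0 1 (by ring)

/-- the companion-like matrix -/
def mm (c t : F) (hc : c ≠ 0) : SL2 F := mkSL 0 (-c⁻¹) c t (by field_simp; ring)

/-- diagonal -/
def dd (a : F) (h : a ≠ 0) : SL2 F := mkSL a 0 0 a⁻¹ (by field_simp; ring)

lemma ne_zero_of_char : (2 : F) ≠ 0 := by
  intro h
  have := h3 (F := F)
  exact one_ne_zero (α := F) (by linear_combination this - h)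

variable [Fintype F]

lemma ringChar_ne_two : ringChar F ≠ 2 := by
  rw [ringChar.eq F 3]; norm_num

lemma exists_quad (D k : F) (hD : D ≠ 0) : ∃ X y : F, X ^ 2 - D * y ^ 2 = k := by
  have hq : Fintype.card F % 2 = 1 := FiniteField.odd_card_of_char_ne_two ringChar_ne_two
  obtain ⟨X, y, h⟩ := FiniteField.exists_root_sum_quadratic (R := F)
    (f := Polynomial.X ^ 2 - Polynomial.C k) (g := Polynomial.C (-D) * Polynomial.X ^ 2)
    (Polynomial.degree_X_pow_sub_C (by decide) _)
    (Polynomial.degree_C_mul_X_pow 2 (neg_ne_zero.2 hD)) hq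
  refine ⟨X, y, ?_⟩
  simp at h
  linear_combination h

lemma exists_form (b c e : F) (hD : e ^ 2 + 4 * b * c ≠ 0) :
    ∃ x y : F, c * x ^ 2 + e * x * y - b * y ^ 2 = 1 := by
  have h2 := ne_zero_of_char (F := F)
  by_cases hc : c = 0
  · subst hc
    have he : e ≠ 0 := by rintro rfl; simp at hD
    refine ⟨(1 + b) / e, 1, ?_⟩
    field_simp
    ring
  · obtain ⟨X, y, h⟩ := exists_quad (e ^ 2 + 4 * b * c) (4 * c) hD
    refine ⟨(X - e * y) / (2 * c), y, ?_⟩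
    field_simp
    linear_combination h

lemma conj_mm (A : SL2 F) (h : tr A ^ 2 ≠ 1) :
    ∃ P : SL2 F, A = P * mm 1 (tr A) one_ne_zero * P⁻¹ := by
  have hd := sl_det A
  obtain ⟨x, y, hxy⟩ := exists_form (A 0 1) (A 1 0) (A 1 1 - A 0 0) (by
    intro h0
    apply h
    have := h3 (F := F)
    simp only [tr]
    linear_combination h0 + 4 * hd + this)
  let P : SL2 F := mkSL x (A 0 0 * x + A 0 1 * y) y (A 1 0 * x + A 1 1 * y)
    (by linear_combination hxy)
  refine ⟨P, ?_⟩
  rw [eq_mul_inv_iff_mul_eq]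
  apply sl_ext <;> simp [P, mm, tr]
  · linear_combination (-x) * hd
  · linear_combination (-y) * hd

lemma conj_of_tr (A B : SL2 F) (h : tr A ^ 2 ≠ 1) (hAB : tr A = tr B) :
    ∃ P : SL2 F, B = P * A * P⁻¹ := by
  obtain ⟨P, hP⟩ := conj_mm A h
  obtain ⟨P', hP'⟩ := conj_mm B (hAB ▸ h)
  refine ⟨P' * P⁻¹, ?_⟩
  rw [← hAB] at hP'
  rw [hP', eq_comm]
  conv_lhs => rw [hP]
  group

/-- class functions on SL2 which are even -/
structure EvenCl (k : SL2 F → ℂ) : Prop where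
  cl : IsClassFn k
  ev : ∀ A, k (-A) = k A

lemma EvenCl.tr_eq {k : SL2 F → ℂ} (hk : EvenCl k) {A B : SL2 F} (h : tr A ^ 2 ≠ 1) (hAB : tr A = tr B) :
    k A = k B := by
  obtain ⟨P, rfl⟩ := conj_of_tr A B h hAB
  rw [hk.cl]

lemma sq_one_iff {t : F} : t ^ 2 = 1 ↔ t = 1 ∨ t = -1 := by
  rw [sq, mul_self_eq_one_iff]

end SL2Basics

end PartP3a

section PartP3b

section Weyl

variable {F : Type} [Field F] [CharP F 3] [Fintype F] [DecidableEq F]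

/-- Bruhat type parametrisation. -/
def bruhatFun : (Fˣ × F × F) ⊕ (Fˣ × F) → SL2 F
  | Sum.inl (c, a, t) => mkSL a ((a * (t - a) - 1) / c) c (t - a) (by
      have := c.ne_zero
      field_simp; ring)
  | Sum.inr (a, b) => mkSL a b 0 (a : F)⁻¹ (by
      have := a.ne_zero
      field_simp; ring)

lemma bruhat_bij : Function.Bijective (bruhatFun (F := F)) := by
  constructor
  · rintro (⟨c, a, t⟩ | ⟨a, b⟩) (⟨c', a', t'⟩ | ⟨a', b'⟩) h
    · have h1 := congrArg (fun A : SL2 F => A 1 0) h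
      have h2 := congrArg (fun A : SL2 F => A 0 0) h
      have h4 := congrArg (fun A : SL2 F => A 1 1) h
      simp only [bruhatFun, mkSL_10, mkSL_00, mkSL_11] at h1 h2 h4
      have h5 : c = c' := Units.ext h1
      have h6 : t = t' := by linear_combination h4 + h2
      rw [h5, h2, h6]
    · have h1 := congrArg (fun A : SL2 F => A 1 0) h
      simp only [bruhatFun, mkSL_10] at h1
      exact absurd h1 c.ne_zero
    · have h1 := congrArg (fun A : SL2 F => A 1 0) h
      simp only [bruhatFun, mkSL_10] at h1
      exact absurd h1.symm c'.ne_zero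
    · have h1 := congrArg (fun A : SL2 F => A 0 0) h
      have h2 := congrArg (fun A : SL2 F => A 0 1) h
      simp only [bruhatFun, mkSL_01, mkSL_00] at h1 h2
      have h5 : a = a' := Units.ext h1
      rw [h5, h2]
  · intro A
    have hd := sl_det A
    by_cases hc : A 1 0 = 0
    · have ha : A 0 0 ≠ 0 := by intro h; rw [h, hc] at hd; simp at hd
      refine ⟨Sum.inr (Units.mk0 _ ha, A 0 1), ?_⟩
      apply sl_ext <;> simp [bruhatFun, hc]
      field_simp
      rw [hc] at hd
      linear_combination -hd
    · refine ⟨Sum.inl (Units.mk0 _ hc, A 0 0, tr A), ?_⟩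
      apply sl_ext <;> simp [bruhatFun, tr]
      field_simp
      linear_combination hd

variable {k : SL2 F → ℂ}

lemma sum_bruhat (hk : EvenCl k) : ∑ A, k A =
    (Fintype.card F : ℂ) * ∑ c : Fˣ, ∑ t : F, k (mm c t c.ne_zero) +
    ∑ a : Fˣ, ∑ b : F, k (bruhatFun (Sum.inr (a, b))) := by
  rw [← Fintype.sum_bijective _ bruhat_bij (fun x => k (bruhatFun x)) k (fun _ => rfl),
    Fintype.sum_sum_type]
  congr 1
  · rw [Fintype.sum_prod_type, Finset.mul_sum]
    refine Finset.sum_congr rfl (fun c _ => ?_)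
    rw [Fintype.sum_prod_type]
    have : ∀ a : F, ∑ t, k (bruhatFun (Sum.inl (c, a, t))) = ∑ t : F, k (mm c t c.ne_zero) := by
      intro a
      refine Finset.sum_congr rfl (fun t _ => ?_)
      rw [← hk.cl (mm c t c.ne_zero) (uu (a / c))]
      congr 1
      have := c.ne_zero
      rw [eq_mul_inv_iff_mul_eq]
      apply sl_ext <;> simp [bruhatFun, uu, mm] <;> field_simp <;> ring
    simp_rw [this]
    simp
  · rw [Fintype.sum_prod_type]

lemma k_mm_neg_one (hk : EvenCl k) (c : Fˣ) : k (mm c (-1) c.ne_zero) = k (uu (-c)) := by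
  rw [← hk.cl (uu (-(c : F))) (mkSL (-(c : F)⁻¹) (-1) 1 0 (by ring))]
  congr 1
  have := c.ne_zero
  have h := h3 (F := F)
  rw [eq_mul_inv_iff_mul_eq]
  apply sl_ext <;> simp [uu, mm]
  · linear_combination -h

lemma k_mm_one (hk : EvenCl k) (c : Fˣ) : k (mm c 1 c.ne_zero) = k (uu c) := by
  have h1 : mm (c : F) 1 c.ne_zero = - mm ((-c : Fˣ) : F) (-1) (-c).ne_zero := by
    apply sl_ext <;> simp [mm]
  rw [h1, hk.ev, k_mm_neg_one hk (-c)]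
  simp

lemma sum_split (g : F → ℂ) : ∑ t, g t = g 1 + g (-1) + ∑ t, if t ^ 2 = 1 then 0 else g t := by
  have h : ∀ t, g t = (if t = 1 then g t else 0) + (if t = -1 then g t else 0) +
      (if t ^ 2 = 1 then 0 else g t) := by
    intro t
    have h2 := ne_zero_of_char (F := F)
    have h1 : (1 : F) ≠ -1 := fun h => h2 (by linear_combination h)
    by_cases ht : t = 1
    · subst ht; simp [h1]
    · by_cases ht' : t = -1
      · subst ht'; simp [h1.symm]
      · simp [ht, ht']
  conv_lhs => rw [Finset.sum_congr rfl (fun t _ => h t)]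
  simp [Finset.sum_add_distrib]

lemma sum_split_units (g : F → ℂ) : ∑ t : Fˣ, g t = g 1 + g (-1) + ∑ t : Fˣ, if (t:F) ^ 2 = 1 then 0 else g t := by
  have h : ∀ t : Fˣ, g t = (if t = 1 then g t else 0) + (if t = -1 then g t else 0) +
      (if (t:F) ^ 2 = 1 then 0 else g t) := by
    intro t
    have h2 := ne_zero_of_char (F := F)
    have h1 : (1 : Fˣ) ≠ -1 := fun h => h2 (by
      have := congrArg Units.val h
      simp only [Units.val_one, Units.val_neg] at this
      linear_combination this)
    by_cases ht : t = 1
    · subst ht; simp [h1]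
    · by_cases ht' : t = -1
      · subst ht'; simp [h1.symm]
      · have : ¬ ((t : F) ^ 2 = 1) := by
          rw [sq_one_iff]
          rintro (h | h)
          · exact ht (Units.ext h)
          · exact ht' (Units.ext h)
        simp [ht, ht', this]
  conv_lhs => rw [Finset.sum_congr rfl (fun t _ => h t)]
  simp [Finset.sum_add_distrib]

/-- sum over nontrivial unipotents -/
noncomputable def usum (k : SL2 F → ℂ) : ℂ := ∑ x : Fˣ, k (uu (x : F))
/-- sum over regular traces -/
noncomputable def vsum (k : SL2 F → ℂ) : ℂ := ∑ t : F, if t ^ 2 = 1 then 0 else k (mm 1 t one_ne_zero)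

lemma usum_neg (k : SL2 F → ℂ) : ∑ x : Fˣ, k (uu (-x : F)) = usum k := by
  unfold usum
  exact Fintype.sum_equiv (Equiv.neg Fˣ) _ _ (fun x => by simp)

lemma tr_mm (c t : F) (h : c ≠ 0) : tr (mm c t h) = t := by simp [tr, mm]

lemma card_pred : (Fintype.card Fˣ : ℂ) = (Fintype.card F : ℂ) - 1 := by
  rw [Fintype.card_units, Nat.cast_sub Fintype.card_pos]; simp

lemma sum_part1 (hk : EvenCl k) : ∑ c : Fˣ, ∑ t : F, k (mm c t c.ne_zero) =
    2 * usum k + ((Fintype.card F : ℂ) - 1) * vsum k := by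
  have : ∀ c : Fˣ, ∑ t : F, k (mm c t c.ne_zero) = k (uu c) + k (uu (-c)) + vsum k := by
    intro c
    rw [sum_split (fun t => k (mm (c:F) t c.ne_zero)), k_mm_one hk, k_mm_neg_one hk]
    congr 1
    refine Finset.sum_congr rfl (fun t _ => ?_)
    split_ifs with h
    · rfl
    · exact hk.tr_eq (by rwa [tr_mm]) (by rw [tr_mm, tr_mm])
  simp_rw [this]
  rw [Finset.sum_add_distrib, Finset.sum_add_distrib, usum_neg, Finset.sum_const, Finset.card_univ, nsmul_eq_mul,
    card_pred]
  unfold usum; ring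

lemma sum_uu (k : SL2 F → ℂ) : ∑ b : F, k (uu b) = k 1 + usum k := by
  unfold usum
  have h0 : uu (0 : F) = 1 := by apply sl_ext <;> simp [uu]
  have h1 : ∑ b ∈ Finset.univ.erase (0 : F), k (uu b) = ∑ x : Fˣ, k (uu (x : F)) := by
    symm
    apply Finset.sum_bij (fun (x : Fˣ) _ => (x : F))
    · intro a _; simp
    · intro a _ b _ h; exact Units.ext h
    · intro b hb
      exact ⟨Units.mk0 b (by simpa using hb), Finset.mem_univ _, rfl⟩
    · intros; rfl
  rw [← h1, ← h0]
  exact (Finset.add_sum_erase _ _ (Finset.mem_univ _)).symm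

lemma sum_part2 (hk : EvenCl k) : ∑ a : Fˣ, ∑ b : F, k (bruhatFun (Sum.inr (a, b))) =
    2 * (k 1 + usum k) + (Fintype.card F : ℂ) * ∑ a : Fˣ, if (a : F) ^ 2 = 1 then 0 else
      k (mm 1 ((a : F) + (a:F)⁻¹) one_ne_zero) := by
  let g : F → ℂ := fun a => if h : a = 0 then 0 else ∑ b : F, k (bruhatFun (Sum.inr (Units.mk0 a h, b)))
  have hg : ∀ a : Fˣ, ∑ b : F, k (bruhatFun (Sum.inr (a, b))) = g a := by
    intro a; simp [g]
  simp_rw [hg]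
  rw [sum_split_units]
  have g1 : g 1 = k 1 + usum k := by
    rw [← sum_uu]
    simp only [g, one_ne_zero, dite_false]
    refine Finset.sum_congr rfl (fun b _ => congrArg k ?_)
    apply sl_ext <;> simp [bruhatFun, uu]
  have g2 : g (-1) = k 1 + usum k := by
    rw [← sum_uu]
    simp only [g, neg_eq_zero, one_ne_zero, dite_false]
    apply Fintype.sum_equiv (Equiv.neg F)
    intro b
    rw [← hk.ev]
    refine congrArg k ?_
    apply sl_ext <;> simp [bruhatFun, uu]
  rw [g1, g2, two_mul, Finset.mul_sum]
  congr 1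
  refine Finset.sum_congr rfl (fun a _ => ?_)
  have ha := a.ne_zero
  split_ifs with h
  · simp
  · simp only [g, ha, dite_false]
    have h5 : ∀ b : F, k (bruhatFun (Sum.inr (Units.mk0 (a:F) ha, b))) = k (mm 1 ((a : F) + (a:F)⁻¹) one_ne_zero) := by
      intro b
      have htr : tr (bruhatFun (Sum.inr (Units.mk0 (a:F) ha, b))) = (a : F) + (a:F)⁻¹ := by
        simp [tr, bruhatFun]
      apply hk.tr_eq
      · rw [htr]
        intro h0
        have h1 : ((a : F) - (a:F)⁻¹) ^ 2 = 0 := by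
          have := h3 (F := F)
          have h6 : (a : F) * (a:F)⁻¹ = 1 := mul_inv_cancel₀ ha
          linear_combination h0 - 4 * h6 - this
        have h2 : (a : F) - (a:F)⁻¹ = 0 := by simpa using h1
        apply h
        field_simp at h2
        linear_combination h2
      · rw [htr, tr_mm]
    simp_rw [h5]
    simp

end Weyl

end PartP3b

section PartP3c

section Tori

variable {F : Type} [Field F]

/-- the tori -/
def TT (F : Type) [Field F] (κ : ℤˣ) : Subgroup (SL2 F) where
  carrier := {A | A 0 0 = A 1 1 ∧ A 0 1 = ((κ : ℤ) : F) * A 1 0}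
  one_mem' := by simp
  mul_mem' := by
    rintro A B ⟨h1, h2⟩ ⟨h3, h4⟩
    constructor
    · simp only [sl_mul_00, sl_mul_11, h1, h2, h3, h4]; ring
    · simp only [sl_mul_01, sl_mul_10, h1, h2, h3, h4]; ring
  inv_mem' := by
    rintro A ⟨h1, h2⟩
    constructor
    · simp only [sl_inv_00, sl_inv_11, h1]
    · simp only [sl_inv_01, sl_inv_10, h2]; ring

lemma mem_TT {κ : ℤˣ} {A : SL2 F} : A ∈ TT F κ ↔ A 0 0 = A 1 1 ∧ A 0 1 = ((κ : ℤ) : F) * A 1 0 := Iff.rfl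

instance TT.comm (κ : ℤˣ) : CommGroup (TT F κ) :=
  { (inferInstance : Group (TT F κ)) with
    mul_comm := by
      rintro ⟨A, h1, h2⟩ ⟨B, h3, h4⟩
      apply Subtype.ext
      apply sl_ext
      · simp only [Subgroup.coe_mul, sl_mul_00, h1, h2, h3, h4]; ring
      · simp only [Subgroup.coe_mul, sl_mul_01, h1, h2, h3, h4]; ring
      · simp only [Subgroup.coe_mul, sl_mul_10, h1, h2, h3, h4]; ring
      · simp only [Subgroup.coe_mul, sl_mul_11, h1, h2, h3, h4]; ring }

lemma TT_eq {κ : ℤˣ} (τ : TT F κ) : (τ : SL2 F) 0 0 ^ 2 - ((κ : ℤ) : F) * (τ : SL2 F) 1 0 ^ 2 = 1 := by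
  have := sl_det (τ : SL2 F)
  rw [← τ.2.1, τ.2.2] at this
  linear_combination this

lemma TT_tr {κ : ℤˣ} (τ : TT F κ) : tr (τ : SL2 F) = 2 * (τ : SL2 F) 0 0 := by
  rw [tr, ← τ.2.1]; ring

lemma TT_ext {κ : ℤˣ} {τ σ : TT F κ} (h1 : (τ : SL2 F) 0 0 = (σ : SL2 F) 0 0)
    (h2 : (τ : SL2 F) 1 0 = (σ : SL2 F) 1 0) : τ = σ := by
  apply Subtype.ext
  apply sl_ext h1 _ h2
  · rw [← τ.2.1, ← σ.2.1, h1]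
  · rw [τ.2.2, σ.2.2, h2]

/-- element of torus from coordinates -/
def mkT (κ : ℤˣ) (x y : F) (h : x ^ 2 - ((κ : ℤ) : F) * y ^ 2 = 1) : TT F κ :=
  ⟨mkSL x (((κ : ℤ) : F) * y) y x (by linear_combination h), by simp [mem_TT]⟩

/-- minus one -/
def negT (κ : ℤˣ) : TT F κ := ⟨-1, by simp [mem_TT]⟩

lemma kF_ne (κ : ℤˣ) : ((κ : ℤ) : F) ≠ 0 := by
  rcases Int.units_eq_one_or κ with rfl | rfl <;> simp

lemma kF_sq (κ : ℤˣ) : ((κ : ℤ) : F) * ((κ : ℤ) : F) = 1 := by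
  rcases Int.units_eq_one_or κ with rfl | rfl <;> simp

variable [CharP F 3]

lemma TT_same_tr {κ : ℤˣ} {τ σ : TT F κ} (h : tr (τ : SL2 F) = tr (σ : SL2 F)) : τ = σ ∨ τ = σ⁻¹ := by
  have h2 := ne_zero_of_char (F := F)
  rw [TT_tr, TT_tr] at h
  have h1 := mul_left_cancel₀ h2 h
  have h4 := TT_eq τ
  have h5 := TT_eq σ
  rw [h1] at h4
  have h6 : (τ : SL2 F) 1 0 ^ 2 = (σ : SL2 F) 1 0 ^ 2 :=
    mul_left_cancel₀ (kF_ne κ) (by linear_combination h5 - h4)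
  rcases sq_eq_sq_iff_eq_or_eq_neg.1 h6 with h7 | h7
  · left; exact TT_ext h1 h7
  · right
    apply TT_ext
    · rw [Subgroup.coe_inv, sl_inv_00, ← σ.2.1, h1]
    · rw [Subgroup.coe_inv, sl_inv_10, h7]

lemma TT_tr_sq {κ : ℤˣ} {τ : TT F κ} : tr (τ : SL2 F) ^ 2 = 1 ↔ τ = 1 ∨ τ = negT κ := by
  have h := h3 (F := F)
  constructor
  · intro h1
    rw [TT_tr] at h1
    have h2 := TT_eq τ
    have h4 : (τ : SL2 F) 1 0 = 0 := by
      have : (τ : SL2 F) 1 0 ^ 2 = 0 := mul_left_cancel₀ (kF_ne κ) (by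
        linear_combination -h2 + h1 - (τ : SL2 F) 0 0 ^ 2 * h)
      simpa using this
    rw [h4] at h2
    have h5 : (τ : SL2 F) 0 0 ^ 2 = 1 := by linear_combination h2
    rcases (by rwa [sq, mul_self_eq_one_iff] at h5 : _ ∨ _) with h6 | h6
    · left; exact TT_ext (by simp [h6]) (by simp [h4])
    · right; exact TT_ext (by simp [h6, negT]) (by simp [h4, negT])
  · rintro (rfl | rfl) <;> rw [TT_tr] <;>
      simp only [negT, Subgroup.coe_one, sl_neg, sl_one_00] <;> linear_combination h

lemma TT_sq {κ : ℤˣ} {τ : TT F κ} : τ ^ 2 = 1 ↔ τ = 1 ∨ τ = negT κ := by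
  constructor
  · intro h
    have h1 : τ = τ⁻¹ := by rw [eq_inv_iff_mul_eq_one, ← sq, h]
    have h4 := congrArg (fun σ : TT F κ => (σ : SL2 F) 1 0) h1
    simp only [Subgroup.coe_inv, sl_inv_10] at h4
    have h2 := ne_zero_of_char (F := F)
    have h5 : (τ : SL2 F) 1 0 = 0 := mul_left_cancel₀ h2 (by linear_combination h4)
    have h6 := TT_eq τ
    rw [h5] at h6
    rw [← TT_tr_sq, TT_tr]
    have := h3 (F := F)
    linear_combination 4 * h6 + this
  · rintro (rfl | rfl)
    · simp
    · apply TT_ext <;> simp [negT, sq]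

lemma negT_ne (κ : ℤˣ) : (negT κ : TT F κ) ≠ 1 := by
  intro h
  have h4 := congrArg (fun σ : TT F κ => (σ : SL2 F) 0 0) h
  simp [negT] at h4
  have h2 := ne_zero_of_char (F := F)
  exact h2 (by linear_combination -h4)

lemma negT_mul {κ : ℤˣ} (τ : TT F κ) : ((negT κ * τ : TT F κ) : SL2 F) = - (τ : SL2 F) := by
  simp [negT]

instance TT.cyclic (κ : ℤˣ) [Finite F] : IsCyclic (TT F κ) := by
  obtain ⟨i, hi⟩ := IsAlgClosed.exists_pow_nat_eq
    (algebraMap F (AlgebraicClosure F) ((κ : ℤ) : F)) (n := 2) (by norm_num)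
  let e := algebraMap F (AlgebraicClosure F)
  have he : Function.Injective e := e.injective
  have hk : e ((κ : ℤ) : F) = i ^ 2 := hi.symm
  let f : TT F κ →* AlgebraicClosure F :=
    { toFun := fun τ => e ((τ : SL2 F) 0 0) + i * e ((τ : SL2 F) 1 0)
      map_one' := by simp
      map_mul' := by
        intro τ σ
        simp only [Subgroup.coe_mul, sl_mul_00, sl_mul_10, τ.2.2, ← τ.2.1, map_add, map_mul, hk]
        ring }
  apply isCyclic_of_injective_ringHom f
  intro τ σ h
  have h1 : f τ⁻¹ = f σ⁻¹ := by
    have h5 : f τ * f τ⁻¹ = 1 := by rw [← map_mul]; simp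
    have h6 : f σ * f σ⁻¹ = 1 := by rw [← map_mul]; simp
    rw [h] at h5
    have h7 : f σ ≠ 0 := by intro h0; rw [h0] at h6; simp at h6
    exact mul_left_cancel₀ h7 (h5.trans h6.symm)
  simp only [f, MonoidHom.coe_mk, OneHom.coe_mk, Subgroup.coe_inv, sl_inv_00, sl_inv_10, ← τ.2.1, ← σ.2.1,
    map_neg] at h h1
  have h2 : e 2 ≠ 0 := by rw [Ne, map_eq_zero]; exact ne_zero_of_char
  have hi0 : i ≠ 0 := by
    rintro rfl
    rw [zero_pow two_ne_zero, map_eq_zero] at hk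
    exact kF_ne κ hk
  rw [map_ofNat] at h2
  apply TT_ext
  · apply he; apply mul_left_cancel₀ h2; linear_combination h + h1
  · apply he; apply mul_left_cancel₀ hi0; apply mul_left_cancel₀ h2; linear_combination h - h1

end Tori

section ToriCount
variable {F : Type} [Field F] [CharP F 3] [Fintype F] [DecidableEq F]

noncomputable instance TT.fintype (κ : ℤˣ) : Fintype (TT F κ) := Fintype.ofFinite _

lemma TT_sum (κ : ℤˣ) (g : F → ℂ) : ∑ τ : TT F κ, g (tr (τ : SL2 F)) =
    ∑ x : F, ((Finset.univ.filter (fun y : F => x ^ 2 - ((κ : ℤ) : F) * y ^ 2 = 1)).card : ℂ) * g (2 * x) := by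
  have h1 : ∀ x : F, ((Finset.univ.filter (fun y : F => x ^ 2 - ((κ : ℤ) : F) * y ^ 2 = 1)).card : ℂ) * g (2 * x) =
      ∑ y : F, if x ^ 2 - ((κ : ℤ) : F) * y ^ 2 = 1 then g (2 * x) else 0 := by
    intro x
    rw [← Finset.sum_filter, Finset.sum_const, nsmul_eq_mul]
  simp_rw [h1]
  rw [← Fintype.sum_prod_type' (f := fun x y => if x ^ 2 - ((κ : ℤ) : F) * y ^ 2 = 1 then g (2 * x) else 0),
    ← Finset.sum_filter]
  apply Finset.sum_bij (fun (τ : TT F κ) _ => ((τ : SL2 F) 0 0, (τ : SL2 F) 1 0))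
  · intro τ _; simp [TT_eq]
  · intro τ _ σ _ h
    simp only [Prod.mk.injEq] at h
    exact TT_ext h.1 h.2
  · rintro ⟨x, y⟩ h
    simp only [Finset.mem_filter, Finset.mem_univ, true_and] at h
    exact ⟨mkT κ x y h, Finset.mem_univ _, rfl⟩
  · intro τ _; rw [TT_tr]

lemma count_sum (hneg : ¬ IsSquare (-1 : F)) (x : F) :
    ((Finset.univ.filter (fun y : F => x ^ 2 - (((1 : ℤˣ) : ℤ) : F) * y ^ 2 = 1)).card : ℂ) +
    ((Finset.univ.filter (fun y : F => x ^ 2 - (((-1 : ℤˣ) : ℤ) : F) * y ^ 2 = 1)).card : ℂ) = 2 := by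
  have h1 := quadraticChar_card_sqrts (F := F) ringChar_ne_two (x ^ 2 - 1)
  have h2 := quadraticChar_card_sqrts (F := F) ringChar_ne_two (-1 * (x ^ 2 - 1))
  rw [map_mul, quadraticChar_neg_one_iff_not_isSquare.2 hneg] at h2
  have e1 : (Finset.univ.filter (fun y : F => x ^ 2 - (((1 : ℤˣ) : ℤ) : F) * y ^ 2 = 1)) = {y : F | y ^ 2 = x ^ 2 - 1}.toFinset := by
    ext y
    simp only [Finset.mem_filter, Finset.mem_univ, true_and, Set.mem_toFinset, Set.mem_ofPred_eq]
    constructor <;> intro h <;> push_cast at * <;> linear_combination -h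
  have e2 : (Finset.univ.filter (fun y : F => x ^ 2 - (((-1 : ℤˣ) : ℤ) : F) * y ^ 2 = 1)) = {y : F | y ^ 2 = -1 * (x ^ 2 - 1)}.toFinset := by
    ext y
    simp only [Finset.mem_filter, Finset.mem_univ, true_and, Set.mem_toFinset, Set.mem_ofPred_eq]
    constructor <;> intro h <;> push_cast at * <;> linear_combination h
  rw [e1, e2]
  have : (({y : F | y ^ 2 = x ^ 2 - 1}.toFinset.card : ℤ) + ({y : F | y ^ 2 = -1 * (x ^ 2 - 1)}.toFinset.card : ℤ)) = 2 := by
    rw [h1, h2]; ring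
  exact_mod_cast this

lemma TT_sum_both (hneg : ¬ IsSquare (-1 : F)) (g : F → ℂ) :
    ∑ τ : TT F 1, g (tr (τ : SL2 F)) + ∑ τ : TT F (-1), g (tr (τ : SL2 F)) = 2 * ∑ t : F, g t := by
  rw [TT_sum, TT_sum, ← Finset.sum_add_distrib]
  simp_rw [← add_mul, count_sum hneg]
  rw [← Finset.mul_sum]
  congr 1
  exact Fintype.sum_equiv (Equiv.mulLeft₀ 2 ne_zero_of_char) _ _ (fun x => rfl)

lemma TT_sum_one (g : F → ℂ) :
    ∑ τ : TT F 1, g (tr (τ : SL2 F)) = ∑ a : Fˣ, g ((a : F) + (a : F)⁻¹) := by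
  symm
  have h := h3 (F := F)
  apply Finset.sum_bij (fun (a : Fˣ) _ => mkT 1 (-((a : F) + (a : F)⁻¹)) (-((a : F) - (a : F)⁻¹)) (by
    have := a.ne_zero
    push_cast; field_simp; linear_combination (a:F)^2 * h))
  · intros; simp
  · intro a _ b _ hab
    have h1 := congrArg (fun σ : TT F 1 => (σ : SL2 F) 0 0 + (σ : SL2 F) 1 0) hab
    simp only [mkT, mkSL_00, mkSL_10] at h1
    apply Units.ext
    linear_combination h1 + (a - b : F) * h
  · intro τ _
    have h1 := TT_eq τ
    push_cast at h1
    have h2 : ((τ : SL2 F) 0 0 + (τ : SL2 F) 1 0) * ((τ : SL2 F) 0 0 - (τ : SL2 F) 1 0) = 1 := by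
      linear_combination h1
    refine ⟨Units.mkOfMulEqOne _ _ h2, Finset.mem_univ _, ?_⟩
    have h4 : (((Units.mkOfMulEqOne _ _ h2 : Fˣ) : F))⁻¹ = ((τ : SL2 F) 0 0 - (τ : SL2 F) 1 0) := by
      rw [← Units.val_inv_eq_inv_val]; rfl
    have h5 : ((Units.mkOfMulEqOne _ _ h2 : Fˣ) : F) = ((τ : SL2 F) 0 0 + (τ : SL2 F) 1 0) := rfl
    apply TT_ext
    · simp only [mkT, mkSL_00]
      rw [h4, h5]; linear_combination (-(τ : SL2 F) 0 0) * h
    · simp only [mkT, mkSL_10]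
      rw [h4, h5]; linear_combination (-(τ : SL2 F) 1 0) * h
  · intro a _
    rw [TT_tr]
    simp only [mkT, mkSL_00]
    congr 1
    linear_combination ((a : F) + (a : F)⁻¹) * h

lemma TT_card_one : (Nat.card (TT F 1) : ℂ) = Fintype.card F - 1 := by
  have := TT_sum_one (F := F) (fun _ => 1)
  simp only [Finset.sum_const, nsmul_eq_mul, Finset.card_univ, mul_one] at this
  rw [Nat.card_eq_fintype_card, this, card_pred]

lemma TT_card_C (hneg : ¬ IsSquare (-1 : F)) (κ : ℤˣ) : (Nat.card (TT F κ) : ℂ) = Fintype.card F - ((κ : ℤ) : ℂ) := by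
  have h1 := TT_card_one (F := F)
  rcases Int.units_eq_one_or κ with rfl | rfl
  · rw [h1]; simp
  · have := TT_sum_both (F := F) hneg (fun _ => 1)
    simp only [Finset.sum_const, nsmul_eq_mul, Finset.card_univ, mul_one, ← Nat.card_eq_fintype_card] at this
    rw [h1, Nat.card_eq_fintype_card (α := F)] at this
    push_cast
    linear_combination this

/-- regular torus sum -/
noncomputable def wsum (κ : ℤˣ) (k : SL2 F → ℂ) : ℂ := ∑ τ : TT F κ, if tr (τ : SL2 F) ^ 2 = 1 then 0 else k τ

/-- regular value -/
noncomputable def vfun (k : SL2 F → ℂ) (t : F) : ℂ := if t ^ 2 = 1 then 0 else k (mm 1 t one_ne_zero)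

lemma wsum_eq (κ : ℤˣ) {k : SL2 F → ℂ} (hk : EvenCl k) : wsum κ k =
    ∑ τ : TT F κ, vfun k (tr (τ : SL2 F)) := by
  refine Finset.sum_congr rfl (fun τ _ => ?_)
  unfold vfun
  split_ifs with h
  · rfl
  · exact hk.tr_eq h (by rw [tr_mm])

lemma weyl (hneg : ¬ IsSquare (-1 : F)) {k : SL2 F → ℂ} (hk : EvenCl k) :
    2 * ∑ A, k A = 4 * k 1 + 4 * (Fintype.card F + 1) * usum k +
      Fintype.card F * (Fintype.card F + 1) * wsum 1 k + Fintype.card F * (Fintype.card F - 1) * wsum (-1) k := by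
  have h1 : wsum 1 k + wsum (-1) k = 2 * vsum k := by
    rw [wsum_eq _ hk, wsum_eq _ hk]; exact TT_sum_both hneg _
  have h2 : wsum 1 k = ∑ a : Fˣ, if (a : F) ^ 2 = 1 then 0 else
      k (mm 1 ((a : F) + (a:F)⁻¹) one_ne_zero) := by
    rw [wsum_eq _ hk]
    refine (TT_sum_one _).trans ?_
    unfold vfun
    refine Finset.sum_congr rfl (fun a _ => ?_)
    have : ((a : F) + (a : F)⁻¹) ^ 2 = 1 ↔ (a : F) ^ 2 = 1 := by
      have ha := a.ne_zero
      have h := h3 (F := F)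
      have h6 : (a : F) * (a:F)⁻¹ = 1 := mul_inv_cancel₀ ha
      constructor
      · intro h0
        have h1 : ((a : F) - (a:F)⁻¹) ^ 2 = 0 := by
          linear_combination h0 - 4 * h6 - h
        have h2 : (a : F) - (a:F)⁻¹ = 0 := by simpa using h1
        field_simp at h2
        linear_combination h2
      · intro h0
        have : (a : F)⁻¹ = a := by
          field_simp
          exact h0.symm
        rw [this]; linear_combination 4 * h0 + h
    simp only [this]
  rw [sum_bruhat hk, sum_part1 hk, sum_part2 hk, ← h2]
  linear_combination (-(Fintype.card F : ℂ) * (Fintype.card F - 1)) * h1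

lemma TT_split (κ : ℤˣ) (g : TT F κ → ℂ) :
    ∑ τ, g τ = g 1 + g (negT κ) + ∑ τ : TT F κ, if tr (τ : SL2 F) ^ 2 = 1 then 0 else g τ := by
  classical
  have h : ∀ τ, g τ = (if τ = 1 then g τ else 0) + (if τ = negT κ then g τ else 0) +
      (if tr (τ : SL2 F) ^ 2 = 1 then 0 else g τ) := by
    intro τ
    have h1 := negT_ne (F := F) κ
    by_cases ht : τ = 1
    · have := TT_tr_sq.2 (Or.inl ht)
      subst ht; simp only [this]; simp [h1.symm]
    · by_cases ht' : τ = negT κ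
      · have := TT_tr_sq.2 (Or.inr ht')
        subst ht'; simp only [this]; simp [h1]
      · have : ¬ tr (τ : SL2 F) ^ 2 = 1 := fun h => by
          rcases TT_tr_sq.1 h with h | h
          · exact ht h
          · exact ht' h
        simp [ht, ht', this]
  conv_lhs => rw [Finset.sum_congr rfl (fun t _ => h t)]
  simp [Finset.sum_add_distrib]

lemma wsum_full (κ : ℤˣ) {k : SL2 F → ℂ} (hk : EvenCl k) : wsum κ k = ∑ τ : TT F κ, k τ - 2 * k 1 := by
  rw [TT_split]
  have : k ((negT κ : TT F κ) : SL2 F) = k 1 := hk.ev 1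
  rw [this]
  simp only [wsum, Subgroup.coe_one]
  ring

lemma card_SL (hneg : ¬ IsSquare (-1 : F)) :
    (Nat.card (SL2 F) : ℂ) = Fintype.card F * (Fintype.card F ^ 2 - 1) := by
  have hk : EvenCl (fun _ : SL2 F => (1 : ℂ)) := ⟨fun _ _ => rfl, fun _ => rfl⟩
  have h := weyl hneg hk
  rw [wsum_full _ hk, wsum_full _ hk, usum] at h
  simp only [Finset.sum_const, nsmul_eq_mul, Finset.card_univ, mul_one, card_pred] at h
  rw [← Nat.card_eq_fintype_card, ← Nat.card_eq_fintype_card (α := TT F 1),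
    ← Nat.card_eq_fintype_card (α := TT F (-1)), TT_card_C hneg, TT_card_C hneg] at h
  push_cast at h
  linear_combination h / 2

end ToriCount

end PartP3c

section PartP4a

section Gen

variable {G H : Type} [Group G] [Fintype G] [Group H] [Fintype H]

lemma ip_surj (π : G →* H) (hπ : Function.Surjective π) (f h : H → ℂ) :
    ip (fun g => f (π g)) (fun g => h (π g)) = ip f h := by
  classical
  have key : ∃ c : ℂ, ∀ u : H → ℂ, ∑ g, u (π g) = c * ∑ x, u x := by
    refine ⟨((Finset.univ.filter (fun g => π g = 1)).card : ℂ), fun u => ?_⟩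
    rw [← Finset.sum_fiberwise (s := Finset.univ) (g := π), Finset.mul_sum]
    refine Finset.sum_congr rfl (fun x _ => ?_)
    rw [Finset.sum_congr rfl (fun g hg => by rw [(Finset.mem_filter.1 hg).2] : ∀ g ∈ Finset.univ.filter (fun g => π g = x), u (π g) = u x)]
    rw [Finset.sum_const, nsmul_eq_mul]
    congr 2
    exact MonoidHom.card_fiber_eq_of_mem_range π (hπ x) (hπ 1)
  obtain ⟨c, hc⟩ := key
  have h1 := hc (fun _ => 1)
  simp only [Finset.sum_const, nsmul_eq_mul, Finset.card_univ, mul_one, ← Nat.card_eq_fintype_card] at h1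
  have h2 := hc (fun x => f x * h x⁻¹)
  simp only [ip]
  have h3 := card_ne G
  have h4 := card_ne H
  simp only [map_inv]
  rw [h2, h1]
  have : c ≠ 0 := by rintro rfl; rw [zero_mul] at h1; exact h3 h1
  field_simp

lemma ab_complete {T : Type} [CommGroup T] [Fintype T] (g : T → ℂ)
    (h : ∀ θ : T →* ℂ, ip g (fun t => θ t) = 0) : g = 0 := by
  classical
  funext t
  have h1 : ∑ l : AddChar (Additive T) ℂ, infl (MonoidHom.id T) l t * ip g (fun x => infl (MonoidHom.id T) l x) = 0 :=
    Finset.sum_eq_zero (fun l _ => by rw [h, mul_zero])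
  simp only [ip] at h1
  have h2 : ∀ l : AddChar (Additive T) ℂ, infl (MonoidHom.id T) l t * ((Nat.card T : ℂ)⁻¹ *
      ∑ x, g x * infl (MonoidHom.id T) l x⁻¹) = (Nat.card T : ℂ)⁻¹ * ∑ x, g x * infl (MonoidHom.id T) l (t * x⁻¹) := by
    intro l
    rw [Finset.mul_sum, Finset.mul_sum, Finset.mul_sum]
    refine Finset.sum_congr rfl (fun x _ => ?_)
    rw [map_mul]; ring
  simp_rw [h2] at h1
  rw [← Finset.mul_sum, Finset.sum_comm] at h1
  simp_rw [← Finset.mul_sum] at h1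
  have hsum : ∀ x : T, ∑ l : AddChar (Additive T) ℂ, infl (MonoidHom.id T) l x = if x = 1 then (Nat.card T : ℂ) else 0 := by
    intro x
    have := AddChar.sum_apply_eq_ite (Additive.ofMul x)
    simp only [infl, MonoidHom.coe_mk, OneHom.coe_mk, MonoidHom.id_apply]
    rw [this]
    simp [ofMul_eq_zero, Nat.card_eq_fintype_card]
  simp_rw [hsum] at h1
  have h3 := card_ne T
  simp_rw [mul_inv_eq_one] at h1
  simpa [h3] using h1

end Gen

section PSLmk
variable {F : Type} [Field F]

/-- the projection -/
def pmk : SL2 F →* PSL2 F := QuotientGroup.mk' _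

lemma pmk_surj : Function.Surjective (pmk (F := F)) := QuotientGroup.mk'_surjective _

lemma mem_center {A : SL2 F} : A ∈ Subgroup.center (SL2 F) ↔ A = 1 ∨ A = -1 := by
  rw [Matrix.SpecialLinearGroup.mem_center_iff]
  constructor
  · rintro ⟨r, hr, h⟩
    simp only [Fintype.card_fin] at hr
    rw [sq, mul_self_eq_one_iff] at hr
    rcases hr with rfl | rfl
    · left; ext i j; rw [← h]; simp
    · right; ext i j; rw [← h]; fin_cases i <;> fin_cases j <;> simp
  · rintro (rfl | rfl)
    · exact ⟨1, by simp, by simp⟩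
    · exact ⟨-1, by simp, by ext i j; fin_cases i <;> fin_cases j <;> simp⟩

lemma pmk_eq {A B : SL2 F} : pmk A = pmk B ↔ B = A ∨ B = -A := by
  rw [pmk, QuotientGroup.mk'_apply, QuotientGroup.mk'_apply, QuotientGroup.eq, mem_center]
  constructor
  · rintro (h | h)
    · left; exact (inv_mul_eq_one.1 h).symm
    · right; rw [inv_mul_eq_iff_eq_mul] at h; rw [h]; simp
  · rintro (rfl | rfl)
    · left; simp
    · right; simp

lemma pmk_neg (A : SL2 F) : pmk (-A) = pmk A := by rw [pmk_eq]; right; simp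

noncomputable instance psl_fintype [Fintype F] : Fintype (PSL2 F) := Fintype.ofFinite _

variable [CharP F 3] [Fintype F] [DecidableEq F]

lemma lift_even {χ : PSL2 F → ℂ} (h : IsClassFn χ) : EvenCl (fun A => χ (pmk A)) :=
  ⟨h.comp pmk, fun A => by rw [pmk_neg]⟩

/-- push an even function down -/
noncomputable def push (k : SL2 F → ℂ) : PSL2 F → ℂ := fun s => k (Quotient.out s)

lemma push_pmk {k : SL2 F → ℂ} (hk : ∀ A, k (-A) = k A) (A : SL2 F) : push k (pmk A) = k A := by
  have : pmk (Quotient.out (pmk A)) = pmk A := Quotient.out_eq' (pmk A)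
  unfold push
  rcases pmk_eq.1 this with h | h
  · rw [← h]
  · conv_rhs => rw [h]
    rw [hk]

lemma push_class {k : SL2 F → ℂ} (hk : EvenCl k) : IsClassFn (push k) := by
  intro g h
  obtain ⟨A, rfl⟩ := pmk_surj g
  obtain ⟨B, rfl⟩ := pmk_surj h
  rw [← map_inv, ← map_mul, ← map_mul, push_pmk hk.ev, push_pmk hk.ev, hk.cl]

lemma ip_push {k : SL2 F → ℂ} (hk : EvenCl k) (h : PSL2 F → ℂ) :
    ip (push k) h = ip k (fun A => h (pmk A)) := by
  rw [← ip_surj pmk pmk_surj]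
  congr 1
  funext A
  exact push_pmk hk.ev A

end PSLmk

end PartP4a

section PartP4b

section RRdef
variable {F : Type} [Field F] [CharP F 3] [Fintype F] [DecidableEq F]

/-- the (virtual) Deligne-Lusztig type class function, up to sign -/
noncomputable def RR (κ : ℤˣ) (θ : TT F κ →* ℂ) (A : SL2 F) : ℂ :=
  if A = 1 ∨ A = -1 then (Fintype.card F : ℂ) + ((κ : ℤ) : ℂ) else
  if tr A ^ 2 = 1 then ((κ : ℤ) : ℂ) else ((κ : ℤ) : ℂ) * ∑ τ : TT F κ, if tr (τ : SL2 F) = tr A then θ τ else 0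

lemma RR_even (κ : ℤˣ) (θ : TT F κ →* ℂ) (hθ : θ (negT κ) = 1) : EvenCl (RR κ θ) := by
  constructor
  · intro A B
    unfold RR
    have h1 : (B * A * B⁻¹ = 1) ↔ A = 1 := by rw [conj_eq_one_iff]
    have h2 : (B * A * B⁻¹ = -1) ↔ A = -1 := by
      constructor
      · intro h
        rw [mul_inv_eq_iff_eq_mul] at h
        have : B * A = B * (-1) := by rw [h]; simp
        exact mul_left_cancel this
      · rintro rfl; simp
    simp only [h1, h2, tr_conj]
  · intro A
    unfold RR
    have h1 : (-A = 1 ∨ -A = -1) ↔ (A = 1 ∨ A = -1) := by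
      rw [neg_inj, neg_eq_iff_eq_neg, or_comm]
    simp only [h1, tr_neg, neg_sq]
    congr 3
    apply Fintype.sum_equiv (Equiv.mulLeft (negT κ))
    intro τ
    simp only [Equiv.coe_mulLeft, map_mul, hθ, one_mul, negT_mul, tr_neg]
    simp only [neg_eq_iff_eq_neg]

lemma TT_disj (hneg : ¬ IsSquare (-1 : F)) {κ ε : ℤˣ} (hne : ε ≠ κ) (τ : TT F κ) (σ : TT F ε)
    (h : tr (τ : SL2 F) = tr (σ : SL2 F)) : tr (τ : SL2 F) ^ 2 = 1 := by
  have h1 := TT_eq τ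
  have h2 := TT_eq σ
  have hx : (τ : SL2 F) 0 0 = (σ : SL2 F) 0 0 := by
    rw [TT_tr, TT_tr] at h
    exact mul_left_cancel₀ ne_zero_of_char h
  have hε : ((ε : ℤ) : F) = - ((κ : ℤ) : F) := by
    rcases Int.units_eq_one_or κ with rfl | rfl <;> rcases Int.units_eq_one_or ε with rfl | rfl <;> simp at hne ⊢
  rw [hε, ← hx] at h2
  have h4 : (τ : SL2 F) 1 0 ^ 2 = - (σ : SL2 F) 1 0 ^ 2 := mul_left_cancel₀ (kF_ne κ) (by linear_combination h2 - h1)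
  have h5 : (σ : SL2 F) 1 0 = 0 := by
    by_contra h0
    apply hneg
    refine ⟨(τ : SL2 F) 1 0 / (σ : SL2 F) 1 0, ?_⟩
    field_simp
    linear_combination -h4
  rw [h5] at h4
  have h6 : (τ : SL2 F) 1 0 = 0 := by simpa using h4
  rw [h6] at h1
  rw [TT_tr]
  have := h3 (F := F)
  linear_combination 4 * h1 + this

lemma TT_pm {κ : ℤˣ} {τ : TT F κ} : ((τ : SL2 F) = 1 ∨ (τ : SL2 F) = -1) ↔ τ = 1 ∨ τ = negT κ := by
  rw [Subtype.ext_iff, Subtype.ext_iff]; rfl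

/-- multiple of the indicator of `±1` -/
noncomputable def DD (κ : ℤˣ) (τ : TT F κ) : ℂ := if tr (τ : SL2 F) ^ 2 = 1 then (Nat.card (TT F κ) : ℂ) else 0

lemma sum_same_tr {κ : ℤˣ} (g : TT F κ → ℂ) (τ : TT F κ) (h : ¬ tr (τ : SL2 F) ^ 2 = 1) :
    (∑ σ : TT F κ, if tr (σ : SL2 F) = tr (τ : SL2 F) then g σ else 0) = g τ + g τ⁻¹ := by
  classical
  rw [← Finset.sum_filter]
  have h1 : τ ≠ τ⁻¹ := by
    intro h0
    apply h
    rw [TT_tr_sq, ← TT_sq, sq]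
    rw [eq_inv_iff_mul_eq_one] at h0
    exact h0
  have : Finset.univ.filter (fun σ : TT F κ => tr (σ : SL2 F) = tr (τ : SL2 F)) = {τ, τ⁻¹} := by
    ext σ
    simp only [Finset.mem_filter, Finset.mem_univ, true_and, Finset.mem_insert, Finset.mem_singleton]
    constructor
    · exact TT_same_tr
    · rintro (rfl | rfl)
      · rfl
      · simp
  rw [this, Finset.sum_pair h1]

lemma RR_res_same (hneg : ¬ IsSquare (-1 : F)) (κ : ℤˣ) (θ : TT F κ →* ℂ) (hθ : θ (negT κ) = 1) (τ : TT F κ) :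
    RR κ θ τ = ((κ : ℤ) : ℂ) * (θ τ + θ τ⁻¹) + DD κ τ := by
  unfold RR DD
  simp only [TT_pm, ← TT_tr_sq]
  split_ifs with h
  · have h1 : θ τ = 1 := by
      rcases TT_tr_sq.1 h with rfl | rfl
      · simp
      · exact hθ
    have h2 : θ τ⁻¹ = 1 := by
      have : θ τ * θ τ⁻¹ = 1 := by rw [← map_mul]; simp
      rwa [h1, one_mul] at this
    rw [h1, h2, TT_card_C hneg]; ring
  · rw [sum_same_tr (fun σ => θ σ) τ h]; ring

lemma RR_res_diff (hneg : ¬ IsSquare (-1 : F)) {κ ε : ℤˣ} (hne : ε ≠ κ) (θ : TT F κ →* ℂ) (σ : TT F ε) :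
    RR κ θ σ = DD ε σ := by
  unfold RR DD
  simp only [TT_pm, ← TT_tr_sq]
  split_ifs with h
  · rw [TT_card_C hneg]
    have hε : ((ε : ℤ) : ℂ) = - ((κ : ℤ) : ℂ) := by
      rcases Int.units_eq_one_or κ with rfl | rfl <;> rcases Int.units_eq_one_or ε with rfl | rfl <;> simp at hne ⊢
    rw [hε]; ring
  · rw [Finset.sum_eq_zero, mul_zero]
    intro τ _
    rw [if_neg]
    intro h0
    apply h
    rw [← h0]
    exact TT_disj hneg hne τ σ h0

lemma uu_ne (x : F) (hx : x ≠ 0) : ¬ (uu x = 1 ∨ uu x = -1) := by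
  rintro (h | h)
  · have := congrArg (fun A : SL2 F => A 0 1) h
    simp [uu] at this; exact hx this
  · have := congrArg (fun A : SL2 F => A 0 1) h
    simp [uu] at this; exact hx this

lemma tr_uu (x : F) : tr (uu x) ^ 2 = 1 := by
  have := h3 (F := F)
  simp only [tr, uu, mkSL_00, mkSL_11]; linear_combination this

lemma RR_uu (κ : ℤˣ) (θ : TT F κ →* ℂ) (x : Fˣ) : RR κ θ (uu (x : F)) = ((κ : ℤ) : ℂ) := by
  unfold RR
  rw [if_neg (uu_ne _ x.ne_zero), if_pos (tr_uu _)]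

lemma RR_one (κ : ℤˣ) (θ : TT F κ →* ℂ) : RR κ θ 1 = (Fintype.card F : ℂ) + ((κ : ℤ) : ℂ) := by
  simp [RR]

/-- the multiplicity `r` -/
noncomputable def rr (h : SL2 F → ℂ) : ℂ :=
  2 * (h 1 - (h 1 + usum h) / Fintype.card F) / (Fintype.card F - 1)

lemma q_ne (F : Type) [Field F] [Fintype F] : (Fintype.card F : ℂ) ≠ 0 := Nat.cast_ne_zero.2 Fintype.card_ne_zero
lemma q1_ne (F : Type) [Field F] [Fintype F] : (Fintype.card F : ℂ) - 1 ≠ 0 := by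
  rw [sub_ne_zero]
  have : Fintype.card F ≠ 1 := Fintype.one_lt_card.ne'
  exact_mod_cast this
lemma q2_ne (F : Type) [Field F] [Fintype F] : (Fintype.card F : ℂ) + 1 ≠ 0 := by
  exact_mod_cast (Nat.succ_ne_zero (Fintype.card F))

lemma alg_aux1 (q h u E : ℂ) (h0 : q ≠ 0) (h1 : q - 1 ≠ 0) :
    q * (q ^ 2 - 1) * ((q - 1)⁻¹ * (2 * h + E) - 2 * (h - (h + u) / q) / (q - 1)) =
    q * (q + 1) * (2 * h + E) - 2 * (q + 1) * (q * h - h - u) := by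
  field_simp; ring

lemma alg_aux2 (q h u E : ℂ) (h0 : q ≠ 0) (h1 : q - 1 ≠ 0) (h2 : q + 1 ≠ 0) :
    q * (q ^ 2 - 1) * ((q + 1)⁻¹ * (2 * h + E) - 2 * (h - (h + u) / q) / (q - 1)) =
    q * (q - 1) * (2 * h + E) - 2 * (q + 1) * (q * h - h - u) := by
  field_simp; ring

lemma ip_RR (hneg : ¬ IsSquare (-1 : F)) (κ : ℤˣ) (θ : TT F κ →* ℂ) (hθ : θ (negT κ) = 1)
    {h : SL2 F → ℂ} (hh : EvenCl h) :
    ip (RR κ θ) h = ((κ : ℤ) : ℂ) * (ip (fun τ : TT F κ => h τ) (fun τ => θ τ) - rr h) := by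
  have hR := RR_even κ θ hθ
  have hk : EvenCl (fun A => RR κ θ A * h A⁻¹) := by
    constructor
    · intro A B
      simp only [hR.cl A B]
      rw [← hh.cl A⁻¹ B]; congr 2; group
    · intro A
      rw [hR.ev]
      have : (-A)⁻¹ = - A⁻¹ := by rw [inv_eq_iff_mul_eq_one]; simp
      rw [this, hh.ev]
  have hw := weyl hneg hk
  have hu : usum (fun A => RR κ θ A * h A⁻¹) = ((κ : ℤ) : ℂ) * usum h := by
    rw [← usum_neg h]
    unfold usum
    rw [Finset.mul_sum]
    refine Finset.sum_congr rfl (fun x _ => ?_)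
    simp only [RR_uu]
    congr 2
    apply sl_ext <;> simp [uu]
  -- the torus sum
  have hE : ip (fun τ : TT F κ => h τ) (fun τ => θ τ) = (Nat.card (TT F κ) : ℂ)⁻¹ *
      (2 * h 1 + ∑ τ : TT F κ, if tr (τ : SL2 F) ^ 2 = 1 then 0 else θ τ * h τ) := by
    rw [ip_comm]
    unfold ip
    congr 1
    rw [TT_split]
    have e1 : h ((negT κ : TT F κ)⁻¹ : TT F κ) = h 1 := by
      rw [← hh.ev 1]; congr 1
      have : (negT κ : TT F κ)⁻¹ = negT κ := by
        rw [inv_eq_iff_mul_eq_one, ← sq, TT_sq]; right; rfl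
      rw [this]; rfl
    have e2 : h ((1 : TT F κ)⁻¹ : TT F κ) = h 1 := by simp
    simp only [e1, e2, hθ, map_one]
    congr 1
    · ring
    · refine Finset.sum_congr rfl (fun τ _ => ?_)
      split_ifs with h0
      · rfl
      · rw [hh.tr_eq (A := ((τ⁻¹ : TT F κ) : SL2 F)) (B := τ) (by simpa using h0) (by simp)]
  have hwk : wsum κ (fun A => RR κ θ A * h A⁻¹) = ((κ : ℤ) : ℂ) * (2 *
      ∑ τ : TT F κ, if tr (τ : SL2 F) ^ 2 = 1 then 0 else θ τ * h τ) := by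
    have e1 : (∑ τ : TT F κ, if tr (τ : SL2 F) ^ 2 = 1 then 0 else θ τ⁻¹ * h τ) =
        ∑ τ : TT F κ, if tr (τ : SL2 F) ^ 2 = 1 then 0 else θ τ * h τ := by
      apply Fintype.sum_equiv (Equiv.inv (TT F κ))
      intro τ
      simp only [Equiv.inv_apply, Subgroup.coe_inv, tr_inv]
      split_ifs with h0
      · rfl
      · rw [hh.tr_eq (A := ((τ : TT F κ) : SL2 F)) (B := (τ : SL2 F)⁻¹) h0 (by simp)]
    rw [two_mul]
    nth_rewrite 2 [← e1]
    rw [← Finset.sum_add_distrib, Finset.mul_sum]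
    unfold wsum
    refine Finset.sum_congr rfl (fun τ _ => ?_)
    split_ifs with h0
    · simp
    · simp only [RR_res_same hneg κ θ hθ]
      rw [DD, if_neg h0, hh.tr_eq (A := (τ : SL2 F)⁻¹) (B := τ) (by simpa using h0) (by simp)]
      ring
  have hwn : ∀ ε : ℤˣ, ε ≠ κ → wsum ε (fun A => RR κ θ A * h A⁻¹) = 0 := by
    intro ε hne
    unfold wsum
    apply Finset.sum_eq_zero
    intro σ _
    split_ifs with h0
    · rfl
    · simp only [RR_res_diff hneg hne]
      rw [DD, if_neg h0, zero_mul]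
  have q0 := q_ne F
  have q1 := q1_ne F
  have q2 := q2_ne F
  have hT := TT_card_C (F := F) hneg κ
  unfold ip at *
  rw [hE, hT, card_SL hneg, rr]
  simp only [hu, RR_one, inv_one] at hw
  have q3 : (Fintype.card F : ℂ) ^ 2 - 1 ≠ 0 := by
    have : (Fintype.card F : ℂ) ^ 2 - 1 = (Fintype.card F - 1) * (Fintype.card F + 1) := by ring
    rw [this]; exact mul_ne_zero q1 q2
  rw [eq_comm, ← mul_right_inj' (mul_ne_zero q0 q3)]
  rw [mul_inv_cancel_left₀ (mul_ne_zero q0 q3)]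
  rcases Int.units_eq_one_or κ with rfl | rfl
  · rw [hwk, hwn (-1) (by decide)] at hw
    have := alg_aux1 (Fintype.card F) (h 1) (usum h)
      (∑ τ : TT F 1, if tr (τ : SL2 F) ^ 2 = 1 then 0 else θ τ * h τ) q0 q1
    push_cast at *
    rw [one_mul, this]
    linear_combination -hw / 2
  · rw [hwk, hwn 1 (by decide)] at hw
    have := alg_aux2 (Fintype.card F) (h 1) (usum h)
      (∑ τ : TT F (-1), if tr (τ : SL2 F) ^ 2 = 1 then 0 else θ τ * h τ) q0 q1 q2
    push_cast at *
    rw [sub_neg_eq_add, neg_one_mul, mul_neg, this]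
    linear_combination -hw / 2

end RRdef

end PartP4b

section PartP4c

section RRip
variable {F : Type} [Field F] [CharP F 3] [Fintype F] [DecidableEq F]

lemma sq_or_neg_sq (hneg : ¬ IsSquare (-1 : F)) (x : F) (hx : x ≠ 0) : ∃ a : F, a ≠ 0 ∧ (x = a ^ 2 ∨ -x = a ^ 2) := by
  by_cases h : IsSquare x
  · obtain ⟨a, ha⟩ := h
    refine ⟨a, ?_, Or.inl (by rw [ha, sq])⟩
    rintro rfl; simp at ha; exact hx ha
  · have h1 : IsSquare (-x) := by
      rw [← quadraticChar_one_iff_isSquare (neg_ne_zero.2 hx), neg_eq_neg_one_mul, map_mul,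
        quadraticChar_neg_one_iff_not_isSquare.2 hneg, quadraticChar_neg_one_iff_not_isSquare.2 h]
      norm_num
    obtain ⟨a, ha⟩ := h1
    refine ⟨a, ?_, Or.inr (by rw [ha, sq])⟩
    rintro rfl; simp at ha; exact hx ha

lemma uu_conj (a x : F) (ha : a ≠ 0) : dd a ha * uu x * (dd a ha)⁻¹ = uu (a ^ 2 * x) := by
  rw [mul_inv_eq_iff_eq_mul]
  apply sl_ext <;> simp [dd, uu]
  field_simp

lemma uu_const (hneg : ¬ IsSquare (-1 : F)) {h : SL2 F → ℂ} (hh : IsClassFn h) (x : F) (hx : x ≠ 0) :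
    h (uu x) + h (uu (-x)) = h (uu 1) + h (uu (-1)) := by
  obtain ⟨a, ha, h1 | h1⟩ := sq_or_neg_sq hneg x hx
  · have e1 : h (uu x) = h (uu 1) := by
      rw [← hh (uu 1) (dd a ha), uu_conj, h1, mul_one]
    have e2 : h (uu (-x)) = h (uu (-1)) := by
      rw [← hh (uu (-1)) (dd a ha), uu_conj, h1]; congr 2; ring
    rw [e1, e2]
  · have e1 : h (uu x) = h (uu (-1)) := by
      rw [← hh (uu (-1)) (dd a ha), uu_conj, ← h1]; congr 2; ring
    have e2 : h (uu (-x)) = h (uu (1)) := by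
      rw [← hh (uu (1)) (dd a ha), uu_conj, h1]; congr 2; ring
    rw [e1, e2, add_comm]

/-- unipotent embedding -/
def uuHom : Multiplicative F →* SL2 F where
  toFun x := uu x.toAdd
  map_one' := by apply sl_ext <;> simp [uu]
  map_mul' x y := by apply sl_ext <;> simp [uu, add_comm]

lemma sum_units_eq (g : F → ℂ) : ∑ b : F, g b = g 0 + ∑ x : Fˣ, g x := by
  have h1 : ∑ b ∈ Finset.univ.erase (0 : F), g b = ∑ x : Fˣ, g x := by
    symm
    apply Finset.sum_bij (fun (x : Fˣ) _ => (x : F))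
    · intro a _; simp
    · intro a _ b _ h; exact Units.ext h
    · intro b hb
      exact ⟨Units.mk0 b (by simpa using hb), Finset.mem_univ _, rfl⟩
    · intros; rfl
  rw [← h1]
  exact (Finset.add_sum_erase _ _ (Finset.mem_univ _)).symm

lemma usum_const (hneg : ¬ IsSquare (-1 : F)) {h : SL2 F → ℂ} (hh : IsClassFn h) :
    2 * usum h = (Fintype.card F - 1) * (h (uu 1) + h (uu (-1))) := by
  rw [two_mul]
  nth_rewrite 2 [← usum_neg]
  rw [usum, ← Finset.sum_add_distrib]
  rw [Finset.sum_congr rfl (fun (x : Fˣ) _ => uu_const hneg hh (x : F) x.ne_zero)]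
  rw [Finset.sum_const, Finset.card_univ, nsmul_eq_mul, card_pred]

lemma rr_nat (hneg : ¬ IsSquare (-1 : F)) {h : SL2 F → ℂ} (hh : IsChar h) : ∃ n : ℕ, rr h = n := by
  obtain ⟨ψ, hψ⟩ : ∃ ψ : AddChar F ℂ, ψ ≠ 1 := by
    obtain ⟨ψ, hψ⟩ := AddChar.exists_apply_ne_zero.2 (one_ne_zero (α := F))
    refine ⟨ψ, ?_⟩
    rintro rfl
    simp at hψ
  let t1 : Multiplicative F →* ℂ :=
    { toFun := fun x => ψ x.toAdd
      map_one' := by simp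
      map_mul' := fun x y => by simp [AddChar.map_add_eq_mul] }
  have c1 := (isIrr_lin t1).isChar
  have c2 := (isIrr_lin t1).inv.isChar
  have c0 := hh.comp (uuHom (F := F))
  obtain ⟨n1, hn1⟩ := ip_nat c0 c1
  obtain ⟨n2, hn2⟩ := ip_nat c0 c2
  refine ⟨n1 + n2, ?_⟩
  have e : ip (fun x => h (uuHom x)) (fun g => t1 g) + ip (fun x => h (uuHom x)) (fun g => t1 g⁻¹) =
      (Fintype.card F : ℂ)⁻¹ * ∑ x : F, (h (uu x) + h (uu (-x))) * ψ x := by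
    unfold ip
    rw [← mul_add]
    congr 1
    · rw [Nat.card_eq_fintype_card, Fintype.card_multiplicative]
    · simp_rw [add_mul]
      rw [Finset.sum_add_distrib, add_comm]
      congr 1
      · apply Fintype.sum_equiv Multiplicative.toAdd
        intro x; simp [t1, uuHom]
      · apply Fintype.sum_equiv (Multiplicative.toAdd.trans (Equiv.neg F))
        intro x; simp [t1, uuHom]
  rw [hn1, hn2, sum_units_eq] at e
  have e3 : ∑ x : Fˣ, (h (uu (x : F)) + h (uu (-(x : F)))) * ψ x = - (h (uu 1) + h (uu (-1))) := by
    rw [Finset.sum_congr rfl (fun x _ => by rw [uu_const hneg hh.classFn (x : F) x.ne_zero] :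
      ∀ x ∈ (Finset.univ : Finset Fˣ), (h (uu (x : F)) + h (uu (-(x : F)))) * ψ x = (h (uu 1) + h (uu (-1))) * ψ x)]
    rw [← Finset.mul_sum]
    have h0 := AddChar.sum_eq_zero_of_ne_one hψ
    rw [sum_units_eq] at h0
    simp only [AddChar.map_zero_eq_one] at h0
    linear_combination (h (uu 1) + h (uu (-1))) * h0
  rw [e3] at e
  have h0 : uu (0 : F) = 1 := by apply sl_ext <;> simp [uu]
  simp only [neg_zero, h0, AddChar.map_zero_eq_one, mul_one] at e
  have hu := usum_const hneg hh.classFn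
  push_cast
  rw [e, rr]
  have q0 := q_ne F
  have q1 := q1_ne F
  field_simp
  linear_combination -hu

lemma rr_RR (κ : ℤˣ) (θ : TT F κ →* ℂ) : rr (RR κ θ) = 2 := by
  rw [rr, RR_one, usum]
  simp only [RR_uu, Finset.sum_const, Finset.card_univ, nsmul_eq_mul, card_pred]
  have q0 := q_ne F
  have q1 := q1_ne F
  field_simp
  ring

lemma ip_DD (hneg : ¬ IsSquare (-1 : F)) (κ : ℤˣ) (θ : TT F κ →* ℂ) (hθ : θ (negT κ) = 1) :
    ip (DD κ) (fun τ => θ τ) = 2 := by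
  rw [ip_comm]
  unfold ip
  have hc := card_ne (TT F κ)
  rw [inv_mul_eq_iff_eq_mul₀ hc, TT_split, Finset.sum_eq_zero]
  · have e1 : tr (((1 : TT F κ)⁻¹ : TT F κ) : SL2 F) ^ 2 = 1 := by
      simp only [Subgroup.coe_inv, tr_inv]; exact TT_tr_sq.2 (Or.inl rfl)
    have e2 : tr (((negT κ : TT F κ)⁻¹ : TT F κ) : SL2 F) ^ 2 = 1 := by
      simp only [Subgroup.coe_inv, tr_inv]; exact TT_tr_sq.2 (Or.inr rfl)
    simp only [DD, e1, e2, if_true, hθ, map_one]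
    ring
  · intro τ _
    split_ifs with h
    · rfl
    · simp only [DD, Subgroup.coe_inv, tr_inv, if_neg h, mul_zero]

lemma ip_RR_self (hneg : ¬ IsSquare (-1 : F)) (κ : ℤˣ) (θ : TT F κ →* ℂ) (hθ : θ (negT κ) = 1) :
    ip (RR κ θ) (RR κ θ) = 1 + ip (fun τ : TT F κ => θ τ⁻¹) (fun τ : TT F κ => θ τ) := by
  rw [ip_RR hneg κ θ hθ (RR_even κ θ hθ), rr_RR]
  have : (fun τ : TT F κ => RR κ θ τ) = ((κ : ℤ) : ℂ) • ((fun τ : TT F κ => θ τ) + (fun τ : TT F κ => θ τ⁻¹)) + DD κ := by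
    funext τ
    rw [RR_res_same hneg κ θ hθ]; rfl
  rw [this, ip_add_left, ip_DD hneg κ θ hθ, ip_smul_left, ip_add_left, (isIrr_lin θ).ip_self]
  have := kF_sq (F := ℂ) κ
  linear_combination (1 + ip (fun τ : TT F κ => θ τ⁻¹) (fun τ : TT F κ => θ τ)) * this

lemma int_RR (hneg : ¬ IsSquare (-1 : F)) (κ : ℤˣ) (θ : TT F κ →* ℂ) (hθ : θ (negT κ) = 1)
    {χ : PSL2 F → ℂ} (hχ : IsChar χ) : ∃ n : ℤ, ip (push (RR κ θ)) χ = n := by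
  rw [ip_push (RR_even κ θ hθ), ip_RR hneg κ θ hθ (lift_even hχ.classFn)]
  obtain ⟨n, hn⟩ := rr_nat hneg (hχ.comp pmk)
  obtain ⟨m, hm⟩ := ip_nat ((hχ.comp pmk).comp (TT F κ).subtype) (isIrr_lin θ).isChar
  refine ⟨κ * (m - n), ?_⟩
  rw [hn]
  simp only [Subgroup.subtype_apply] at hm
  rw [hm]
  push_cast
  rfl

lemma push_ip_self (κ : ℤˣ) (θ : TT F κ →* ℂ) (hθ : θ (negT κ) = 1) :
    ip (push (RR κ θ)) (push (RR κ θ)) = ip (RR κ θ) (RR κ θ) := by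
  rw [ip_push (RR_even κ θ hθ)]
  congr 1
  funext A
  exact push_pmk (RR_even κ θ hθ).ev A

lemma push_one (κ : ℤˣ) (θ : TT F κ →* ℂ) (hθ : θ (negT κ) = 1) :
    push (RR κ θ) 1 = (Fintype.card F : ℂ) + ((κ : ℤ) : ℂ) := by
  rw [← map_one pmk, push_pmk (RR_even κ θ hθ).ev, RR_one]

lemma card_ge : 3 ≤ Fintype.card F := by
  have h2 := ne_zero_of_char (F := F)
  have h1 : (1 : F) ≠ -1 := fun h => h2 (by linear_combination h)
  have : ({0, 1, -1} : Finset F).card = 3 := by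
    rw [Finset.card_eq_three]
    exact ⟨0, 1, -1, by simp, by simp, h1, rfl⟩
  rw [← this]; exact Finset.card_le_univ _

lemma push_one_nat (κ : ℤˣ) (θ : TT F κ →* ℂ) (hθ : θ (negT κ) = 1) :
    ∃ n : ℕ, push (RR κ θ) 1 = n := by
  rw [push_one κ θ hθ]
  rcases Int.units_eq_one_or κ with rfl | rfl
  · exact ⟨Fintype.card F + 1, by simp⟩
  · refine ⟨Fintype.card F - 1, ?_⟩
    rw [Nat.cast_sub (by have := card_ge (F := F); omega)]; simp; ring

lemma RR_irr (hneg : ¬ IsSquare (-1 : F)) (κ : ℤˣ) (θ : TT F κ →* ℂ) (hθ : θ (negT κ) = 1)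
    (h2 : ∃ τ, θ τ ^ 2 ≠ 1) : IsIrr (push (RR κ θ)) := by
  apply norm_one_pos (push_class (RR_even κ θ hθ)) (fun χ hχ => int_RR hneg κ θ hθ hχ.isChar)
  · rw [push_ip_self κ θ hθ, ip_RR_self hneg κ θ hθ, (isIrr_lin θ).inv.ip_ne (isIrr_lin θ), add_zero]
    intro h
    obtain ⟨τ, hτ⟩ := h2
    apply hτ
    have h1 := congrFun h τ
    rw [sq]
    nth_rewrite 1 [← h1]
    rw [← map_mul]; simp
  · exact push_one_nat κ θ hθ

lemma RR_norm_two (hneg : ¬ IsSquare (-1 : F)) (κ : ℤˣ) (θ : TT F κ →* ℂ) (hθ : θ (negT κ) = 1)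
    (h2 : ∀ τ, θ τ ^ 2 = 1) : ip (push (RR κ θ)) (push (RR κ θ)) = 2 := by
  rw [push_ip_self κ θ hθ, ip_RR_self hneg κ θ hθ]
  have : (fun τ : TT F κ => θ τ⁻¹) = fun τ => θ τ := by
    funext τ
    have h1 : θ τ * θ τ⁻¹ = 1 := by rw [← map_mul]; simp
    have h4 := h2 τ
    have h5 : θ τ ≠ 0 := by intro h0; rw [h0, zero_mul] at h1; simp at h1
    apply mul_left_cancel₀ h5
    rw [h1, ← sq, h4]
  rw [this, (isIrr_lin θ).ip_self]; norm_num

/-- Steinberg -/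
noncomputable def St (F : Type) [Field F] [CharP F 3] [Fintype F] [DecidableEq F] : PSL2 F → ℂ :=
  push (RR 1 (1 : TT F 1 →* ℂ)) - fun _ => 1

lemma triv_irr (G : Type) [Group G] [Fintype G] : IsIrr (fun _ : G => (1 : ℂ)) := by
  have := isIrr_lin (1 : G →* ℂ)
  simpa using this

lemma ip_R1_one (hneg : ¬ IsSquare (-1 : F)) : ip (push (RR 1 (1 : TT F 1 →* ℂ))) (fun _ => 1) = 1 := by
  rw [ip_push (RR_even 1 1 rfl), ip_RR hneg 1 1 rfl ⟨fun _ _ => rfl, fun _ => rfl⟩]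
  have e1 := (triv_irr (TT F 1)).ip_self
  simp only [MonoidHom.one_apply]
  rw [e1, rr, usum]
  simp only [Finset.sum_const, Finset.card_univ, nsmul_eq_mul, card_pred]
  have q0 := q_ne F
  have q1 := q1_ne F
  push_cast
  field_simp
  ring

lemma St_irr (hneg : ¬ IsSquare (-1 : F)) : IsIrr (St F) := by
  have hcl := (push_class (RR_even (F := F) 1 1 rfl))
  apply norm_one_pos (hcl.sub (triv_irr _).isChar.classFn)
  · intro χ hχ
    obtain ⟨n, hn⟩ := int_RR (F := F) hneg 1 1 rfl hχ.isChar
    obtain ⟨m, hm⟩ := ip_nat (triv_irr (PSL2 F)).isChar hχ.isChar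
    refine ⟨n - m, ?_⟩
    rw [ip_sub_left, hn, hm]; push_cast; rfl
  · rw [ip_sub_left, ip_sub_right, ip_sub_right, RR_norm_two hneg 1 1 rfl (by simp), ip_R1_one hneg,
      ip_comm, ip_R1_one hneg, (triv_irr _).ip_self]
    norm_num
  · refine ⟨Fintype.card F, ?_⟩
    rw [Pi.sub_apply, push_one 1 1 rfl]; simp

lemma R_neg_one (hneg : ¬ IsSquare (-1 : F)) : push (RR (-1) (1 : TT F (-1) →* ℂ)) = St F - fun _ => 1 := by
  funext s
  obtain ⟨A, rfl⟩ := pmk_surj s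
  simp only [St, Pi.sub_apply]
  rw [push_pmk (RR_even (F := F) (-1) 1 rfl).ev, push_pmk (RR_even (F := F) 1 1 rfl).ev]
  unfold RR
  split_ifs with h1 h2
  · push_cast; ring
  · push_cast; ring
  · simp only [MonoidHom.one_apply]
    have := TT_sum_both hneg (fun t => if t = tr A then (1 : ℂ) else 0)
    simp only [Finset.sum_ite_eq', Finset.mem_univ, if_true] at this
    push_cast
    linear_combination -this

end RRip

end PartP4c

section PartP4d

section Dich

lemma exists_hom (T : Type) [CommGroup T] [IsCyclic T] [Finite T] {n : ℕ} (hn : n ∣ Nat.card T) :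
    ∃ (g : T) (θ : T →* ℂ), (∀ x, x ∈ Subgroup.zpowers g) ∧ IsPrimitiveRoot (θ g) n := by
  obtain ⟨g, hg⟩ := IsCyclic.exists_generator (α := T)
  have hn0 : n ≠ 0 := by
    rintro rfl
    exact Nat.card_pos.ne' (zero_dvd_iff.1 hn)
  have hz := Complex.isPrimitiveRoot_exp n hn0
  set z := Complex.exp (2 * Real.pi * Complex.I / n)
  let u : ℂˣ := (hz.isUnit hn0).unit
  have hu : orderOf u ∣ orderOf g := by
    rw [orderOf_eq_card_of_forall_mem_zpowers hg, ← orderOf_units]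
    have : orderOf (u : ℂ) = n := hz.eq_orderOf.symm
    rwa [this]
  refine ⟨g, (Units.coeHom ℂ).comp (monoidHomOfForallMemZpowers hg hu), hg, ?_⟩
  simp only [MonoidHom.comp_apply, monoidHomOfForallMemZpowers_apply_gen]
  exact hz

lemma hom_ext_gen {T : Type} [CommGroup T] {g : T} (hg : ∀ x, x ∈ Subgroup.zpowers g) {θ θ' : T →* ℂ}
    (h : θ g = θ' g) : θ = θ' := by
  ext x
  obtain ⟨k, rfl⟩ := hg x
  have h1 : ∀ k : ℤ, ∀ θ : T →* ℂ, θ (g ^ k) = (θ g) ^ k := fun k θ => by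
    have := map_zpow (Units.coeHom ℂ |>.comp θ.toHomUnits) g k
    simpa using congrArg id this
  simp only [h1, h]

variable {F : Type} [Field F] [CharP F 3] [Fintype F] [DecidableEq F]

lemma hneg_of (hq : Fintype.card F % 8 = 3) : ¬ IsSquare (-1 : F) := by
  rw [FiniteField.isSquare_neg_one_iff]; omega

lemma card_TT1 (hneg : ¬ IsSquare (-1 : F)) : Nat.card (TT F 1) + 1 = Fintype.card F := by
  have := TT_card_C hneg 1
  have h : ((Nat.card (TT F 1) + 1 : ℕ) : ℂ) = (Fintype.card F : ℕ) := by
    push_cast; rw [this]; simp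
  exact_mod_cast h

lemma card_TTn (hneg : ¬ IsSquare (-1 : F)) : Nat.card (TT F (-1)) = Fintype.card F + 1 := by
  have := TT_card_C hneg (-1)
  have h : ((Nat.card (TT F (-1)) : ℕ) : ℂ) = (Fintype.card F + 1 : ℕ) := by
    rw [this]; simp
  exact_mod_cast h

lemma plus_triv (hq : Fintype.card F % 8 = 3) (θ : TT F 1 →* ℂ) (hθ : θ (negT 1) = 1)
    (h2 : ∀ τ, θ τ ^ 2 = 1) : θ = 1 := by
  have hc := card_TT1 (hneg_of hq)
  ext τ
  have h1 : τ ^ (Nat.card (TT F 1)) = 1 := pow_card_eq_one'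
  obtain ⟨m, hm⟩ : ∃ m, Nat.card (TT F 1) = (2 * m + 1) * 2 := ⟨(Nat.card (TT F 1) - 2) / 4, by omega⟩
  rw [hm, pow_mul] at h1
  have h3 : θ (τ ^ (2 * m + 1)) = 1 := by
    rcases TT_sq.1 h1 with h | h
    · rw [h, map_one]
    · rw [h, hθ]
  rw [map_pow, pow_succ, pow_mul, h2, one_pow, one_mul] at h3
  simpa using h3

lemma exists_lam (hq : Fintype.card F % 8 = 3) : ∃ l : TT F (-1) →* ℂ, l (negT (-1)) = 1 ∧ (∀ τ, l τ ^ 2 = 1) ∧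
    l ≠ 1 ∧ ∀ θ : TT F (-1) →* ℂ, (∀ τ, θ τ ^ 2 = 1) → θ ≠ 1 → θ = l := by
  have hc := card_TTn (hneg_of hq)
  obtain ⟨g, l, hg, hl⟩ := exists_hom (TT F (-1)) (n := 2) (by rw [hc]; omega)
  have hlg : l g = -1 := hl.eq_neg_one_of_two_right
  have hsq : ∀ τ, l τ ^ 2 = 1 := by
    intro τ
    have : l * l = 1 := hom_ext_gen hg (by simp [hlg])
    have := DFunLike.congr_fun this τ
    rw [sq]; simpa using this
  refine ⟨l, ?_, hsq, ?_, ?_⟩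
  · have : (negT (-1) : TT F (-1)) = (mkT (-1) 0 1 (by simp)) ^ 2 := by
      apply TT_ext <;> simp [negT, mkT, sq]
    rw [this, map_pow, hsq]
  · rintro rfl
    norm_num at hlg
  · intro θ h1 h2
    apply hom_ext_gen hg
    rw [hlg]
    rcases (mul_self_eq_one_iff.1 ((sq _).symm.trans (h1 g))) with h | h
    · exact absurd (hom_ext_gen hg (by rw [h]; rfl)) h2
    · exact h

lemma ip_odd {T : Type} [CommGroup T] [Fintype T] {z : T} (hz : z ^ 2 = 1) {g : T → ℂ} (hg : ∀ t, g (z * t) = g t)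
    (θ : T →* ℂ) (hθ : θ z = -1) : ip g (fun t => θ t) = 0 := by
  have h : ∑ t, g t * θ t⁻¹ = ∑ t, g (z * t) * θ (z * t)⁻¹ :=
    (Fintype.sum_equiv (Equiv.mulLeft z) _ _ (fun t => rfl)).symm
  have h2 : z⁻¹ = z := by rw [inv_eq_iff_mul_eq_one, ← sq, hz]
  have h3 : ∑ t, g (z * t) * θ (z * t)⁻¹ = - ∑ t, g t * θ t⁻¹ := by
    rw [← Finset.sum_neg_distrib]
    refine Finset.sum_congr rfl (fun t _ => ?_)
    rw [hg, mul_inv, h2, map_mul, hθ]; ring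
  rw [h3] at h
  unfold ip
  have : ∑ t, g t * θ t⁻¹ = 0 := by linear_combination h / 2
  rw [this, mul_zero]

lemma theta_neg {κ : ℤˣ} (θ : TT F κ →* ℂ) : θ (negT κ) = 1 ∨ θ (negT κ) = -1 := by
  rw [← mul_self_eq_one_iff, ← sq, ← map_pow, TT_sq.2 (Or.inr rfl), map_one]

lemma negT_sq (κ : ℤˣ) : (negT κ : TT F κ) ^ 2 = 1 := TT_sq.2 (Or.inr rfl)

lemma DD_neg (κ : ℤˣ) (τ : TT F κ) : DD κ (negT κ * τ) = DD κ τ := by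
  unfold DD; rw [negT_mul, tr_neg]; simp

lemma dichotomy (hq : Fintype.card F % 8 = 3) {l : TT F (-1) →* ℂ} (hl1 : l (negT (-1)) = 1)
    (hl2 : ∀ τ, l τ ^ 2 = 1) (hl3 : ∀ θ : TT F (-1) →* ℂ, (∀ τ, θ τ ^ 2 = 1) → θ ≠ 1 → θ = l)
    {χ : PSL2 F → ℂ} (hχ : IsIrr χ) (h1 : χ ≠ fun _ => 1) (hSt : χ ≠ St F)
    (hR : ∀ (κ : ℤˣ) (θ : TT F κ →* ℂ), θ (negT κ) = 1 → (∃ τ, θ τ ^ 2 ≠ 1) → χ ≠ push (RR κ θ)) :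
    2 * χ 1 = Fintype.card F - 1 ∧ ip (push (RR (-1) l)) χ = 1 := by
  classical
  have hneg := hneg_of hq
  set h : SL2 F → ℂ := fun A => χ (pmk A) with hh
  have hev : EvenCl h := lift_even hχ.isChar.classFn
  obtain ⟨r, hr⟩ := rr_nat hneg (hχ.isChar.comp pmk)
  have hr' : rr h = r := hr
  have key : ∀ (κ : ℤˣ) (θ : TT F κ →* ℂ), θ (negT κ) = 1 →
      ip (push (RR κ θ)) χ = ((κ : ℤ) : ℂ) * (ip (fun τ : TT F κ => h τ) (fun τ => θ τ) - r) := by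
    intro κ θ hθ
    rw [ip_push (RR_even κ θ hθ), ip_RR hneg κ θ hθ hev, hr']
  have key0 : ∀ (κ : ℤˣ) (θ : TT F κ →* ℂ), θ (negT κ) = 1 → ip (push (RR κ θ)) χ = 0 →
      ip (fun τ : TT F κ => h τ) (fun τ => θ τ) = r := by
    intro κ θ hθ h0
    rw [key κ θ hθ] at h0
    have := (mul_eq_zero.1 h0).resolve_left (kF_ne (F := ℂ) κ)
    linear_combination this
  have key1 : ∀ (κ : ℤˣ) (θ : TT F κ →* ℂ), θ (negT κ) = 1 → (∃ τ, θ τ ^ 2 ≠ 1) →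
      ip (fun τ : TT F κ => h τ) (fun τ => θ τ) = r := fun κ θ hθ h2 =>
    key0 κ θ hθ ((RR_irr hneg κ θ hθ h2).ip_ne hχ (hR κ θ hθ h2).symm)
  have eSt : ip (St F) χ = 0 := (St_irr hneg).ip_ne hχ hSt.symm
  have e1 : ip (fun _ : PSL2 F => (1 : ℂ)) χ = 0 := (triv_irr _).ip_ne hχ h1.symm
  have keyp : ip (fun τ : TT F 1 => h τ) (fun τ => (1 : TT F 1 →* ℂ) τ) = r := by
    apply key0 1 1 rfl
    have : push (RR 1 (1 : TT F 1 →* ℂ)) = St F + fun _ => 1 := by unfold St; simp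
    rw [this, ip_add_left, eSt, e1, add_zero]
  have keyn : ip (fun τ : TT F (-1) => h τ) (fun τ => (1 : TT F (-1) →* ℂ) τ) = r := by
    apply key0 (-1) 1 rfl
    rw [R_neg_one hneg, ip_sub_left, eSt, e1, sub_zero]
  have hodd : ∀ (κ : ℤˣ) (τ : TT F κ), h (negT κ * τ : TT F κ) = h τ := fun κ τ => by
    rw [negT_mul]; exact hev.ev _
  -- split torus
  have P : (fun τ : TT F 1 => h τ) - ((r : ℂ) / 2) • DD 1 = 0 := by
    apply ab_complete
    intro θ
    rw [ip_sub_left, ip_smul_left]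
    rcases theta_neg θ with hθ | hθ
    · rw [ip_DD hneg 1 θ hθ]
      by_cases h2 : ∃ τ, θ τ ^ 2 ≠ 1
      · rw [key1 1 θ hθ h2]; ring
      · push Not at h2
        rw [plus_triv hq θ hθ h2, keyp]; ring
    · rw [ip_odd (negT_sq 1) (hodd 1) θ hθ, ip_odd (negT_sq 1) (DD_neg 1) θ hθ]; ring
  have M : (fun τ : TT F (-1) => h τ) - ((r : ℂ) / 2) • DD (-1) -
      (ip (fun τ : TT F (-1) => h τ) (fun τ => l τ) - r) • (fun τ => l τ) = 0 := by
    apply ab_complete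
    intro θ
    rw [ip_sub_left, ip_sub_left, ip_smul_left, ip_smul_left]
    rcases theta_neg θ with hθ | hθ
    · rw [ip_DD hneg (-1) θ hθ]
      by_cases hlt : θ = l
      · subst hlt
        rw [(isIrr_lin θ).ip_self]; ring
      · have : ip (fun τ => l τ) (fun τ => θ τ) = 0 := (isIrr_lin l).ip_ne (isIrr_lin θ) (by
          intro h0; apply hlt; ext τ; exact (congrFun h0 τ).symm)
        rw [this]
        by_cases h2 : ∃ τ, θ τ ^ 2 ≠ 1
        · rw [key1 (-1) θ hθ h2]; ring
        · push Not at h2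
          have : θ = 1 := by
            by_contra h0; exact hlt (hl3 θ h2 h0)
          rw [this, keyn]; ring
    · have : ip (fun τ => l τ) (fun τ => θ τ) = 0 := (isIrr_lin l).ip_ne (isIrr_lin θ) (by
          intro h0
          have := congrFun h0 (negT (-1))
          simp only [hl1, hθ] at this
          norm_num at this)
      rw [ip_odd (negT_sq (-1)) (hodd (-1)) θ hθ, ip_odd (negT_sq (-1)) (DD_neg (-1)) θ hθ, this]; ring
  have P1 := congrFun P 1
  have M1 := congrFun M 1
  have ht : ∀ κ : ℤˣ, DD κ (1 : TT F κ) = (Fintype.card F : ℂ) - ((κ : ℤ) : ℂ) := fun κ => by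
    rw [← TT_card_C hneg κ]; unfold DD; rw [if_pos (TT_tr_sq.2 (Or.inl rfl))]
  have hone : h 1 = χ 1 := by rw [hh]; simp
  simp only [Pi.sub_apply, Pi.smul_apply, smul_eq_mul, ht, map_one, Subgroup.coe_one, hone, Pi.zero_apply, mul_one,
    Units.val_one, Units.val_neg, Int.cast_one, Int.cast_neg] at P1 M1
  have hQ : ip (push (RR (-1) l)) χ = r := by
    rw [key (-1) l hl1]; push_cast
    linear_combination M1 - P1
  have hr1 : r = 1 := by
    have hp := parseval (h := push (RR (-1) l)) (push_class (RR_even (-1) l hl1))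
    rw [RR_norm_two hneg (-1) l hl1 hl2] at hp
    choose! n hn using fun χ (hχ : IsIrr χ) => int_RR hneg (-1) l hl1 hχ.isChar
    have hp2 : (2 : ℂ) = ((∑ φ ∈ irrF (PSL2 F), n φ ^ 2 : ℤ) : ℂ) := by
      rw [hp]; push_cast
      refine Finset.sum_congr rfl (fun φ hφ => ?_)
      rw [ip_comm φ, hn φ (mem_irrF.1 hφ), sq]
    have hp3 : (2 : ℤ) = ∑ φ ∈ irrF (PSL2 F), n φ ^ 2 := by exact_mod_cast hp2
    have hp4 := Finset.single_le_sum (f := fun φ => n φ ^ 2) (fun φ _ => sq_nonneg (n φ)) (mem_irrF.2 hχ)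
    have hp5 : n χ = r := by
      have := hn χ hχ
      rw [hQ] at this
      exact_mod_cast this.symm
    simp only [hp5] at hp4
    rw [← hp3] at hp4
    have hr2 : r < 2 := by
      by_contra hlt
      push Not at hlt
      have : (2 : ℤ) ≤ r := by exact_mod_cast hlt
      nlinarith
    have hr0 : r ≠ 0 := by
      rintro rfl
      obtain ⟨d, hd, hd1⟩ := hχ.one_pos
      rw [hd1] at P1
      simp at P1
      omega
    omega
  subst hr1
  push_cast at P1 hQ
  exact ⟨by linear_combination 2 * P1, hQ⟩

lemma even_irr (hq : Fintype.card F % 8 = 3) {χ : PSL2 F → ℂ} (hχ : IsIrr χ) {d : ℕ} (hd : χ 1 = d) (hev : Even d) :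
    ∃ (κ : ℤˣ) (θ : TT F κ →* ℂ), θ (negT κ) = 1 ∧ (∃ τ, θ τ ^ 2 ≠ 1) ∧ χ = push (RR κ θ) := by
  by_contra hcon
  push Not at hcon
  obtain ⟨l, hl1, hl2, -, hl3⟩ := exists_lam hq
  obtain ⟨e, rfl⟩ := hev
  have h1 : χ ≠ fun _ => 1 := by
    rintro rfl
    have hd1 : (1 : ℂ) = ((e + e : ℕ) : ℂ) := hd
    have : 1 = e + e := by exact_mod_cast hd1
    omega
  have h2 : χ ≠ St F := by
    rintro rfl
    have hs : St F 1 = Fintype.card F := by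
      unfold St
      rw [Pi.sub_apply, push_one 1 1 rfl]; simp
    rw [hs] at hd
    have : Fintype.card F = e + e := by exact_mod_cast hd
    omega
  have := (dichotomy hq hl1 hl2 hl3 hχ h1 h2 hcon).1
  rw [hd] at this
  have h4 : 2 * (e + e) + 1 = Fintype.card F := by
    have : ((2 * (e + e) + 1 : ℕ) : ℂ) = (Fintype.card F : ℕ) := by
      push_cast at this ⊢; linear_combination this
    exact_mod_cast this
  omega

end Dich

end PartP4d

section PartP5

section AutS
variable {F : Type} [Field F] [CharP F 3] [Fintype F] [DecidableEq F]

lemma uu_mul (x y : F) : uu x * uu y = uu (x + y) := by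
  apply sl_ext <;> simp [uu]; ring

lemma uu_zero : uu (0 : F) = 1 := by
  apply sl_ext <;> simp [uu]

lemma uu_inj {x y : F} (h : uu x = uu y) : x = y := by
  have := congrArg (fun A : SL2 F => A 0 1) h
  simpa [uu] using this

lemma one_ne_neg_one : (1 : F) ≠ -1 := fun h => ne_zero_of_char (F := F) (by linear_combination h)

lemma pmk_uu_inj {x y : F} (h : pmk (uu x) = pmk (uu y)) : x = y := by
  rcases pmk_eq.1 h with h | h
  · exact (uu_inj h).symm
  · have := congrArg (fun A : SL2 F => A 0 0) h
    simp [uu] at this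
    exact absurd this one_ne_neg_one

lemma uu_sq_conj (hneg : ¬ IsSquare (-1 : F)) (y : F) (hy : y ≠ 0) : ∃ P : SL2 F, ∃ e : ℤˣ,
    uu y = P * uu ((e : ℤ) : F) * P⁻¹ := by
  obtain ⟨a, ha, h | h⟩ := sq_or_neg_sq hneg y hy
  · refine ⟨dd a ha, 1, ?_⟩
    rw [uu_conj, h]; simp
  · refine ⟨dd a ha, -1, ?_⟩
    rw [uu_conj, ← h]; simp

lemma unip (hneg : ¬ IsSquare (-1 : F)) (A : SL2 F) (ht : tr A = 2) (h1 : A ≠ 1) : ∃ P : SL2 F, ∃ e : ℤˣ,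
    A = P * uu ((e : ℤ) : F) * P⁻¹ := by
  have hd := sl_det A
  have key : ∃ P : SL2 F, ∃ y, y ≠ 0 ∧ A = P * uu y * P⁻¹ := by
    unfold tr at ht
    by_cases hc : A 1 0 = 0
    · have ha : A 0 0 = 1 := by
        have : (A 0 0 - 1) ^ 2 = 0 := by linear_combination -hd + (A 0 0) * ht - A 0 1 * hc
        have := pow_eq_zero_iff (two_ne_zero) |>.1 this
        linear_combination this
      have hdd : A 1 1 = 1 := by linear_combination ht - ha
      have hA : A = uu (A 0 1) := by apply sl_ext <;> simp [uu, ha, hc, hdd]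
      refine ⟨1, A 0 1, ?_, by simpa using hA⟩
      intro h0
      rw [h0, uu_zero] at hA
      exact h1 hA
    · refine ⟨mkSL (A 0 0 - 1) (-(A 1 0)⁻¹) (A 1 0) 0 (by field_simp; ring), -(A 1 0)⁻¹, by simpa using hc, ?_⟩
      rw [eq_mul_inv_iff_mul_eq]
      have hd1 : A 1 1 = 2 - A 0 0 := by linear_combination ht
      rw [hd1] at hd
      apply sl_ext <;> simp [uu]
      · linear_combination -hd
      · field_simp; ring
      · rw [hd1]; ring
  obtain ⟨P, y, hy, hA⟩ := key
  obtain ⟨Q, e, hQ⟩ := uu_sq_conj hneg y hy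
  refine ⟨P * Q, e, ?_⟩
  rw [hA, hQ]; group

/-- the Weyl element -/
def ww : SL2 F := mkSL 0 (-1) 1 0 (by ring)

/-- the lower unipotent -/
lemma low_eq (c : F) : mkSL 1 0 c 1 (by ring) = ww * uu (-c) * (ww : SL2 F)⁻¹ := by
  rw [eq_mul_inv_iff_mul_eq]
  apply sl_ext <;> simp [uu, ww]

lemma gen_ext {H : Type} [Group H] {β γ : SL2 F →* H} (h : ∀ x, β (uu x) = γ (uu x)) (hw : β ww = γ ww) : β = γ := by
  have key : ∀ A : SL2 F, A 1 0 ≠ 0 → β A = γ A := by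
    intro A hc
    have hd := sl_det A
    have : A = uu ((A 0 0 - 1) / A 1 0) * (ww * uu (-(A 1 0)) * (ww : SL2 F)⁻¹) * uu ((A 1 1 - 1) / A 1 0) := by
      rw [← low_eq]
      apply sl_ext <;> simp [uu]
      · field_simp; ring
      · field_simp; linear_combination -hd
      · field_simp; ring
    rw [this]
    simp only [map_mul, h, hw, map_inv]
  ext A
  by_cases hc : A 1 0 = 0
  · have hd := sl_det A
    have : A = (ww : SL2 F)⁻¹ * (ww * A) := by group
    rw [this, map_mul, map_mul γ, map_inv, map_inv, hw, key]
    simp [ww]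
    intro h0
    rw [h0, hc] at hd
    simp at hd
  · exact key A hc

lemma sq_eq_one_center {W : SL2 F} (h : W ^ 2 = 1) : W = 1 ∨ W = -1 := by
  have h2 := ne_zero_of_char (F := F)
  have h1 : W = W⁻¹ := by rw [eq_inv_iff_mul_eq_one, ← sq, h]
  have e1 := congrArg (fun A : SL2 F => A 0 1) h1
  have e2 := congrArg (fun A : SL2 F => A 1 0) h1
  have e3 := congrArg (fun A : SL2 F => A 0 0) h1
  simp at e1 e2 e3
  have f1 : W 0 1 = 0 := by
    have : 2 * W 0 1 = 0 := by linear_combination e1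
    exact (mul_eq_zero.1 this).resolve_left h2
  have f2 : W 1 0 = 0 := by
    have : 2 * W 1 0 = 0 := by linear_combination e2
    exact (mul_eq_zero.1 this).resolve_left h2
  have hd := sl_det W
  rw [f1, e3] at hd
  have : W 1 1 * W 1 1 = 1 := by linear_combination hd
  rcases mul_self_eq_one_iff.1 this with h | h
  · left; apply sl_ext <;> simp [f1, f2, e3, h]
  · right; apply sl_ext <;> simp [f1, f2, e3, h]

lemma neg_one_sl_ne : (-1 : SL2 F) ≠ 1 := by
  intro h
  have := congrArg (fun A : SL2 F => A 0 0) h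
  simp at this
  exact one_ne_neg_one this.symm

/-- Lifts of elements with given square. -/
lemma sq_neg_one {W : SL2 F} (h : W ^ 2 = -1) : W 1 1 = - W 0 0 := by
  have h1 : W = - W⁻¹ := by
    rw [← neg_eq_iff_eq_neg, eq_comm, inv_eq_iff_mul_eq_one, mul_neg, ← sq, h, neg_neg]
  have e3 := congrArg (fun A : SL2 F => A 0 0) h1
  simp at e3
  rw [e3]; ring

lemma aut0 (hneg : ¬ IsSquare (-1 : F)) (β : SL2 F →* PSL2 F) (hβ : ∀ A, β A = 1 → A = 1 ∨ A = -1) (hm : β (-1) = 1)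
    (hu : ∀ x, β (uu x) = pmk (uu x)) : ∃ P : SL2 F, ∀ X, β X = pmk (P * X * P⁻¹) := by
  obtain ⟨W, hW⟩ := pmk_surj (β ww)
  have hww : (ww : SL2 F) ^ 2 = -1 := by rw [sq]; apply sl_ext <;> simp [ww]
  have hW2 : pmk (W ^ 2) = pmk 1 := by rw [map_pow, hW, ← map_pow, hww, hm, map_one]
  have hW3 : W ^ 2 = -1 := by
    rcases pmk_eq.1 hW2 with h | h
    · exfalso
      have : β ww = 1 := by
        rw [← hW]
        rcases sq_eq_one_center h.symm with h | h
        · rw [h, map_one]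
        · rw [h, pmk_neg, map_one]
      rcases hβ _ this with h | h
      · rw [h, one_pow] at hww; exact neg_one_sl_ne hww.symm
      · rw [h, neg_sq, one_pow] at hww; exact neg_one_sl_ne hww.symm
    · rw [h, neg_neg]
  have h11 := sq_neg_one hW3
  have hd := sl_det W
  rw [h11] at hd
  have hs : W 1 0 ≠ 0 := by
    intro h0
    apply hneg
    refine ⟨W 0 0, ?_⟩
    rw [h0] at hd
    linear_combination hd
  set s := W 1 0 with hsdef
  set p := W 0 0 with hpdef
  -- order three relation
  have hwu : pmk ((W * uu 1) ^ 3) = 1 := by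
    rw [map_pow, map_mul, hW, ← hu, ← map_mul, ← map_pow]
    have : ((ww : SL2 F) * uu 1) ^ 3 = -1 := by
      apply sl_ext <;> simp [ww, uu, pow_succ]
    rw [this, hm]
  -- after translating
  set x := p / s with hx
  have hWx : W = uu x * mkSL 0 (-s⁻¹) s 0 (by field_simp; ring) * (uu x)⁻¹ := by
    rw [eq_mul_inv_iff_mul_eq]
    apply sl_ext <;> simp [uu]
    · rw [hx, ← hpdef]; field_simp
    · rw [hx, ← hpdef]
      field_simp
      linear_combination -hd
    · exact hsdef.symm
    · rw [hx, h11, ← hsdef]; field_simp; ring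
  have hss : s ^ 2 = 1 := by
    have h5 : tr (W * uu 1) = s := by
      simp only [tr, sl_mul_00, sl_mul_11, uu, mkSL_00, mkSL_01, mkSL_10, mkSL_11, h11, ← hsdef, ← hpdef]; ring
    have h6 := tr_cube (W * uu 1)
    rw [h5] at h6
    have h3 := h3 (F := F)
    rw [← map_one pmk] at hwu
    have h7 : (s ^ 3) ^ 2 = 1 := by
      rw [← h6]
      rcases pmk_eq.1 hwu with h | h
      · rw [← h, tr_one]; linear_combination h3
      · have : (W * uu 1) ^ 3 = -1 := by rw [h, neg_neg]
        rw [this, tr_neg, tr_one]; linear_combination h3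
    have h8 : (s ^ 2 - 1) ^ 3 = 0 := by linear_combination h7 + (- s ^ 4 + s ^ 2) * h3
    have := pow_eq_zero_iff (three_ne_zero) |>.1 h8
    linear_combination this
  have hfin : β ww = pmk (uu x * ww * (uu x)⁻¹) := by
    rw [← hW, hWx]
    simp only [map_mul, map_inv]
    congr 2
    rw [pmk_eq]
    rcases sq_one_iff.1 hss with h | h
    · left; apply sl_ext <;> simp [ww, h]
    · right; apply sl_ext <;> simp [ww, h]
  refine ⟨uu x, ?_⟩
  let γ : SL2 F →* PSL2 F := pmk.comp (MulAut.conj (uu x)).toMonoidHom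
  have : β = γ := by
    apply gen_ext
    · intro y
      rw [hu]
      show _ = pmk (uu x * uu y * (uu x)⁻¹)
      congr 1
      rw [eq_mul_inv_iff_mul_eq, uu_mul, uu_mul, add_comm]
    · rw [hfin]; rfl
  intro X
  rw [this]; rfl

end AutS

end PartP5

section PartP5b

section AutT
variable {F : Type} [Field F] 

lemma e_sq (e : ℤˣ) : ((e : ℤ) : F) * ((e : ℤ) : F) = 1 := by
  rcases Int.units_eq_one_or e with rfl | rfl <;> simp

/-- diagonal automorphism -/
def del (e : ℤˣ) : SL2 F →* SL2 F where
  toFun X := mkSL (X 0 0) (((e : ℤ) : F) * X 0 1) (((e : ℤ) : F) * X 1 0) (X 1 1) (by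
    have := sl_det X
    have h := e_sq (F := F) e
    linear_combination this - X 0 1 * X 1 0 * h)
  map_one' := by apply sl_ext <;> simp
  map_mul' := by
    intro X Y
    have h := e_sq (F := F) e
    apply sl_ext <;> simp
    · linear_combination -(X 0 1 * Y 1 0) * h
    · ring
    · ring
    · linear_combination -(X 1 0 * Y 0 1) * h

/-- field automorphism -/
def fr (φ : F ≃+* F) : SL2 F →* SL2 F := Matrix.SpecialLinearGroup.map (φ : F →+* F)

@[simp] lemma fr_apply (φ : F ≃+* F) (X : SL2 F) (i j) : (fr φ X) i j = φ (X i j) := rfl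
@[simp] lemma del_00 (e : ℤˣ) (X : SL2 F) : (del e X) 0 0 = X 0 0 := rfl
@[simp] lemma del_01 (e : ℤˣ) (X : SL2 F) : (del e X) 0 1 = ((e : ℤ) : F) * X 0 1 := rfl
@[simp] lemma del_10 (e : ℤˣ) (X : SL2 F) : (del e X) 1 0 = ((e : ℤ) : F) * X 1 0 := rfl
@[simp] lemma del_11 (e : ℤˣ) (X : SL2 F) : (del e X) 1 1 = X 1 1 := rfl

lemma fr_del (e : ℤˣ) (φ : F ≃+* F) (X : SL2 F) : fr φ (del e X) = del e (fr φ X) := by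
  apply sl_ext <;> simp

lemma del_del (e e' : ℤˣ) (X : SL2 F) : del e (del e' X) = del (e * e') X := by
  apply sl_ext <;> simp <;> ring

lemma del_one (X : SL2 F) : del 1 X = X := by
  apply sl_ext <;> simp

lemma fr_fr (φ ψ : F ≃+* F) (X : SL2 F) : fr φ (fr ψ X) = fr (φ * ψ) X := by
  apply sl_ext <;> simp

lemma fr_one (X : SL2 F) : fr 1 X = X := by
  apply sl_ext <;> simp

lemma fr_neg (φ : F ≃+* F) (X : SL2 F) : fr φ (-X) = - fr φ X := by
  apply sl_ext <;> simp

lemma del_neg (e : ℤˣ) (X : SL2 F) : del e (-X) = - del e X := by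
  apply sl_ext <;> simp

lemma tr_del (e : ℤˣ) (X : SL2 F) : tr (del e X) = tr X := by simp [tr]
lemma tr_fr (φ : F ≃+* F) (X : SL2 F) : tr (fr φ X) = φ (tr X) := by simp [tr]

/-- type of an automorphism -/
def Ty (α : MulAut (PSL2 F)) (e : ℤˣ) (φ : F ≃+* F) : Prop :=
  ∃ P : SL2 F, ∀ X, α (pmk X) = pmk (P * del e (fr φ X) * P⁻¹)

lemma Ty.mul {α β : MulAut (PSL2 F)} {e e' : ℤˣ} {φ ψ : F ≃+* F} (h : Ty α e φ) (h' : Ty β e' ψ) :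
    Ty (α * β) (e * e') (φ * ψ) := by
  obtain ⟨P, hP⟩ := h
  obtain ⟨Q, hQ⟩ := h'
  refine ⟨P * del e (fr φ Q), fun X => ?_⟩
  rw [MulAut.mul_apply, hQ, hP]
  congr 1
  simp only [map_mul, map_inv, fr_del, del_del, fr_fr]
  group

lemma Ty.inv {α : MulAut (PSL2 F)} {e : ℤˣ} {φ : F ≃+* F} (h : Ty α e φ) : Ty α⁻¹ e φ⁻¹ := by
  obtain ⟨P, hP⟩ := h
  refine ⟨(del e (fr φ⁻¹ P))⁻¹, fun X => ?_⟩
  rw [MulAut.inv_apply, MulEquiv.symm_apply_eq, hP]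
  congr 1
  simp only [map_mul, map_inv, fr_del, del_del, fr_fr, Int.units_mul_self, mul_inv_cancel, fr_one, del_one]
  group

lemma Ty.pow {α : MulAut (PSL2 F)} {e : ℤˣ} {φ : F ≃+* F} (h : Ty α e φ) (n : ℕ) : Ty (α ^ n) (e ^ n) (φ ^ n) := by
  induction n with
  | zero => exact ⟨1, fun X => by simp [del_one, fr_one]⟩
  | succ n ih => simpa [pow_succ] using ih.mul h

lemma Ty.conj (P : SL2 F) : Ty (MulAut.conj (pmk P)) 1 1 :=
  ⟨P, fun X => by simp [del_one, fr_one]⟩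

lemma Ty.inn {α : MulAut (PSL2 F)} (h : Ty α 1 1) : ∃ P, α = MulAut.conj (pmk P) := by
  obtain ⟨P, hP⟩ := h
  refine ⟨P, ?_⟩
  ext s
  obtain ⟨X, rfl⟩ := pmk_surj s
  rw [hP]; simp [del_one, fr_one]

variable [CharP F 3] [Fintype F] [DecidableEq F]

lemma comm_u (A : SL2 F) (h : pmk A * pmk (uu 1) = pmk (uu 1) * pmk A) : ∃ y, pmk A = pmk (uu y) := by
  have h2 := ne_zero_of_char (F := F)
  have hd := sl_det A
  rw [← map_mul, ← map_mul] at h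
  rcases pmk_eq.1 h with h | h
  · have e1 := congrArg (fun A : SL2 F => A 0 0) h
    have e2 := congrArg (fun A : SL2 F => A 0 1) h
    simp [uu] at e1 e2
    have e3 : A 0 0 = A 1 1 := by linear_combination -e2
    rw [e1, e3] at hd
    have : A 1 1 * A 1 1 = 1 := by linear_combination hd
    rcases mul_self_eq_one_iff.1 this with h | h
    · refine ⟨A 0 1, pmk_eq.2 (Or.inl ?_)⟩
      apply sl_ext <;> simp [uu, e1, e3, h]
    · refine ⟨-A 0 1, pmk_eq.2 (Or.inr ?_)⟩
      apply sl_ext <;> simp [uu, e1, e3, h]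
  · exfalso
    have e1 := congrArg (fun A : SL2 F => A 1 0) h
    have e2 := congrArg (fun A : SL2 F => A 1 1) h
    simp [uu] at e1 e2
    have f1 : A 1 0 = 0 := (mul_eq_zero.1 (show 2 * A 1 0 = 0 by linear_combination e1)).resolve_left h2
    have f2 : A 1 1 = 0 := (mul_eq_zero.1 (show 2 * A 1 1 = 0 by linear_combination e2 - f1)).resolve_left h2
    rw [f1, f2] at hd
    simp at hd

lemma norm_u (D : SL2 F) {x z : F} (hx : x ≠ 0) (h : pmk D * pmk (uu x) = pmk (uu z) * pmk D) :
    z = D 0 0 ^ 2 * x := by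
  have h2 := ne_zero_of_char (F := F)
  have hd := sl_det D
  rw [← map_mul, ← map_mul] at h
  rcases pmk_eq.1 h with h | h
  · have e1 := congrArg (fun A : SL2 F => A 1 1) h
    have e2 := congrArg (fun A : SL2 F => A 0 1) h
    simp [uu, hx] at e1 e2
    rw [e1] at hd
    linear_combination D 0 0 * e2 - z * hd
  · exfalso
    have e1 := congrArg (fun A : SL2 F => A 1 0) h
    have e2 := congrArg (fun A : SL2 F => A 0 0) h
    simp [uu] at e1 e2
    have f1 : D 1 0 = 0 := (mul_eq_zero.1 (show 2 * D 1 0 = 0 by linear_combination e1)).resolve_left h2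
    rw [f1] at e2
    have f2 : D 0 0 = 0 := (mul_eq_zero.1 (show 2 * D 0 0 = 0 by linear_combination e2)).resolve_left h2
    rw [f1, f2] at hd
    simp at hd

lemma fr_uu (φ : F ≃+* F) (x : F) : fr φ (uu x) = uu (φ x) := by
  apply sl_ext <;> simp [uu]

lemma del_uu (e : ℤˣ) (x : F) : del e (uu x) = uu (((e : ℤ) : F) * x) := by
  apply sl_ext <;> simp [uu]

lemma aut1 (hneg : ¬ IsSquare (-1 : F)) (β : SL2 F →* PSL2 F) (hβ : ∀ A, β A = 1 → A = 1 ∨ A = -1) (hm : β (-1) = 1)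
    (hu : β (uu 1) = pmk (uu 1)) : ∃ (φ : F ≃+* F) (P : SL2 F), ∀ X, β X = pmk (P * fr φ X * P⁻¹) := by
  have h1 : ∀ x, ∃ y, β (uu x) = pmk (uu y) := by
    intro x
    obtain ⟨A, hA⟩ := pmk_surj (β (uu x))
    rw [← hA]
    apply comm_u
    rw [hA, ← hu, ← map_mul, ← map_mul, uu_mul, uu_mul, add_comm]
  choose a ha using h1
  have hadd : ∀ x y, a (x + y) = a x + a y := by
    intro x y
    apply pmk_uu_inj
    rw [← ha, ← uu_mul, map_mul, ha, ha, ← map_mul, uu_mul]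
  have hone : a 1 = 1 := by
    apply pmk_uu_inj; rw [← ha, hu]
  have hzero : a 0 = 0 := by
    have := hadd 0 0; simp at this; exact this
  have hneg' : ∀ x, a (-x) = - a x := by
    intro x
    have := hadd x (-x)
    rw [add_neg_cancel, hzero] at this
    linear_combination -this
  have hsq : ∀ t : F, t ≠ 0 → ∀ x, a (t ^ 2 * x) = a (t ^ 2) * a x := by
    intro t ht
    obtain ⟨D, hD⟩ := pmk_surj (β (dd t ht))
    have key : ∀ x, x ≠ 0 → a (t ^ 2 * x) = D 0 0 ^ 2 * a x := by
      intro x hx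
      have hax : a x ≠ 0 := by
        intro h0
        have := ha x
        rw [h0, uu_zero, map_one] at this
        exact uu_ne x hx (hβ _ this)
      apply norm_u D hax
      rw [hD, ← ha, ← ha, ← map_mul, ← map_mul, ← uu_conj t x ht]
      congr 1
      group
    intro x
    by_cases hx : x = 0
    · rw [hx, mul_zero, hzero, mul_zero]
    · have k1 := key 1 one_ne_zero
      rw [mul_one, hone, mul_one] at k1
      rw [key x hx, k1]
  have hmul : ∀ x y, a (x * y) = a x * a y := by
    intro x y
    by_cases hx : x = 0
    · rw [hx, zero_mul, hzero, zero_mul]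
    · obtain ⟨t, ht, h | h⟩ := sq_or_neg_sq hneg x hx
      · rw [h, hsq t ht]
      · have e1 : x = -(t ^ 2) := by rw [← h, neg_neg]
        rw [e1, neg_mul, hneg', hneg', hsq t ht, neg_mul]
  let φ0 : F →+* F := { toFun := a, map_one' := hone, map_mul' := hmul, map_zero' := hzero, map_add' := hadd }
  let φ : F ≃+* F := RingEquiv.ofBijective φ0 (Finite.injective_iff_bijective.1 φ0.injective)
  have hφ : ∀ x, φ x = a x := fun x => rfl
  obtain ⟨P, hP⟩ := aut0 hneg (β.comp (fr φ⁻¹)) (by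
      intro A hA
      rcases hβ _ hA with h | h
      · left
        have := congrArg (fr φ) h
        rwa [fr_fr, mul_inv_cancel, fr_one, map_one] at this
      · right
        have := congrArg (fr φ) h
        rwa [fr_fr, mul_inv_cancel, fr_one, fr_neg, map_one] at this) (by
      rw [MonoidHom.comp_apply, fr_neg, map_one, hm]) (by
      intro x
      rw [MonoidHom.comp_apply, fr_uu, ha, ← hφ]
      congr 2
      exact φ.apply_symm_apply x)
  refine ⟨φ, P, fun X => ?_⟩
  rw [← hP, MonoidHom.comp_apply, fr_fr, inv_mul_cancel, fr_one]

lemma tr_sq_of_cube {A : SL2 F} (h : pmk A ^ 3 = 1) : tr A ^ 2 = 1 := by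
  have h3 := h3 (F := F)
  have h6 := tr_cube A
  have h7 : (tr A ^ 3) ^ 2 = 1 := by
    rw [← h6]
    rw [← map_pow, ← map_one pmk] at h
    rcases pmk_eq.1 h with h | h
    · rw [← h, tr_one]; linear_combination h3
    · have : A ^ 3 = -1 := by rw [h, neg_neg]
      rw [this, tr_neg, tr_one]; linear_combination h3
  have h8 : (tr A ^ 2 - 1) ^ 3 = 0 := by linear_combination h7 + (- tr A ^ 4 + tr A ^ 2) * h3
  have := pow_eq_zero_iff (three_ne_zero) |>.1 h8
  linear_combination this

/-- lifts of elements of order three -/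
lemma unip_psl (hneg : ¬ IsSquare (-1 : F)) (A : SL2 F) (h1 : pmk A ≠ 1) (ht : tr A ^ 2 = 1) : ∃ P : SL2 F, ∃ e : ℤˣ,
    pmk A = pmk (P * uu ((e : ℤ) : F) * P⁻¹) := by
  have h3 := h3 (F := F)
  rcases sq_one_iff.1 ht with h | h
  · obtain ⟨P, e, hP⟩ := unip hneg (-A) (by rw [tr_neg, h]; linear_combination -h3) (by
      intro h; apply h1; rw [← pmk_neg, h, map_one])
    exact ⟨P, e, by rw [← hP, pmk_neg]⟩
  · obtain ⟨P, e, hP⟩ := unip hneg A (by rw [h]; linear_combination -h3) (by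
      intro h; apply h1; rw [h, map_one])
    exact ⟨P, e, by rw [← hP]⟩

lemma aut2 (hneg : ¬ IsSquare (-1 : F)) (α : MulAut (PSL2 F)) : ∃ e φ, Ty α e φ := by
  let β : SL2 F →* PSL2 F := α.toMonoidHom.comp pmk
  have hβa : ∀ X, β X = α (pmk X) := fun X => rfl
  obtain ⟨A, hA⟩ := pmk_surj (β (uu 1))
  have hu3 : (uu (1 : F)) ^ 3 = 1 := by
    rw [pow_succ, sq, uu_mul, uu_mul, ← uu_zero]; congr 1; linear_combination h3 (F := F)
  have hA1 : pmk A ≠ 1 := by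
    rw [hA, hβa]
    intro h
    rw [map_eq_one_iff _ α.injective, ← map_one pmk, ← uu_zero] at h
    exact one_ne_zero (pmk_uu_inj h)
  obtain ⟨P, e, hP⟩ := unip_psl hneg A hA1 (tr_sq_of_cube (by rw [hA, ← map_pow, hu3, map_one]))
  let γ : SL2 F →* PSL2 F := (MulAut.conj (pmk P)⁻¹).toMonoidHom.comp (β.comp (del e))
  have hγ : ∀ X, γ X = (pmk P)⁻¹ * α (pmk (del e X)) * pmk P := fun X => by
    show MulAut.conj (pmk P)⁻¹ (α (pmk (del e X))) = _
    simp
  have hu1 : α (pmk (uu ((e : ℤ) : F))) = pmk (P * uu 1 * P⁻¹) := by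
    rw [hA, hβa] at hP
    rcases Int.units_eq_one_or e with rfl | rfl
    · simpa using hP
    · have e1 : uu (((-1 : ℤˣ) : ℤ) : F) = (uu 1)⁻¹ := by
        rw [eq_inv_iff_mul_eq_one, uu_mul, ← uu_zero]; simp
      rw [e1] at hP ⊢
      rw [map_inv, map_inv, hP, ← map_inv]
      congr 1; group
  obtain ⟨φ, Q, hQ⟩ := aut1 hneg γ (by
      intro X hX
      rw [hγ] at hX
      have : α (pmk (del e X)) = 1 := by
        have := congrArg (fun s => pmk P * s * (pmk P)⁻¹) hX
        simpa [mul_assoc] using this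
      rw [map_eq_one_iff _ α.injective, ← map_one pmk] at this
      rcases pmk_eq.1 this with h | h
      · left
        have := congrArg (del e) h
        rw [del_del, Int.units_mul_self, del_one, map_one] at this
        exact this.symm
      · right
        have := congrArg (del e) h
        rw [del_neg, del_del, Int.units_mul_self, del_one, map_one] at this
        rw [this, neg_neg]) (by
      rw [hγ, del_neg, pmk_neg]; simp) (by
      rw [hγ, del_uu, mul_one, hu1, ← map_inv, ← map_mul, ← map_mul]; congr 1; group)
  refine ⟨e, φ, P * Q, fun X => ?_⟩
  have := hQ (del e X)
  rw [hγ, del_del, Int.units_mul_self, del_one, fr_del] at this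
  have h9 : α (pmk X) = pmk P * pmk (Q * del e (fr φ X) * Q⁻¹) * (pmk P)⁻¹ := by
    rw [← this]; group
  rw [h9, ← map_inv, ← map_mul, ← map_mul]
  congr 1; group

end AutT

end PartP5b

section PartP6a

section Wrap
variable {G N : Type} [Group G] [Fintype G] [Group N] [Fintype N]

lemma exists_quot (j : N →* G) (c : G → N ≃* N) (hc : ∀ g n, j (c g n) = g * j n * g⁻¹)
    {f : ℕ} (hcomm : ∀ g h : G, ∃ n, j n = g * h * g⁻¹ * h⁻¹) (hpow : ∀ g : G, ∃ n, j n = g ^ f) :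
    ∃ (Q : Type) (_ : CommGroup Q) (_ : Fintype Q) (π : G →* Q), Function.Surjective π ∧
      (∀ g, π g = 1 ↔ ∃ n, j n = g) ∧ (∀ g, π g ^ f = 1) := by
  classical
  haveI : j.range.Normal := ⟨by
    rintro _ ⟨n, rfl⟩ g
    exact ⟨c g n, hc g n⟩⟩
  let Q := G ⧸ j.range
  let π : G →* Q := QuotientGroup.mk' j.range
  have hπ : Function.Surjective π := QuotientGroup.mk'_surjective _
  have hker : ∀ g, π g = 1 ↔ ∃ n, j n = g := by
    intro g
    exact (QuotientGroup.eq_one_iff g)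
  let inst : CommGroup Q := { (inferInstance : Group Q) with
    mul_comm := by
      intro a b
      obtain ⟨g, rfl⟩ := hπ a
      obtain ⟨h, rfl⟩ := hπ b
      have h1 : π (g * h * g⁻¹ * h⁻¹) = 1 := (hker _).2 (hcomm g h)
      rw [map_mul, map_mul, map_mul, map_inv, map_inv, mul_inv_eq_one, mul_inv_eq_iff_eq_mul] at h1
      exact h1 }
  refine ⟨Q, inst, Fintype.ofFinite Q, π, hπ, hker, fun g => ?_⟩
  have := (hker _).2 (hpow g)
  rwa [map_pow] at this

lemma parityW (j : N →* G) (c : G → N ≃* N) (hc : ∀ g n, j (c g n) = g * j n * g⁻¹) (hj : Function.Injective j)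
    {f : ℕ} (hf : Odd f) (hcomm : ∀ g h : G, ∃ n, j n = g * h * g⁻¹ * h⁻¹) (hpow : ∀ g : G, ∃ n, j n = g ^ f)
    {ψ : G → ℂ} (hψ : IsIrr ψ) {χ : N → ℂ} (hχ : IsIrr χ) (h : ip χ (fun n => ψ (j n)) ≠ 0)
    {d e : ℕ} (hd : ψ 1 = d) (he : χ 1 = e) (hev : Even d) : Even e := by
  obtain ⟨Q, i1, i2, π, hπ, hker, hp⟩ := exists_quot j c hc hcomm hpow
  exact parity j c hc π hj hπ hker hf hp hψ hχ h hd he hev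

lemma descend (j : N →* G) (c : G → N ≃* N) (hc : ∀ g n, j (c g n) = g * j n * g⁻¹) (hj : Function.Injective j)
    {f : ℕ} (hf : Odd f) (hcomm : ∀ g h : G, ∃ n, j n = g * h * g⁻¹ * h⁻¹) (hpow : ∀ g : G, ∃ n, j n = g ^ f)
    {η : N → ℂ} (hη : IsIrr η) (hreal : ∀ n, η n⁻¹ = η n)
    (hgal : ∀ σ : ℂ ≃+* ℂ, ∃ g : G, ∀ n, σ (η n) = η (c g n)) {d : ℕ} (hd : η 1 = d) (hev : Even d) :
    ∃ V : FDRep ℂ G, Simple V ∧ (∀ g, ∃ q : ℚ, V.character g = q) ∧ Even (Module.finrank ℂ V) ∧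
      ip η (fun n => V.character (j n)) ≠ 0 := by
  classical
  obtain ⟨Q, i1, i2, π, hπ, hker, hp⟩ := exists_quot j c hc hcomm hpow
  obtain ⟨ψ, hψ, hfix, h0⟩ := lemmaE0 j c hc π hj hπ hker hf hp hη hreal hgal
  have hψc := hψ.isChar
  obtain ⟨V, hV, rfl⟩ := hψ
  refine ⟨V, hV, fun g => rational_of_fixed (hψc.algebraic g) (fun σ => hfix σ g), ?_, h0⟩
  have hirr : IsIrr V.character := ⟨V, hV, rfl⟩
  have hres : IsChar (fun n => V.character (j n)) := hψc.comp j
  have hexp := congrFun (expand hres.classFn) 1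
  choose! n hn using fun χ (hχ : IsIrr χ) => ip_nat hres hχ.isChar
  have h1 : (Module.finrank ℂ V : ℂ) = ((∑ χ ∈ irrF N, n χ * d : ℕ) : ℂ) := by
    rw [← V.char_one]
    simp only [map_one] at hexp
    rw [hexp, Finset.sum_apply]
    push_cast
    refine Finset.sum_congr rfl (fun χ hχ => ?_)
    have hχ1 := mem_irrF.1 hχ
    simp only [Pi.smul_apply, smul_eq_mul]
    by_cases hz : n χ = 0
    · rw [hn χ hχ1, hz]; simp
    · obtain ⟨g, hg⟩ := clifford j c hη hχ1 hirr hj hc h0 (by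
        rw [ip_comm, hn χ hχ1]; exact_mod_cast hz)
      have : χ 1 = d := by rw [hg]; simp only [map_one]; exact hd
      rw [hn χ hχ1, this]
  have h2 : Module.finrank ℂ V = ∑ χ ∈ irrF N, n χ * d := by exact_mod_cast h1
  rw [h2, ← Finset.sum_mul]
  exact hev.mul_left _

/-- restriction not constant -/
lemma not_const {ψ χ : N → ℂ} (hχ : IsIrr χ) (h1 : χ ≠ fun _ => 1) (h : ip χ ψ ≠ 0) : ∃ n, ψ n ≠ ψ 1 := by
  by_contra! hcon
  apply h
  have : ψ = ψ 1 • (fun _ : N => (1 : ℂ)) := by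
    funext n; rw [hcon n]; simp
  rw [this, ip_smul_right, hχ.ip_ne (triv_irr N) h1, mul_zero]

lemma ip_norm_zero {f : N → ℂ} (hf : IsClassFn f) (hinteg : ∀ χ, IsIrr χ → ∃ n : ℤ, ip f χ = n) (h0 : ip f f = 0) : f = 0 := by
  classical
  apply irr_complete hf
  intro χ hχ
  choose! n hn using hinteg
  rw [parseval hf] at h0
  have : ∑ χ ∈ irrF N, n χ ^ 2 = 0 := by
    have : ((∑ χ ∈ irrF N, n χ ^ 2 : ℤ) : ℂ) = 0 := by
      rw [← h0]; push_cast
      refine Finset.sum_congr rfl (fun φ hφ => ?_)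
      rw [ip_comm φ, hn φ (mem_irrF.1 hφ), sq]
    exact_mod_cast this
  have := (Finset.sum_eq_zero_iff_of_nonneg (fun φ _ => sq_nonneg (n φ))).1 this χ (mem_irrF.2 hχ)
  rw [hn χ hχ, pow_eq_zero_iff (two_ne_zero) |>.1 this]; simp

end Wrap

section RRmore
variable {F : Type} [Field F] [CharP F 3] [Fintype F] [DecidableEq F]

lemma RR_congr (κ : ℤˣ) (θ : TT F κ →* ℂ) {A B : SL2 F} (h : (A = 1 ∨ A = -1) ↔ (B = 1 ∨ B = -1))
    (ht : tr A = tr B) : RR κ θ A = RR κ θ B := by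
  unfold RR
  simp only [h, ht]

lemma RR_inv (κ : ℤˣ) (θ : TT F κ →* ℂ) (A : SL2 F) : RR κ θ A⁻¹ = RR κ θ A := by
  apply RR_congr
  · rw [inv_eq_one, inv_eq_iff_eq_inv]; simp
  · rw [tr_inv]

lemma del_eq_iff (e : ℤˣ) (A : SL2 F) : (del e A = 1 ∨ del e A = -1) ↔ (A = 1 ∨ A = -1) := by
  constructor
  · rintro (h | h)
    · left
      have := congrArg (del e) h
      rwa [del_del, Int.units_mul_self, del_one, map_one] at this
    · right
      have := congrArg (del e) h
      rwa [del_del, Int.units_mul_self, del_one, del_neg, map_one] at this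
  · rintro (rfl | rfl)
    · left; rw [map_one]
    · right; rw [del_neg, map_one]

lemma fr_eq_iff (φ : F ≃+* F) (A : SL2 F) : (fr φ A = 1 ∨ fr φ A = -1) ↔ (A = 1 ∨ A = -1) := by
  constructor
  · rintro (h | h)
    · left
      have := congrArg (fr φ⁻¹) h
      rwa [fr_fr, inv_mul_cancel, fr_one, map_one] at this
    · right
      have := congrArg (fr φ⁻¹) h
      rwa [fr_fr, inv_mul_cancel, fr_one, fr_neg, map_one] at this
  · rintro (rfl | rfl)
    · left; rw [map_one]
    · right; rw [fr_neg, map_one]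

lemma RR_del (κ : ℤˣ) (θ : TT F κ →* ℂ) (e : ℤˣ) (A : SL2 F) : RR κ θ (del e A) = RR κ θ A :=
  RR_congr κ θ (del_eq_iff e A) (tr_del e A)

/-- Galois twist -/
def galT {T : Type} [Group T] (σ : ℂ ≃+* ℂ) (θ : T →* ℂ) : T →* ℂ := (σ : ℂ →* ℂ).comp θ

lemma galT_apply {T : Type} [Group T] (σ : ℂ ≃+* ℂ) (θ : T →* ℂ) (t : T) : galT σ θ t = σ (θ t) := rfl

lemma RR_gal (κ : ℤˣ) (θ : TT F κ →* ℂ) (σ : ℂ ≃+* ℂ) (A : SL2 F) : σ (RR κ θ A) = RR κ (galT σ θ) A := by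
  unfold RR
  split_ifs
  · simp
  · simp
  · simp only [map_mul, map_sum, map_intCast]
    congr 1
    refine Finset.sum_congr rfl (fun τ _ => ?_)
    split_ifs
    · rfl
    · simp

/-- field automorphism on the torus -/
def frT (κ : ℤˣ) (φ : F ≃+* F) : TT F κ →* TT F κ where
  toFun τ := ⟨fr φ τ, by
    have h1 := τ.2.1
    have h2 := τ.2.2
    rw [mem_TT]
    simp [h1, h2]⟩
  map_one' := by apply Subtype.ext; simp
  map_mul' := by intro a b; apply Subtype.ext; simp

lemma frT_coe (κ : ℤˣ) (φ : F ≃+* F) (τ : TT F κ) : (frT κ φ τ : SL2 F) = fr φ τ := rfl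

lemma frT_inv (κ : ℤˣ) (φ : F ≃+* F) (τ : TT F κ) : frT κ φ (frT κ φ⁻¹ τ) = τ := by
  apply Subtype.ext
  rw [frT_coe, frT_coe, fr_fr, mul_inv_cancel, fr_one]

lemma frT_bij (κ : ℤˣ) (φ : F ≃+* F) : Function.Bijective (frT (F := F) κ φ) := by
  refine Finite.surjective_iff_bijective.1 (fun τ => ⟨_, frT_inv κ φ τ⟩)

lemma RR_fr (κ : ℤˣ) (θ : TT F κ →* ℂ) (φ : F ≃+* F) (A : SL2 F) :
    RR κ θ (fr φ A) = RR κ (θ.comp (frT κ φ)) A := by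
  unfold RR
  have e1 : tr (fr φ A) ^ 2 = 1 ↔ tr A ^ 2 = 1 := by
    rw [tr_fr, ← map_pow, map_eq_one_iff _ φ.injective]
  simp only [fr_eq_iff, e1]
  congr 3
  rw [← (frT_bij κ φ).sum_comp]
  refine Finset.sum_congr rfl (fun τ _ => ?_)
  simp only [frT_coe, tr_fr, φ.injective.eq_iff, MonoidHom.comp_apply]

lemma RR_theta_inv (κ : ℤˣ) (θ θ' : TT F κ →* ℂ) (h : ∀ τ, θ' τ = θ τ⁻¹) (A : SL2 F) : RR κ θ' A = RR κ θ A := by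
  unfold RR
  congr 3
  refine Fintype.sum_equiv (Equiv.inv _) _ _ (fun τ => ?_)
  simp only [Equiv.inv_apply, Subgroup.coe_inv, tr_inv, h]

lemma RR_conj (κ : ℤˣ) (θ : TT F κ →* ℂ) (hθ : θ (negT κ) = 1) (P A : SL2 F) :
    RR κ θ (P * A * P⁻¹) = RR κ θ A := (RR_even κ θ hθ).cl A P

lemma RR_Ty (κ : ℤˣ) (θ : TT F κ →* ℂ) (hθ : θ (negT κ) = 1) {α : MulAut (PSL2 F)} {e φ} (h : Ty α e φ) (X : SL2 F) :
    push (RR κ θ) (α (pmk X)) = RR κ (θ.comp (frT κ φ)) X := by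
  obtain ⟨P, hP⟩ := h
  rw [hP, push_pmk (RR_even κ θ hθ).ev, RR_conj κ θ hθ, RR_del, RR_fr]

lemma frT_negT (κ : ℤˣ) (φ : F ≃+* F) : frT κ φ (negT κ) = negT κ := by
  apply Subtype.ext
  rw [frT_coe]
  show fr φ (-1) = -1
  rw [fr_neg, map_one]

lemma frT_pow (κ : ℤˣ) (φ : F ≃+* F) : ∃ m : ℕ, ∀ τ : TT F κ, frT κ φ τ = τ ^ m := by
  obtain ⟨g, hg⟩ := IsCyclic.exists_generator (α := TT F κ)
  obtain ⟨m, hm⟩ := (mem_powers_iff_mem_zpowers.2 (hg (frT κ φ g)))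
  refine ⟨m, fun τ => ?_⟩
  obtain ⟨n, rfl⟩ := (mem_powers_iff_mem_zpowers.2 (hg τ))
  simp only at hm ⊢
  rw [map_pow, ← hm, ← pow_mul, ← pow_mul, mul_comm]

lemma frT_one (κ : ℤˣ) : frT (F := F) κ 1 = MonoidHom.id _ := by
  ext τ : 1
  apply Subtype.ext
  rw [frT_coe, fr_one]; rfl

end RRmore

end PartP6a

section PartP6b

section FieldAut
variable {F : Type} [Field F] [CharP F 3] [Fintype F] [DecidableEq F]

lemma aut_frob (φ : F ≃+* F) : ∃ i : ℕ, ∀ x, φ x = x ^ (3 ^ i) := by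
  letI := ZMod.algebra F 3
  let ψ : F ≃ₐ[ZMod 3] F := AlgEquiv.ofRingEquiv (f := φ) (fun r => by
    have : (φ : F →+* F).comp (algebraMap (ZMod 3) F) = algebraMap (ZMod 3) F := Subsingleton.elim _ _
    exact congrArg (fun h => h r) this)
  obtain ⟨i, hi⟩ := (FiniteField.bijective_frobeniusAlgEquivOfAlgebraic_pow (ZMod 3) F).2 ψ
  refine ⟨i, fun x => ?_⟩
  have h1 : φ x = ψ x := rfl
  rw [h1, ← hi]
  have key : ∀ (n : ℕ) (x : F), (FiniteField.frobeniusAlgEquivOfAlgebraic (ZMod 3) F ^ n) x = x ^ (3 ^ n) := by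
    intro n
    induction n with
    | zero => intro x; simp
    | succ n ih =>
      intro x
      rw [pow_succ', AlgEquiv.mul_apply, ih]
      simp [FiniteField.coe_frobeniusAlgEquivOfAlgebraic, pow_succ, pow_mul]
  exact key i x

lemma aut_comm (φ ψ : F ≃+* F) : φ * ψ = ψ * φ := by
  obtain ⟨i, hi⟩ := aut_frob φ
  obtain ⟨k, hk⟩ := aut_frob ψ
  ext x
  simp only [RingAut.mul_apply, hi, hk]
  rw [← pow_mul, ← pow_mul, mul_comm]

lemma aut_pow {f : ℕ} (hF : Fintype.card F = 3 ^ f) (φ : F ≃+* F) : φ ^ f = 1 := by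
  obtain ⟨i, hi⟩ := aut_frob φ
  ext x
  have h : ∀ n, (φ ^ n) x = x ^ ((3 ^ i) ^ n) := by
    intro n
    induction n with
    | zero => simp
    | succ n ih => rw [pow_succ', RingAut.mul_apply, ih, hi, ← pow_mul, pow_succ]
  rw [h, ← pow_mul, mul_comm, pow_mul, ← hF]
  rw [FiniteField.pow_card_pow]
  rfl

lemma q_mod {f : ℕ} (hf : Odd f) (hF : Fintype.card F = 3 ^ f) : Fintype.card F % 8 = 3 := by
  obtain ⟨k, rfl⟩ := hf
  rw [hF, pow_succ, pow_mul, Nat.mul_mod, Nat.pow_mod]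
  norm_num

lemma ww_inj (y : F) (h : pmk (ww : SL2 F) * pmk (uu 1) = pmk (uu y) * pmk (ww : SL2 F)) : y = 0 := by
  have := norm_u (ww : SL2 F) one_ne_zero h
  simpa [ww] using this

lemma conj_inj : Function.Injective (MulAut.conj : PSL2 F →* MulAut (PSL2 F)) := by
  rw [injective_iff_map_eq_one]
  intro s hs
  obtain ⟨A, rfl⟩ := pmk_surj s
  have hc : ∀ t, pmk A * t = t * pmk A := by
    intro t
    have := congrArg (fun α => α t) hs
    simp only [MulAut.conj_apply, MulAut.one_apply] at this
    rwa [mul_inv_eq_iff_eq_mul] at this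
  obtain ⟨y, hy⟩ := comm_u A (hc _)
  have h2 := hc (pmk (ww : SL2 F))
  by_cases h0 : y = 0
  · rw [hy, h0, uu_zero, map_one]
  · rw [hy] at h2
    have := norm_u (ww : SL2 F) h0 h2.symm
    simp [ww] at this
    exact absurd this h0

lemma conj_aut {S : Type*} [Group S] (α : MulAut S) (s : S) : MulAut.conj (α s) = α * MulAut.conj s * α⁻¹ := by
  ext t
  simp

lemma not_conj_one (hneg : ¬ IsSquare (-1 : F)) (P : SL2 F) :
    pmk P * pmk (uu 1) * (pmk P)⁻¹ ≠ pmk (uu (-1 : F)) := by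
  intro h
  rw [mul_inv_eq_iff_eq_mul] at h
  have := norm_u P one_ne_zero h
  exact hneg ⟨P 0 0, by rw [this]; ring⟩

lemma Ty_neg_not_inn (hneg : ¬ IsSquare (-1 : F)) {α : MulAut (PSL2 F)} (h : Ty α (-1) 1) (h' : Ty α 1 1) : False := by
  obtain ⟨P, hP⟩ := h
  obtain ⟨Q, rfl⟩ := h'.inn
  have := hP (uu 1)
  rw [fr_one, del_uu] at this
  simp only [MulAut.conj_apply, map_mul, map_inv] at this
  apply not_conj_one hneg (P⁻¹ * Q)
  rw [map_mul, map_inv, mul_inv_rev, inv_inv]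
  calc _ = (pmk P)⁻¹ * (pmk Q * pmk (uu 1) * (pmk Q)⁻¹) * pmk P := by group
    _ = _ := by rw [this]; simp; group
end FieldAut

end PartP6b

section PartP7a

lemma exists_lift_coprime {p n k : ℕ} (hn : 0 < n) (hpn : p ∣ n) (hk : k.Coprime p) :
    ∃ k' : ℕ, k'.Coprime n ∧ ∃ z : ℤ, (k' : ℤ) = k + p * z := by
  haveI : NeZero n := ⟨hn.ne'⟩
  obtain ⟨u, hu⟩ := ZMod.unitsMap_surjective hpn (ZMod.unitOfCoprime k hk)
  refine ⟨(u : ZMod n).val, ZMod.val_coe_unit_coprime u, ?_⟩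
  have h1 : (((u : ZMod n).val : ℤ) : ZMod p) = ((k : ℤ) : ZMod p) := by
    have := congrArg Units.val hu
    rw [ZMod.unitsMap_val, ZMod.coe_unitOfCoprime] at this
    rw [Int.cast_natCast, Int.cast_natCast, ← this, ZMod.natCast_val]
  rw [ZMod.intCast_eq_intCast_iff_dvd_sub] at h1
  obtain ⟨z, hz⟩ := h1
  exact ⟨-z, by linarith⟩

lemma pow_pm_dvd {T : Type} [Group T] {τ : T} {p : ℕ} (ho : orderOf τ = p) {m k : ℕ} :
    (τ ^ m = τ ^ k ∨ τ ^ m = (τ ^ k)⁻¹) ↔ ((p : ℤ) ∣ m - k ∨ (p : ℤ) ∣ m + k) := by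
  rw [← ho, orderOf_dvd_iff_zpow_eq_one, orderOf_dvd_iff_zpow_eq_one, zpow_sub, zpow_add, mul_inv_eq_one,
    mul_eq_one_iff_eq_inv]
  simp only [zpow_natCast]

section Setup
variable {F : Type} [Field F] [CharP F 3] [Fintype F] [DecidableEq F]
variable {G : Subgroup (MulAut (PSL2 F))} (hinn : innAut (PSL2 F) ≤ G)

/-- embedding of the simple group -/
def jS : PSL2 F →* G := (MulAut.conj : PSL2 F →* MulAut (PSL2 F)).codRestrict G (fun s => hinn ⟨s, rfl⟩)

/-- action of `G` -/
def cS (g : G) : PSL2 F ≃* PSL2 F := (g : MulAut (PSL2 F))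

lemma jS_coe (s : PSL2 F) : (jS hinn s : MulAut (PSL2 F)) = MulAut.conj s := rfl

lemma jS_inj : Function.Injective (jS hinn) := by
  intro s t h
  exact conj_inj (congrArg Subtype.val h)

lemma jS_cS (g : G) (s : PSL2 F) : jS hinn (cS g s) = g * jS hinn s * g⁻¹ := by
  apply Subtype.ext
  exact conj_aut (g : MulAut (PSL2 F)) s

lemma jS_of_Ty {g : G} (h : Ty (g : MulAut (PSL2 F)) 1 1) : ∃ s, jS hinn s = g := by
  obtain ⟨P, hP⟩ := h.inn
  exact ⟨pmk P, Subtype.ext hP.symm⟩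

lemma isConj_jS (g : G) (s a : PSL2 F) : IsConj (jS hinn a) (jS hinn (s * cS g a * s⁻¹)) := by
  rw [isConj_iff]
  refine ⟨jS hinn s * g, ?_⟩
  rw [map_mul, map_mul, jS_cS, map_inv]
  group

lemma of_isConj_jS {a b : PSL2 F} (h : IsConj (jS hinn a) (jS hinn b)) : ∃ g : G, cS g a = b := by
  obtain ⟨g, hg⟩ := isConj_iff.1 h
  exact ⟨g, jS_inj hinn (by rw [jS_cS, hg])⟩

/-- The left hand side of the theorem. -/
def LHS (G : Subgroup (MulAut (PSL2 F))) : Prop :=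
  ∃ x : ↥G, (x : MulAut (PSL2 F)) ∈ innAut (PSL2 F) ∧ x ≠ 1 ∧ Odd (orderOf x) ∧ IsRationalElement x

/-- The numerical criterion. -/
def Crit (G : Subgroup (MulAut (PSL2 F))) : Prop :=
  ∃ (κ : ℤˣ) (p : ℕ), p.Prime ∧ p ≠ 2 ∧ p ∣ Nat.card (TT F κ) ∧ ∀ k : ℕ, k.Coprime p →
    ∃ g : G, ∃ φ, Ty (g : MulAut (PSL2 F)) 1 φ ∧ ∃ m : ℕ, (∀ τ : TT F κ, frT κ φ τ = τ ^ m) ∧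
      ((p : ℤ) ∣ m - k ∨ (p : ℤ) ∣ m + k)

lemma crit_lhs (hinn : innAut (PSL2 F) ≤ G) (h : Crit G) : LHS G := by
  obtain ⟨κ, p, hp, hp2, hdvd, hk⟩ := h
  haveI := Fact.mk hp
  obtain ⟨τ, hτ⟩ := exists_prime_orderOf_dvd_card' (G := TT F κ) p hdvd
  have hnt : ∀ k : ℕ, k.Coprime p → ¬ (τ ^ k = 1 ∨ τ ^ k = negT κ) := by
    intro k hkp h
    have h2 := (TT_sq (τ := τ ^ k)).2 h
    rw [← pow_mul] at h2
    have h3 := orderOf_dvd_of_pow_eq_one h2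
    rw [hτ] at h3
    have h4 := (Nat.Coprime.dvd_of_dvd_mul_left hkp.symm h3)
    exact hp2 ((Nat.prime_dvd_prime_iff_eq hp Nat.prime_two).1 h4)
  have hs1 : pmk (τ : SL2 F) ≠ 1 := by
    intro h
    rw [← map_one pmk, eq_comm, pmk_eq] at h
    apply hnt 1 (Nat.coprime_one_left p)
    rw [pow_one]
    rcases h with h | h
    · exact Or.inl (Subtype.ext h)
    · exact Or.inr (Subtype.ext h)
  have hsp : pmk (τ : SL2 F) ^ p = 1 := by
    rw [← map_pow, ← Subgroup.coe_pow, ← hτ, pow_orderOf_eq_one]; simp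
  have hso : orderOf (pmk (τ : SL2 F)) = p := orderOf_eq_prime hsp hs1
  have hxo : orderOf (jS hinn (pmk (τ : SL2 F))) = p := by
    rw [orderOf_injective _ (jS_inj hinn), hso]
  refine ⟨jS hinn (pmk (τ : SL2 F)), ⟨_, rfl⟩, ?_, ?_, ?_⟩
  · rw [Ne, map_eq_one_iff _ (jS_inj hinn)]; exact hs1
  · rw [hxo]; exact hp.odd_of_ne_two hp2
  intro y hy
  have hfin : IsOfFinOrder (jS hinn (pmk (τ : SL2 F))) := by
    rw [← orderOf_pos_iff, hxo]; exact hp.pos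
  obtain ⟨k, hky⟩ := (hfin.mem_powers_iff_mem_zpowers).2 (hy ▸ Subgroup.mem_zpowers y)
  have hkp : k.Coprime p := by
    rw [Nat.coprime_comm, hp.coprime_iff_not_dvd]
    rintro ⟨r, rfl⟩
    simp only at hky
    rw [pow_mul, ← hxo, pow_orderOf_eq_one, one_pow] at hky
    rw [← hky] at hy
    have h1 : jS hinn (pmk (τ : SL2 F)) ∈ Subgroup.zpowers (1 : G) := by
      rw [hy]; exact Subgroup.mem_zpowers _
    simp only [Subgroup.zpowers_one_eq_bot, Subgroup.mem_bot] at h1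
    rw [map_eq_one_iff _ (jS_inj hinn)] at h1
    exact hs1 h1
  obtain ⟨g, φ, ⟨P0, hP0⟩, m, hm, hmk⟩ := hk k hkp
  have ht : tr ((τ ^ m : TT F κ) : SL2 F) = tr ((τ ^ k : TT F κ) : SL2 F) := by
    rcases (pow_pm_dvd hτ).2 hmk with h | h
    · rw [h]
    · rw [h, Subgroup.coe_inv, tr_inv]
  have ht1 : tr ((τ ^ m : TT F κ) : SL2 F) ^ 2 ≠ 1 := by
    rw [ht, Ne, TT_tr_sq]; exact hnt k hkp
  obtain ⟨P, hP⟩ := conj_of_tr _ _ ht1 ht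
  have hc : pmk ((τ : SL2 F) ^ k) = pmk (P * P0⁻¹) * cS g (pmk (τ : SL2 F)) * (pmk (P * P0⁻¹))⁻¹ := by
    show _ = _ * (g : MulAut (PSL2 F)) (pmk (τ : SL2 F)) * _
    rw [hP0, del_one, ← frT_coe, hm, ← Subgroup.coe_pow, hP]
    simp only [map_mul, map_inv]
    group
  simp only at hky
  rw [← hky, ← map_pow, ← map_pow, hc]
  exact isConj_jS hinn g _ _

lemma exists_tau (hneg : ¬ IsSquare (-1 : F)) (t : F) : ∃ (κ : ℤˣ) (τ : TT F κ), tr (τ : SL2 F) = t := by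
  by_contra! h
  have := TT_sum_both hneg (fun x => if x = t then (1 : ℂ) else 0)
  simp [h] at this

lemma lhs_crit (hinn : innAut (PSL2 F) ≤ G) (hneg : ¬ IsSquare (-1 : F)) (hall : ∀ g : G, ∃ φ, Ty (g : MulAut (PSL2 F)) 1 φ) (h : LHS G) :
    Crit G := by
  obtain ⟨x, ⟨s, hs⟩, hx1, hodd, hrat⟩ := h
  obtain rfl : jS hinn s = x := Subtype.ext hs
  rw [orderOf_injective _ (jS_inj hinn)] at hodd
  rw [Ne, map_eq_one_iff _ (jS_inj hinn)] at hx1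
  have hn1 : orderOf s ≠ 1 := by rwa [Ne, orderOf_eq_one_iff]
  set p := (orderOf s).minFac with hpdef
  have hp : p.Prime := Nat.minFac_prime hn1
  have hpn : p ∣ orderOf s := Nat.minFac_dvd _
  have hpodd : Odd p := hodd.of_dvd_nat hpn
  have hp2 : p ≠ 2 := by rintro h; rw [h] at hpodd; exact absurd hpodd (by decide)
  haveI := Fact.mk hp
  obtain ⟨r, hr⟩ := hpn
  have hfin : Finite (PSL2 F) := inferInstance
  have hpos : 0 < orderOf s := orderOf_pos s
  have hto : orderOf (s ^ r) = p := by
    have hr0 : r ≠ 0 := by rintro rfl; omega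
    rw [orderOf_pow_of_dvd hr0 ⟨p, by rw [hr, mul_comm]⟩, hr]
    exact Nat.mul_div_cancel _ (Nat.pos_of_ne_zero hr0)
  have hk1 : ∀ k : ℕ, k.Coprime p → ∃ g : G, cS g (s ^ r) = (s ^ r) ^ k := by
    intro k hk
    obtain ⟨k', hk', z, hz⟩ := exists_lift_coprime hpos ⟨r, hr⟩ hk
    have hgen : Subgroup.zpowers (jS hinn s ^ k') = Subgroup.zpowers (jS hinn s) := by
      apply le_antisymm
      · rw [Subgroup.zpowers_le]; exact Subgroup.npow_mem_zpowers _ _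
      · rw [Subgroup.zpowers_le, mem_zpowers_pow_iff, orderOf_injective _ (jS_inj hinn)]
        exact hk'
    obtain ⟨g, hg⟩ := of_isConj_jS hinn (a := s) (b := s ^ k') (by have := hrat _ hgen; rwa [← map_pow] at this)
    refine ⟨g, ?_⟩
    rw [map_pow, hg, ← pow_mul, mul_comm, pow_mul, ← zpow_natCast, hz, zpow_add, zpow_mul, zpow_natCast,
      zpow_natCast, ← hto, pow_orderOf_eq_one, one_zpow, mul_one]
  clear hrat
  generalize s ^ r = t at hto hk1
  have ht1 : t ≠ 1 := by
    rintro rfl; rw [orderOf_one] at hto; exact hp.one_lt.ne hto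
  have htp : t ^ p = 1 := by rw [← hto]; exact pow_orderOf_eq_one t
  obtain ⟨A, hA, hAp⟩ : ∃ A : SL2 F, pmk A = t ∧ A ^ p = 1 := by
    obtain ⟨A, rfl⟩ := pmk_surj t
    rw [← map_pow, ← map_one pmk, eq_comm, pmk_eq] at htp
    rcases htp with h | h
    · exact ⟨A, rfl, h⟩
    · exact ⟨-A, pmk_neg A, by rw [hpodd.neg_pow, h, neg_neg]⟩
  by_cases htr : tr A ^ 2 = 1
  · exfalso
    obtain ⟨P, e, hPe⟩ := unip_psl hneg A (by rwa [hA]) htr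
    rw [hA] at hPe
    have h3 : t ^ 3 = 1 := by
      rw [hPe, ← map_pow, conj_pow, pow_succ, pow_two, uu_mul, uu_mul]
      have : ((e : ℤ) : F) + (e : ℤ) + (e : ℤ) = 0 := by
        have := CharP.cast_eq_zero F 3
        push_cast at this
        linear_combination ((e : ℤ) : F) * this
      rw [this, uu_zero]; simp
    have hp3 : p = 3 := by
      have := orderOf_dvd_of_pow_eq_one h3
      rw [hto] at this
      exact (Nat.prime_dvd_prime_iff_eq hp Nat.prime_three).1 this
    obtain ⟨g, hg⟩ := hk1 2 (by rw [hp3]; decide)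
    obtain ⟨φ, Q, hQ⟩ := hall g
    have hg' : (g : MulAut (PSL2 F)) t = t ^ 2 := hg
    rw [hPe, hQ, ← map_pow, conj_pow, pow_two, uu_mul, del_one] at hg'
    have h2 : ((e : ℤ) : F) + (e : ℤ) = -(e : ℤ) := by
      have := CharP.cast_eq_zero F 3
      push_cast at this
      linear_combination ((e : ℤ) : F) * this
    rw [h2, map_mul (fr φ), map_mul (fr φ), fr_uu, map_intCast, map_inv (fr φ)] at hg'
    have key : pmk (P⁻¹ * Q * fr φ P) * pmk (uu ((e : ℤ) : F)) = pmk (uu (-((e : ℤ) : F))) * pmk (P⁻¹ * Q * fr φ P) := by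
      have := congrArg (fun z => pmk P⁻¹ * z * pmk (Q * fr φ P)) hg'
      simp only [← map_mul] at this ⊢
      convert this using 2 <;> group
    have he0 : ((e : ℤ) : F) ≠ 0 := kF_ne e
    have := norm_u _ he0 key
    apply hneg
    refine ⟨(P⁻¹ * Q * fr φ P) 0 0, ?_⟩
    have h5 := mul_right_cancel₀ he0 ((neg_one_mul ((e : ℤ) : F)).trans this)
    rw [h5]; ring
  · obtain ⟨κ, τ, hτ⟩ := exists_tau hneg (tr A)
    obtain ⟨P, hP⟩ := conj_of_tr (τ : SL2 F) A (by rwa [hτ]) hτ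
    have hτp : τ ^ p = 1 := by
      apply Subtype.ext
      rw [hP, conj_pow, mul_inv_eq_one, mul_eq_left] at hAp
      exact hAp
    have hτ1 : τ ≠ 1 := by
      rintro rfl
      apply ht1
      rw [← hA, hP]; simp
    have hτo : orderOf τ = p := orderOf_eq_prime hτp hτ1
    refine ⟨κ, p, hp, hp2, hτo ▸ orderOf_dvd_natCard τ, fun k hk => ?_⟩
    obtain ⟨g, hg⟩ := hk1 k hk
    obtain ⟨φ, hφ⟩ := hall g
    obtain ⟨m, hm⟩ := frT_pow κ φ
    refine ⟨g, φ, hφ, m, hm, ?_⟩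
    rw [← pow_pm_dvd hτo]
    apply TT_same_tr
    obtain ⟨Q, hQ⟩ := hφ
    have hg' : (g : MulAut (PSL2 F)) t = t ^ k := hg
    rw [← hA, hQ, ← map_pow, pmk_eq, del_one] at hg'
    have h1 : (Q * fr φ A * Q⁻¹) ^ p = 1 := by
      rw [conj_pow, ← map_pow, hAp]; simp
    have h2 : A ^ k = Q * fr φ A * Q⁻¹ := by
      rcases hg' with h | h
      · exact h
      · exfalso
        have := congrArg (fun z => z ^ p) h
        simp only [hpodd.neg_pow, h1] at this
        rw [← pow_mul, mul_comm, pow_mul, hAp, one_pow] at this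
        exact neg_one_sl_ne this.symm
    rw [← hm, frT_coe, tr_fr, hτ, ← tr_fr, ← tr_conj Q, ← h2, hP, conj_pow, tr_conj]
    rfl
end Setup

end PartP7a

section PartP7b

section Case2
variable {F : Type} [Field F] [CharP F 3] [Fintype F] [DecidableEq F]
variable {G : Subgroup (MulAut (PSL2 F))} 

/-- The right hand side of the theorem. -/
def RHS (G : Subgroup (MulAut (PSL2 F))) : Prop :=
  ∃ V : FDRep ℂ ↥G, Simple V ∧ (∀ g : ↥G, ∃ q : ℚ, V.character g = (q : ℂ)) ∧
    Even (Module.finrank ℂ V) ∧ ∃ g : ↥G, (g : MulAut (PSL2 F)) ∈ innAut (PSL2 F) ∧ V.character g ≠ V.character 1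

lemma hcomm2 (hinn : innAut (PSL2 F) ≤ G) (hall : ∀ g : G, ∃ φ, Ty (g : MulAut (PSL2 F)) 1 φ) (g h : G) :
    ∃ s, jS hinn s = g * h * g⁻¹ * h⁻¹ := by
  obtain ⟨φ, hφ⟩ := hall g
  obtain ⟨ψ, hψ⟩ := hall h
  apply jS_of_Ty
  have := ((hφ.mul hψ).mul hφ.inv).mul hψ.inv
  rw [aut_comm φ ψ] at this
  simpa using this

lemma hpow2 (hinn : innAut (PSL2 F) ≤ G) (hall : ∀ g : G, ∃ φ, Ty (g : MulAut (PSL2 F)) 1 φ)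
    {f : ℕ} (hF : Fintype.card F = 3 ^ f) (g : G) : ∃ s, jS hinn s = g ^ f := by
  obtain ⟨φ, hφ⟩ := hall g
  apply jS_of_Ty
  have := hφ.pow f
  rw [aut_pow hF] at this
  simpa using this

lemma deg_even (hq : Fintype.card F % 8 = 3) (κ : ℤˣ) :
    ∃ d : ℕ, ((Fintype.card F : ℂ) + ((κ : ℤ) : ℂ)) = d ∧ Even d := by
  rcases Int.units_eq_one_or κ with rfl | rfl
  · exact ⟨Fintype.card F + 1, by simp, by rw [Nat.even_iff]; omega⟩
  · refine ⟨Fintype.card F - 1, ?_, by rw [Nat.even_iff]; omega⟩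
    rw [Nat.cast_sub (by omega)]; simp [sub_eq_add_neg]

lemma push_inv (κ : ℤˣ) (θ : TT F κ →* ℂ) (hθ : θ (negT κ) = 1) (s : PSL2 F) :
    push (RR κ θ) s⁻¹ = push (RR κ θ) s := by
  obtain ⟨A, rfl⟩ := pmk_surj s
  rw [← map_inv, push_pmk (RR_even κ θ hθ).ev, push_pmk (RR_even κ θ hθ).ev, RR_inv]

lemma theta_inv {T : Type} [Group T] (θ : T →* ℂ) (t : T) : θ t⁻¹ = (θ t)⁻¹ := by
  apply eq_inv_of_mul_eq_one_left
  rw [← map_mul, inv_mul_cancel, map_one]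

lemma crit_rhs [Fintype G] (hinn : innAut (PSL2 F) ≤ G) (hall : ∀ g : G, ∃ φ, Ty (g : MulAut (PSL2 F)) 1 φ)
    {f : ℕ} (hf : Odd f) (hF : Fintype.card F = 3 ^ f) (h : Crit G) : RHS G := by
  have hq := q_mod hf hF
  have hneg := hneg_of hq
  obtain ⟨κ, p, hp, hp2, hdvd, hk⟩ := h
  obtain ⟨g0, θ, hg0, hprim⟩ := exists_hom (TT F κ) hdvd
  have hpodd := hp.odd_of_ne_two hp2
  have hgen : ∀ τ : TT F κ, ∃ i : ℕ, g0 ^ i = τ := fun τ => mem_powers_iff_mem_zpowers.2 (hg0 τ)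
  have hθ : θ (negT κ) = 1 := by
    rcases theta_neg θ with h | h
    · exact h
    · obtain ⟨i, hi⟩ := hgen (negT κ)
      exfalso
      have h1 : θ (negT κ) ^ p = 1 := by
        rw [← hi, map_pow, ← pow_mul, mul_comm, pow_mul, hprim.pow_eq_one, one_pow]
      rw [h, hpodd.neg_one_pow] at h1
      norm_num at h1
  have hθ2 : ∃ τ, θ τ ^ 2 ≠ 1 := by
    refine ⟨g0, fun h => hp2 ?_⟩
    exact (Nat.prime_dvd_prime_iff_eq hp Nat.prime_two).1 (hprim.dvd_of_pow_eq_one 2 h)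
  have hirr := RR_irr hneg κ θ hθ hθ2
  obtain ⟨d, hd, hev⟩ := deg_even hq κ
  have hz0 : θ g0 ≠ 0 := hprim.ne_zero hp.ne_zero
  obtain ⟨V, hV, hVq, hVe, hVi⟩ := descend (jS hinn) cS (jS_cS hinn) (jS_inj hinn) hf (hcomm2 hinn hall)
    (hpow2 hinn hall hF) hirr (push_inv κ θ hθ) (by
      intro σ
      have hs : IsPrimitiveRoot (σ (θ g0)) p := hprim.map_of_injective σ.injective
      obtain ⟨k, -, hkp, hkz⟩ := (@IsPrimitiveRoot.isPrimitiveRoot_iff _ _ _ p ⟨hp.ne_zero⟩ _ _ hprim).1 hs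
      obtain ⟨g, φ, hφ, m, hm, hmk⟩ := hk k hkp
      refine ⟨g, fun s => ?_⟩
      obtain ⟨X, rfl⟩ := pmk_surj s
      refine Eq.trans ?_ (RR_Ty κ θ hθ hφ X).symm
      rw [push_pmk (RR_even κ θ hθ).ev, RR_gal]
      rcases hmk with h | h
      · congr 1
        refine hom_ext_gen hg0 ?_
        rw [galT_apply, MonoidHom.comp_apply, hm, map_pow, ← hkz]
        rw [← hprim.zpow_eq_one_iff_dvd, zpow_sub₀ hz0, div_eq_one_iff_eq (zpow_ne_zero _ hz0)] at h
        simpa using h.symm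
      · apply RR_theta_inv
        intro τ
        obtain ⟨i, rfl⟩ := hgen τ
        rw [galT_apply, MonoidHom.comp_apply, hm, map_pow, map_pow, map_pow, theta_inv, map_pow, ← hkz]
        rw [← hprim.zpow_eq_one_iff_dvd, zpow_add₀ hz0, zpow_natCast, zpow_natCast] at h
        rw [eq_inv_of_mul_eq_one_right h, inv_pow, inv_pow, ← pow_mul, ← pow_mul, mul_comm])
    ((push_one κ θ hθ).trans hd) hev
  refine ⟨V, hV, hVq, hVe, ?_⟩
  obtain ⟨s, hs⟩ := not_const hirr (by
    intro h1
    have h2 := congrFun h1 1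
    rw [push_one κ θ hθ, hd] at h2
    have : d = 1 := by exact_mod_cast h2
    rw [this] at hev
    exact absurd hev (by decide)) hVi
  refine ⟨jS hinn s, ⟨s, rfl⟩, ?_⟩
  simpa using hs

lemma rhs_crit [Fintype G] (hinn : innAut (PSL2 F) ≤ G) (hall : ∀ g : G, ∃ φ, Ty (g : MulAut (PSL2 F)) 1 φ)
    {f : ℕ} (hf : Odd f) (hF : Fintype.card F = 3 ^ f) (h : RHS G) : Crit G := by
  have hq := q_mod hf hF
  have hneg := hneg_of hq
  obtain ⟨V, hV, hVq, hVe, -⟩ := h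
  have hψ : IsIrr V.character := ⟨V, hV, rfl⟩
  have hres : IsChar (fun s => V.character (jS hinn s)) := hψ.isChar.comp (jS hinn)
  obtain ⟨χ, hχ, hχψ⟩ : ∃ χ, IsIrr χ ∧ ip χ (fun s => V.character (jS hinn s)) ≠ 0 := by
    by_contra! hcon
    have h0 := irr_complete hres.classFn (fun χ hχ => by rw [ip_comm]; exact hcon χ hχ)
    have h1 := congrFun h0 1
    obtain ⟨n, hn, hn1⟩ := hψ.one_pos
    simp only [map_one, hn1, Pi.zero_apply, Nat.cast_eq_zero] at h1
    omega
  obtain ⟨e, -, he⟩ := hχ.one_pos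
  have heven := parityW (jS hinn) cS (jS_cS hinn) (jS_inj hinn) hf (hcomm2 hinn hall)
    (hpow2 hinn hall hF) hψ hχ hχψ V.char_one he hVe
  obtain ⟨κ, θ, hθ, hθ2, rfl⟩ := even_irr hq hχ he heven
  obtain ⟨g0, hg0⟩ := IsCyclic.exists_generator (α := TT F κ)
  have hgen : ∀ τ : TT F κ, ∃ i : ℕ, g0 ^ i = τ := fun τ => mem_powers_iff_mem_zpowers.2 (hg0 τ)
  have ho : orderOf g0 = Nat.card (TT F κ) := orderOf_eq_card_of_forall_mem_zpowers hg0
  obtain ⟨c, hc, hc4⟩ : ∃ c, Nat.card (TT F κ) = 2 * c ∧ c % 4 ≠ 0 := by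
    rcases Int.units_eq_one_or κ with rfl | rfl
    · have := card_TT1 hneg
      exact ⟨Nat.card (TT F 1) / 2, by omega, by omega⟩
    · have := card_TTn hneg
      exact ⟨Nat.card (TT F (-1)) / 2, by omega, by omega⟩
  have hcn : g0 ^ c = negT κ := by
    have h1 : (g0 ^ c) ^ 2 = 1 := by
      rw [← pow_mul, mul_comm, ← hc, ← ho, pow_orderOf_eq_one]
    rcases TT_sq.1 h1 with h | h
    · exfalso
      have := orderOf_dvd_of_pow_eq_one h
      rw [ho, hc] at this
      have := Nat.le_of_dvd (by omega) this
      omega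
    · exact h
  set ζ := θ g0 with hζ
  have hζc : ζ ^ c = 1 := by rw [hζ, ← map_pow, hcn, hθ]
  set n := orderOf ζ with hn
  have hprim : IsPrimitiveRoot ζ n := IsPrimitiveRoot.orderOf ζ
  have hnc : n ∣ c := orderOf_dvd_of_pow_eq_one hζc
  have hn0 : 0 < n := Nat.pos_of_dvd_of_pos hnc (by omega)
  have hn2 : ¬ n ∣ 2 := by
    intro h
    obtain ⟨τ, hτ⟩ := hθ2
    obtain ⟨i, rfl⟩ := hgen τ
    apply hτ
    rw [map_pow, ← pow_mul, mul_comm, pow_mul, orderOf_dvd_iff_pow_eq_one.1 h, one_pow]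
  obtain ⟨p, hp, hpn, hpodd⟩ : ∃ p, p.Prime ∧ p ∣ n ∧ Odd p := by
    rcases Nat.eq_two_pow_or_exists_odd_prime_and_dvd n with ⟨k, hk⟩ | h
    · exfalso
      rcases k with _ | _ | k
      · exact hn2 (by rw [hk]; decide)
      · exact hn2 (by rw [hk]; decide)
      · have : 4 ∣ c := dvd_trans ⟨2 ^ k, by rw [hk]; ring⟩ hnc
        omega
    · exact h
  have hp2 : p ≠ 2 := by rintro rfl; exact absurd hpodd (by decide)
  refine ⟨κ, p, hp, hp2, hpn.trans (hnc.trans ⟨2, by rw [hc, mul_comm]⟩), fun k hk => ?_⟩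
  obtain ⟨k', hk', z, hz⟩ := exists_lift_coprime hn0 hpn hk
  obtain ⟨σ, hσ⟩ := exists_aut_root_of_unity hn0 hk' hprim
  obtain ⟨g, hg⟩ := clifford (jS hinn) cS hχ (hχ.galois σ) hψ (jS_inj hinn) (jS_cS hinn) hχψ (by
    have h1 : (fun s => V.character (jS hinn s)) = σ ∘ (fun s => V.character (jS hinn s)) := by
      funext s
      obtain ⟨q, hq⟩ := hVq (jS hinn s)
      simp [hq]
    rw [h1]
    have h2 := ip_galois (push (RR κ θ)) (fun s => V.character (jS hinn s)) σ
    intro h3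
    apply hχψ
    apply σ.injective
    rw [map_zero, ← h2]
    exact h3)
  obtain ⟨φ, hφ⟩ := hall g
  obtain ⟨m, hm⟩ := frT_pow κ φ
  refine ⟨g, φ, hφ, m, hm, ?_⟩
  have h1 := (congrFun hg (pmk (g0 : SL2 F))).trans (RR_Ty κ θ hθ hφ g0)
  have h2 : σ (RR κ θ g0) = RR κ (θ.comp (frT κ φ)) g0 := by
    rw [← h1]; simp [push_pmk (RR_even κ θ hθ).ev]
  have hθ' : galT σ θ (negT κ) = 1 := by rw [galT_apply, hθ, map_one]
  have hθ'' : (θ.comp (frT κ φ)) (negT κ) = 1 := by rw [MonoidHom.comp_apply, frT_negT, hθ]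
  rw [RR_gal, RR_res_same hneg κ _ hθ', RR_res_same hneg κ _ hθ'', theta_inv, theta_inv, galT_apply,
    MonoidHom.comp_apply, hm, map_pow, ← hζ, hσ] at h2
  have hκ : ((κ : ℤ) : ℂ) ≠ 0 := by exact_mod_cast κ.ne_zero
  have h3 := mul_left_cancel₀ hκ (add_right_cancel h2)
  have hz0 : ζ ≠ 0 := hprim.ne_zero hn0.ne'
  have ha : ζ ^ k' ≠ 0 := pow_ne_zero _ hz0
  have hb : ζ ^ m ≠ 0 := pow_ne_zero _ hz0
  have h4 : (ζ ^ k' - ζ ^ m) * (ζ ^ k' * ζ ^ m - 1) = 0 := by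
    field_simp at h3
    linear_combination h3
  rcases mul_eq_zero.1 h4 with h | h
  · left
    have h5 : ζ ^ ((m : ℤ) - k') = 1 := by
      rw [zpow_sub₀ hz0, div_eq_one_iff_eq (zpow_ne_zero _ hz0), zpow_natCast, zpow_natCast]
      exact (sub_eq_zero.1 h).symm
    have h6 := (Int.natCast_dvd_natCast.2 hpn).trans ((hprim.zpow_eq_one_iff_dvd _).1 h5)
    rw [hz] at h6
    obtain ⟨w, hw⟩ := h6
    exact ⟨w + z, by linear_combination hw⟩
  · right
    have h5 : ζ ^ ((m : ℤ) + k') = 1 := by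
      rw [zpow_add₀ hz0, zpow_natCast, zpow_natCast]
      linear_combination h
    have h6 := (Int.natCast_dvd_natCast.2 hpn).trans ((hprim.zpow_eq_one_iff_dvd _).1 h5)
    rw [hz] at h6
    obtain ⟨w, hw⟩ := h6
    exact ⟨w - z, by linear_combination hw⟩
end Case2

end PartP7b

section PartP8

section Case1
variable {F : Type} [Field F] [CharP F 3] [Fintype F] [DecidableEq F]
variable {G : Subgroup (MulAut (PSL2 F))}

lemma exists_g0 (hinn : innAut (PSL2 F) ≤ G) {f : ℕ} (hf : Odd f) (hF : Fintype.card F = 3 ^ f)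
    {g1 : G} {φ} (h : Ty (g1 : MulAut (PSL2 F)) (-1) φ) : ∃ g0 : G, ∀ X : SL2 F, cS g0 (pmk X) = pmk (del (-1) X) := by
  have h1 := h.pow f
  rw [aut_pow hF, hf.neg_one_pow] at h1
  obtain ⟨P, hP⟩ := h1
  refine ⟨(jS hinn (pmk P))⁻¹ * g1 ^ f, fun X => ?_⟩
  show (MulAut.conj (pmk P))⁻¹ (((g1 : MulAut (PSL2 F)) ^ f) (pmk X)) = _
  rw [hP, fr_one, MulAut.conj_inv_apply]
  simp only [map_mul, map_inv]
  group

lemma g0_Ty {g0 : G} (hg0 : ∀ X : SL2 F, cS g0 (pmk X) = pmk (del (-1) X)) : Ty (g0 : MulAut (PSL2 F)) (-1) 1 := by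
  refine ⟨1, fun X => ?_⟩
  rw [fr_one]
  refine (hg0 X).trans ?_
  simp

lemma case1_lhs (hinn : innAut (PSL2 F) ≤ G) {g0 : G} (hg0 : ∀ X : SL2 F, cS g0 (pmk X) = pmk (del (-1) X)) :
    LHS G := by
  have hneg1 : cS g0 (pmk (uu (1 : F))) = pmk (uu (-1)) := by
    rw [hg0, del_uu]; simp
  have h3 : pmk (uu (1 : F)) ^ 3 = 1 := by
    rw [← map_pow, pow_succ, pow_two, uu_mul, uu_mul]
    have : (1 : F) + 1 + 1 = 0 := by
      have := CharP.cast_eq_zero F 3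
      push_cast at this
      linear_combination this
    rw [this, uu_zero, map_one]
  have hne : pmk (uu (1 : F)) ≠ 1 := by
    intro h
    have : (1 : F) = 0 := pmk_uu_inj (by rw [h, uu_zero, map_one])
    exact one_ne_zero this
  have hinv : (pmk (uu (1 : F)))⁻¹ = pmk (uu (-1)) := by
    rw [inv_eq_iff_mul_eq_one, ← map_mul, uu_mul, add_neg_cancel, uu_zero, map_one]
  have hxo : orderOf (jS hinn (pmk (uu (1 : F)))) = 3 := by
    rw [orderOf_injective _ (jS_inj hinn), orderOf_eq_prime h3 hne]
  have hx1 : jS hinn (pmk (uu (1 : F))) ≠ 1 := by rwa [Ne, map_eq_one_iff _ (jS_inj hinn)]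
  refine ⟨jS hinn (pmk (uu (1 : F))), ⟨_, rfl⟩, hx1, ?_, ?_⟩
  · rw [hxo]; decide
  intro y hy
  have hfin : IsOfFinOrder (jS hinn (pmk (uu (1 : F)))) := by
    rw [← orderOf_pos_iff, hxo]; norm_num
  obtain ⟨k, hky⟩ := (hfin.mem_powers_iff_mem_zpowers).2 (hy ▸ Subgroup.mem_zpowers y)
  simp only at hky
  rw [← pow_mod_orderOf, hxo] at hky
  have hk3 : k % 3 < 3 := Nat.mod_lt _ (by norm_num)
  interval_cases hk : k % 3
  · exfalso
    rw [pow_zero] at hky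
    rw [← hky] at hy
    have h1 : jS hinn (pmk (uu (1 : F))) ∈ Subgroup.zpowers (1 : G) := by
      rw [hy]; exact Subgroup.mem_zpowers _
    simp only [Subgroup.zpowers_one_eq_bot, Subgroup.mem_bot] at h1
    exact hx1 h1
  · rw [← hky, pow_one]
  · have h2 : pmk (uu (1 : F)) ^ 2 = (pmk (uu (1 : F)))⁻¹ := by
      rw [eq_inv_iff_mul_eq_one, ← pow_succ, h3]
    rw [← hky, ← map_pow, h2, hinv]
    have := isConj_jS hinn g0 1 (pmk (uu (1 : F)))
    rwa [hneg1, one_mul, inv_one, mul_one] at this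

/-- inner-diagonal part -/
def NN (G : Subgroup (MulAut (PSL2 F))) : Subgroup G where
  carrier := {g | ∃ e, Ty (g : MulAut (PSL2 F)) e 1}
  one_mem' := ⟨1, by
    have := Ty.conj (1 : SL2 F)
    simpa using this⟩
  mul_mem' := by
    rintro a b ⟨e, h⟩ ⟨e', h'⟩
    exact ⟨e * e', by simpa using h.mul h'⟩
  inv_mem' := by
    rintro a ⟨e, h⟩
    exact ⟨e, by simpa using h.inv⟩

lemma mem_NN {g : G} : g ∈ NN G ↔ ∃ e, Ty (g : MulAut (PSL2 F)) e 1 := Iff.rfl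

lemma push_Ty (κ : ℤˣ) (θ : TT F κ →* ℂ) (hθ : θ (negT κ) = 1) {α : MulAut (PSL2 F)} {e} (h : Ty α e 1) (s) :
    push (RR κ θ) (α s) = push (RR κ θ) s := by
  obtain ⟨X, rfl⟩ := pmk_surj s
  rw [RR_Ty κ θ hθ h, frT_one, push_pmk (RR_even κ θ hθ).ev]
  rfl

lemma exists_moved (hneg : ¬ IsSquare (-1 : F)) {g0 : G} (hg0 : ∀ X : SL2 F, cS g0 (pmk X) = pmk (del (-1) X)) :
    ∃ χ : PSL2 F → ℂ, IsIrr χ ∧ (fun s => χ (cS g0 s)) ≠ χ := by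
  classical
  by_contra! hcon
  let δ : PSL2 F → ℂ := fun s => if IsConj (pmk (uu (1 : F))) s then 1 else 0
  have hδ : IsClassFn δ := by
    intro g h
    have : IsConj (pmk (uu (1 : F))) (h * g * h⁻¹) ↔ IsConj (pmk (uu (1 : F))) g := by
      have h1 : IsConj g (h * g * h⁻¹) := isConj_iff.2 ⟨h, rfl⟩
      exact ⟨fun h2 => h2.trans h1.symm, fun h2 => h2.trans h1⟩
    simp only [δ, this]
  have h1 : δ (cS g0 (pmk (uu 1))) = δ (pmk (uu 1)) := by
    rw [expand hδ, Finset.sum_apply, Finset.sum_apply]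
    refine Finset.sum_congr rfl (fun χ hχ => ?_)
    have := congrFun (hcon χ (mem_irrF.1 hχ)) (pmk (uu 1))
    simp only [Pi.smul_apply, this]
  rw [hg0, del_uu] at h1
  have h2 : ¬ IsConj (pmk (uu (1 : F))) (pmk (uu (((-1 : ℤˣ) : ℤ) * 1))) := by
    intro h
    obtain ⟨c, hc⟩ := isConj_iff.1 h
    obtain ⟨P, rfl⟩ := pmk_surj c
    apply not_conj_one hneg P
    rw [hc]; simp
  simp only [δ, h2, if_false, IsConj.refl, if_true] at h1
  exact zero_ne_one h1

lemma case1_rhs [Fintype G] (hinn : innAut (PSL2 F) ≤ G)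
    {f : ℕ} (hf : Odd f) (hF : Fintype.card F = 3 ^ f)
    {g0 : G} (hg0 : ∀ X : SL2 F, cS g0 (pmk X) = pmk (del (-1) X)) : RHS G := by
  classical
  have hq := q_mod hf hF
  have hneg := hneg_of hq
  have hT := g0_Ty hg0
  have hall : ∀ g : G, ∃ e φ, Ty (g : MulAut (PSL2 F)) e φ := fun g => aut2 hneg _
  obtain ⟨χ, hχ, hmov⟩ := exists_moved hneg hg0
  obtain ⟨l, hl1, hl2, hl0, hl3⟩ := exists_lam (F := F) hq
  set χ' : PSL2 F → ℂ := fun s => χ (cS g0 s) with hχ'def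
  have hχ' : IsIrr χ' := hχ.comp_equiv (cS g0)
  have hB : ∀ B : PSL2 F → ℂ, (∀ s, B (cS g0 s) = B s) → χ ≠ B ∧ χ' ≠ B := by
    intro B hB
    constructor
    · rintro rfl
      exact hmov (funext hB)
    · intro h
      have : χ = B := by
        funext s
        obtain ⟨t, rfl⟩ := (cS g0).surjective s
        rw [hB]
        exact congrFun h t
      apply hmov
      exact h.trans this.symm
  have hRR : ∀ (κ : ℤˣ) (θ : TT F κ →* ℂ) (hθ : θ (negT κ) = 1) s, push (RR κ θ) (cS g0 s) = push (RR κ θ) s :=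
    fun κ θ hθ s => push_Ty κ θ hθ hT s
  have hone := hB (fun _ => 1) (fun _ => rfl)
  have hSt := hB (St F) (fun s => by
    have := hRR 1 1 rfl s
    simp only [St, Pi.sub_apply, this])
  have d1 := (dichotomy hq hl1 hl2 hl3 hχ hone.1 hSt.1 (fun κ θ hθ _ => (hB _ (hRR κ θ hθ)).1)).2
  have d2 := (dichotomy hq hl1 hl2 hl3 hχ' hone.2 hSt.2 (fun κ θ hθ _ => (hB _ (hRR κ θ hθ)).2)).2
  have dn := RR_norm_two hneg (-1) l hl1 hl2
  have hinteg := @int_RR F _ _ _ _ hneg (-1) l hl1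
  have hQc : IsClassFn (push (RR (-1) l)) := push_class (RR_even (-1) l hl1)
  have hQ1 := push_one (-1) l hl1
  have hQinv := push_inv (-1) l hl1
  have hQgal : ∀ (σ : ℂ ≃+* ℂ) s, σ (push (RR (-1) l) s) = push (RR (-1) l) s := by
    intro σ s
    obtain ⟨X, rfl⟩ := pmk_surj s
    rw [push_pmk (RR_even (-1) l hl1).ev, RR_gal]
    congr 1
    ext τ
    rw [galT_apply]
    rcases (sq_eq_one_iff.1 (hl2 τ)) with h | h
    · rw [h, map_one]
    · rw [h, map_neg, map_one]
  generalize push (RR (-1) l) = Q at *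
  have hne : χ ≠ χ' := fun h => hmov h.symm
  have hQ : Q = χ + χ' := by
    have h0 := ip_norm_zero (f := Q - (χ + χ')) (hQc.sub (hχ.isChar.classFn.add hχ'.isChar.classFn)) (by
      intro ψ hψ
      obtain ⟨a, ha⟩ := hinteg hψ.isChar
      obtain ⟨b, hb⟩ := ip_nat hχ.isChar hψ.isChar
      obtain ⟨c, hc⟩ := ip_nat hχ'.isChar hψ.isChar
      refine ⟨a - (b + c), ?_⟩
      rw [ip_sub_left, ip_add_left, ha, hb, hc]
      push_cast; ring) (by
      rw [ip_sub_left, ip_add_left, ip_sub_right, ip_sub_right, ip_sub_right, ip_add_right, ip_add_right, ip_add_right,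
        dn, d1, d2, ip_comm χ Q, d1, ip_comm χ' Q, d2, hχ.ip_self, hχ'.ip_self, hχ.ip_ne hχ' hne,
        hχ'.ip_ne hχ hne.symm]
      ring)
    exact sub_eq_zero.1 h0
  -- the normal subgroup
  letI : Fintype (NN G) := Fintype.ofFinite _
  haveI hN : (NN G).Normal := ⟨by
    rintro n ⟨e, hn⟩ g
    obtain ⟨e', φ, hg⟩ := hall g
    refine ⟨e' * e * e', ?_⟩
    have := (hg.mul hn).mul hg.inv
    simpa using this⟩
  let jN : PSL2 F →* NN G := (jS hinn).codRestrict (NN G) (fun s => by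
    obtain ⟨P, rfl⟩ := pmk_surj s
    exact ⟨1, Ty.conj P⟩)
  have hjN : Function.Injective jN := by
    intro s t h
    exact jS_inj hinn (congrArg Subtype.val h)
  let cN : NN G → PSL2 F ≃* PSL2 F := fun n => cS (n : G)
  have hcN : ∀ n s, jN (cN n s) = n * jN s * n⁻¹ := fun n s => Subtype.ext (jS_cS hinn n s)
  let n0 : NN G := ⟨g0, -1, hT⟩
  have hbij : Function.Bijective (Sum.elim jN (fun s => n0 * jN s) : PSL2 F ⊕ PSL2 F → NN G) := by
    have hno : ∀ s t, jN s ≠ n0 * jN t := by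
      intro s t h
      have h1 : n0 = jN (s * t⁻¹) := by rw [map_mul, map_inv, h]; group
      obtain ⟨P, hP⟩ := pmk_surj (s * t⁻¹)
      have h2 : (g0 : MulAut (PSL2 F)) = MulAut.conj (pmk P) := by
        rw [hP]
        exact congrArg (fun z : NN G => ((z : G) : MulAut (PSL2 F))) h1
      exact Ty_neg_not_inn hneg hT (h2 ▸ Ty.conj P)
    constructor
    · rintro (s | s) (t | t) h
      · exact congrArg _ (hjN h)
      · exact absurd h (hno s t)
      · exact absurd h.symm (hno t s)
      · exact congrArg _ (hjN (mul_left_cancel h))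
    · rintro ⟨n, e, hn⟩
      rcases Int.units_eq_one_or e with rfl | rfl
      · obtain ⟨s, hs⟩ := jS_of_Ty hinn hn
        exact ⟨Sum.inl s, Subtype.ext hs⟩
      · have h1 := hT.inv.mul hn
        obtain ⟨s, hs⟩ := jS_of_Ty hinn (g := g0⁻¹ * n) (by simpa using h1)
        refine ⟨Sum.inr s, Subtype.ext ?_⟩
        show g0 * jS hinn s = n
        rw [hs]; group
  have hηS : ∀ s, ind jN χ (jN s) = Q s := by
    intro s
    rw [ind_res jN cN χ hjN hcN, ← hbij.sum_comp, Fintype.sum_sum_type]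
    have e1 : ∀ t, χ (cN (jN t) s) = χ s := by
      intro t
      exact hχ.isChar.classFn s t
    have e2 : ∀ t, χ (cN (n0 * jN t) s) = χ' s := by
      intro t
      exact hχ'.isChar.classFn s t
    simp only [Sum.elim_inl, Sum.elim_inr, e1, e2, Finset.sum_const, Finset.card_univ, nsmul_eq_mul, hQ, Pi.add_apply]
    rw [← Nat.card_eq_fintype_card, ← mul_add, inv_mul_cancel_left₀ (card_ne _)]
  have hη0 : ∀ n, (¬ ∃ s, jN s = n) → ind jN χ n = 0 := by
    intro n hn
    unfold ind
    rw [Finset.sum_eq_zero, mul_zero]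
    intro g _
    apply Finset.sum_eq_zero
    intro s _
    rw [if_neg]
    intro h
    apply hn
    refine ⟨cN g⁻¹ s, ?_⟩
    rw [hcN, h]; group
  have hηc := ind_classFn jN χ
  have hηηS : (fun s => ind jN χ (jN s)) = Q := funext hηS
  obtain ⟨d, hd, hev⟩ := deg_even hq (-1)
  have hη1 : ind jN χ 1 = d := by
    rw [← map_one jN, hηS, hQ1, hd]
  have hηirr : IsIrr (ind jN χ) := by
    apply norm_one_pos hηc
    · intro ψ hψ
      rw [frob jN χ hψ.isChar.classFn]
      obtain ⟨n, hn⟩ := ip_nat hχ.isChar (hψ.isChar.comp jN)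
      exact ⟨n, by rw [hn]; simp⟩
    · rw [frob jN χ hηc, hηηS, ip_comm, d1]
    · exact ⟨d, hη1⟩
  obtain ⟨V, hV, hVq, hVe, hVi⟩ := descend (NN G).subtype (fun g => MulAut.conjNormal g)
    (fun g n => by simp) (NN G).subtype_injective hf
    (fun g h => by
      obtain ⟨e, φ, hφ⟩ := hall g
      obtain ⟨e', ψ, hψ⟩ := hall h
      refine ⟨⟨g * h * g⁻¹ * h⁻¹, e * e' * e * e', ?_⟩, rfl⟩
      have := ((hφ.mul hψ).mul hφ.inv).mul hψ.inv
      rw [aut_comm φ ψ] at this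
      simpa using this)
    (fun g => by
      obtain ⟨e, φ, hφ⟩ := hall g
      refine ⟨⟨g ^ f, e ^ f, ?_⟩, rfl⟩
      have := hφ.pow f
      rw [aut_pow hF] at this
      simpa using this) hηirr (by
      intro n
      by_cases h : ∃ s, jN s = n
      · obtain ⟨s, rfl⟩ := h
        rw [← map_inv, hηS, hηS, hQinv]
      · rw [hη0 n h, hη0]
        rintro ⟨s, hs⟩
        exact h ⟨s⁻¹, by rw [map_inv, hs, inv_inv]⟩) (by
      intro σ
      refine ⟨1, fun n => ?_⟩
      rw [map_one, MulAut.one_apply]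
      by_cases h : ∃ s, jN s = n
      · obtain ⟨s, rfl⟩ := h
        rw [hηS, hQgal]
      · rw [hη0 n h, map_zero]) hη1 hev
  refine ⟨V, hV, hVq, hVe, ?_⟩
  have hψ : IsIrr V.character := ⟨V, hV, rfl⟩
  rw [frob jN χ (hψ.isChar.comp (NN G).subtype).classFn] at hVi
  obtain ⟨s, hs⟩ := not_const hχ hone.1 hVi
  refine ⟨jS hinn s, ⟨s, rfl⟩, ?_⟩
  simp only [map_one] at hs
  exact hs
end Case1

end PartP8

/-- For `S = PSL₂(3^f)` (`f ≥ 3` odd) and `Inn(S) < G ≤ Aut(S)`: `G` has a non-trivial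
rational element of odd order lying in `Inn(S)` if and only if `G` has a rational
irreducible character of even degree whose kernel does not contain `Inn(S)`. -/
theorem rational_element_iff_rational_char (f : ℕ) (hf : Odd f) (hf3 : 3 ≤ f)
    (G : Subgroup (MulAut (PSL2 (GaloisField 3 f))))
    (hG : innAut (PSL2 (GaloisField 3 f)) < G) :
    (∃ x : ↥G, (↑x : MulAut (PSL2 (GaloisField 3 f))) ∈ innAut (PSL2 (GaloisField 3 f)) ∧
        x ≠ 1 ∧ Odd (orderOf x) ∧ IsRationalElement x) ↔
      (∃ V : FDRep ℂ ↥G, Simple V ∧ (∀ g : ↥G, ∃ q : ℚ, V.character g = (q : ℂ)) ∧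
        Even (Module.finrank ℂ V) ∧
        ∃ g : ↥G, (↑g : MulAut (PSL2 (GaloisField 3 f))) ∈ innAut (PSL2 (GaloisField 3 f)) ∧
          V.character g ≠ V.character 1) := by
  classical
  letI : Fintype (GaloisField 3 f) := Fintype.ofFinite _
  letI : Fintype ↥G := Fintype.ofFinite _
  have hF : Fintype.card (GaloisField 3 f) = 3 ^ f := by
    rw [← Nat.card_eq_fintype_card, GaloisField.card 3 f (by omega)]
  have hneg := hneg_of (q_mod hf hF)
  have hinn := hG.le
  change LHS G ↔ RHS G
  by_cases h : ∃ (g : ↥G) (φ : _), Ty (g : MulAut (PSL2 (GaloisField 3 f))) (-1) φ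
  · obtain ⟨g1, φ, h1⟩ := h
    obtain ⟨g0, hg0⟩ := exists_g0 hinn hf hF h1
    exact ⟨fun _ => case1_rhs hinn hf hF hg0, fun _ => case1_lhs hinn hg0⟩
  · have hall : ∀ g : ↥G, ∃ φ, Ty (g : MulAut (PSL2 (GaloisField 3 f))) 1 φ := by
      intro g
      obtain ⟨e, φ, he⟩ := aut2 hneg (g : MulAut (PSL2 (GaloisField 3 f)))
      rcases Int.units_eq_one_or e with rfl | rfl
      · exact ⟨φ, he⟩
      · exact absurd ⟨g, φ, he⟩ h
    exact ⟨fun h1 => crit_rhs hinn hall hf hF (lhs_crit hinn hneg hall h1),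
      fun h2 => crit_lhs hinn (rhs_crit hinn hall hf hF h2)⟩
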